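/- Let G be a finitely generated group with infinitely many ends. Then the automorphism group Aut(G) is acylindrically hyperbolic. -/

import Mathlib

noncomputable section

open Metric Set

universe u v

/-- A geodesic metric space: any two points are joined by an isometrically
parametrized segment. -/
def GeodesicSpace (Y : Type*) [MetricSpace Y] : Prop :=
  ∀ x y : Y, ∃ f : ℝ → Y, f 0 = x ∧ f (dist x y) = y ∧
    ∀ s ∈ Set.Icc (0:ℝ) (dist x y), ∀ t ∈ Set.Icc (0:ℝ) (dist x y),
      dist (f s) (f t) = |s - t|

/-- Gromov hyperbolicity (four-point condition) with constant `δ`. -/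
def GromovHyperbolic (Y : Type*) [MetricSpace Y] (δ : ℝ) : Prop :=
  ∀ x y z w : Y, dist x y + dist z w ≤ max (dist x z + dist y w) (dist x w + dist y z) + 2 * δ

/-- A Gromov hyperbolic geodesic metric space. -/
def HyperbolicGeodesicSpace (Y : Type*) [MetricSpace Y] : Prop :=
  GeodesicSpace Y ∧ ∃ δ : ℝ, 0 ≤ δ ∧ GromovHyperbolic Y δ

/-- An isometric action `ρ` of `G` on `Y` is acylindrical if for every `R > 0` there are
`L > 0` and `N` such that for any two points at distance `> L`, at most `N` elements of `G`
move both points by less than `R`. -/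
def IsAcylindrical {G : Type*} [Group G] {Y : Type*} [MetricSpace Y] (ρ : G →* (Y ≃ᵢ Y)) : Prop :=
  ∀ R : ℝ, 0 < R → ∃ L : ℝ, 0 < L ∧ ∃ N : ℕ, ∀ x y : Y, L < dist x y →
    ∃ s : Finset G, s.card ≤ N ∧
      ∀ g : G, dist x (ρ g x) < R → dist y (ρ g y) < R → g ∈ s

/-- A group is virtually cyclic if it has a cyclic subgroup of finite index. -/
def VirtuallyCyclic (G : Type*) [Group G] : Prop :=
  ∃ H : Subgroup G, H.FiniteIndex ∧ IsCyclic ↥H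

/-- A group is acylindrically hyperbolic if it is not virtually cyclic and admits an
acylindrical isometric action with unbounded orbits on a Gromov hyperbolic geodesic space
(this is equivalent to admitting a nonelementary acylindrical action on such a space). -/
def AcylindricallyHyperbolic (G : Type u) [Group G] : Prop :=
  ¬ VirtuallyCyclic G ∧
    ∃ (Y : Type u) (_ : MetricSpace Y) (ρ : G →* (Y ≃ᵢ Y)),
      HyperbolicGeodesicSpace Y ∧ IsAcylindrical ρ ∧
      ∃ y : Y, ¬ Bornology.IsBounded (Set.range fun g : G => ρ g y)

/-- The Cayley graph of a group with respect to a generating set `S`. -/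
def cayleyGraph {G : Type*} [Group G] (S : Set G) : SimpleGraph G :=
  SimpleGraph.fromRel (fun x y => x⁻¹ * y ∈ S)

/-- A finitely generated group has infinitely many ends: the Cayley graph with respect
to any finite generating set has infinitely many ends. -/
def InfinitelyManyEnds (G : Type*) [Group G] : Prop :=
  ∀ S : Finset G, Subgroup.closure (S : Set G) = ⊤ →
    ((cayleyGraph (S : Set G)).end).Infinite



namespace AH
set_option linter.all false
structure MetFun {X : Type u} (D : X → X → ℝ) : Prop where
  self : ∀ x, D x x = 0
  symm : ∀ x y, D x y = D y x
  tri : ∀ x y z, D x z ≤ D x y + D y z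
structure IsExt {X : Type u} (D : X → X → ℝ) (f : X → ℝ) : Prop where
  adm : ∀ x y, D x y ≤ f x + f y
  ext : ∀ x, ∀ ε > 0, ∃ y, f x + f y ≤ D x y + ε
def Hull {X : Type u} (D : X → X → ℝ) : Type u := {f : X → ℝ // IsExt D f}
section hull
variable {X : Type u} {D : X → X → ℝ}
lemma IsExt.nonneg {f : X → ℝ} (h : MetFun D) (hf : IsExt D f) (x : X) : 0 ≤ f x := by
  have := hf.adm x x
  rw [h.self] at this; linarith
lemma IsExt.lip {f : X → ℝ} (h : MetFun D) (hf : IsExt D f) (x y : X) : f x ≤ D x y + f y := by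
  refine le_of_forall_pos_le_add fun ε hε => ?_
  obtain ⟨z, hz⟩ := hf.ext x ε hε
  have := h.tri x y z
  have := hf.adm y z
  linarith
lemma ext_sub_le {f g : X → ℝ} (h : MetFun D) (hf : IsExt D f) (hg : IsExt D g) (x0 x : X) :
    |f x - g x| ≤ f x0 + g x0 := by
  have h1 := hf.lip h x x0
  have h2 := hg.lip h x x0
  have h3 := hf.adm x x0
  have h4 := hg.adm x x0
  rw [abs_le]; constructor <;> linarith
def hdist (f g : Hull D) : ℝ := ⨆ x, |f.1 x - g.1 x|
lemma hdist_bdd (h : MetFun D) (f g : Hull D) : BddAbove (range fun x => |f.1 x - g.1 x|) := by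
  by_cases hX : Nonempty X
  · obtain ⟨x0⟩ := hX
    exact ⟨_, by rintro _ ⟨x, rfl⟩; exact ext_sub_le h f.2 g.2 x0 x⟩
  · exact ⟨0, by rintro _ ⟨x, rfl⟩; exact (hX ⟨x⟩).elim⟩
lemma le_hdist (h : MetFun D) (f g : Hull D) (x : X) : |f.1 x - g.1 x| ≤ hdist f g :=
  le_ciSup (hdist_bdd h f g) x
lemma hdist_le [Nonempty X] (f g : Hull D) {c : ℝ} (hc : ∀ x, |f.1 x - g.1 x| ≤ c) :
    hdist f g ≤ c := ciSup_le hc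
@[reducible] def hullMetric [Nonempty X] (h : MetFun D) : MetricSpace (Hull D) where
  dist := hdist
  dist_self f := by simp [hdist]
  dist_comm f g := by simp [hdist, abs_sub_comm]
  dist_triangle f g k := hdist_le _ _ fun x => by
    have := le_hdist h f g x
    have := le_hdist h g k x
    have := abs_sub_le (f.1 x) (g.1 x) (k.1 x)
    linarith
  eq_of_dist_eq_zero := by
    intro f g hfg
    apply Subtype.ext
    funext x
    have h1 := le_hdist h f g x
    have h2 : hdist f g = 0 := hfg
    rw [h2] at h1
    have := abs_nonpos_iff.1 h1
    linarith
def star (D : X → X → ℝ) (f : X → ℝ) (x : X) : ℝ := ⨆ y, (D x y - f y)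
def Adm (D : X → X → ℝ) (f : X → ℝ) : Prop := ∀ x y, D x y ≤ f x + f y
lemma star_bdd {f : X → ℝ} (hf : Adm D f) (x : X) : BddAbove (range fun y => D x y - f y) :=
  ⟨f x, by rintro _ ⟨y, rfl⟩; have := hf x y; simp only; linarith⟩
lemma le_star {f : X → ℝ} (hf : Adm D f) (x y : X) : D x y - f y ≤ star D f x :=
  le_ciSup (star_bdd hf x) y
lemma star_le [Nonempty X] {f : X → ℝ} (hf : Adm D f) (x : X) : star D f x ≤ f x :=
  ciSup_le fun y => by have := hf x y; linarith
def qq (D : X → X → ℝ) (f : X → ℝ) (x : X) : ℝ := (f x + star D f x) / 2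
lemma qq_adm (h : MetFun D) {f : X → ℝ} (hf : Adm D f) : Adm D (qq D f) := by
  intro x y
  have h1 := le_star hf x y
  have h2 := le_star hf y x
  rw [h.symm y x] at h2
  simp only [qq]; linarith
lemma qq_le [Nonempty X] {f : X → ℝ} (hf : Adm D f) (x : X) : qq D f x ≤ f x := by
  have := star_le hf x
  simp only [qq]; linarith
lemma star_close [Nonempty X] {f g : X → ℝ} (hf : Adm D f) {c : ℝ}
    (hc : ∀ x, f x ≤ g x + c) (x : X) : star D g x ≤ star D f x + c :=
  ciSup_le fun y => by have := le_star hf x y; have := hc y; linarith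
def qn (D : X → X → ℝ) (f : X → ℝ) (n : ℕ) : X → ℝ := (qq D)^[n] f
lemma qn_succ (f : X → ℝ) (n : ℕ) : qn D f (n+1) = qq D (qn D f n) :=
  Function.iterate_succ_apply' _ _ _
lemma qn_adm (h : MetFun D) {f : X → ℝ} (hf : Adm D f) (n : ℕ) : Adm D (qn D f n) := by
  induction n with
  | zero => exact hf
  | succ n ih => rw [qn_succ]; exact qq_adm h ih
lemma adm_nonneg (h : MetFun D) {f : X → ℝ} (hf : Adm D f) (x : X) : 0 ≤ f x := by
  have := hf x x
  rw [h.self] at this; linarith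
lemma qn_anti [Nonempty X] (h : MetFun D) {f : X → ℝ} (hf : Adm D f) (x : X) :
    Antitone fun n => qn D f n x :=
  antitone_nat_of_succ_le fun n => by rw [qn_succ]; exact qq_le (qn_adm h hf n) x
lemma qn_close [Nonempty X] (h : MetFun D) {f g : X → ℝ} (hf : Adm D f) (hg : Adm D g) {c : ℝ}
    (hc : ∀ x, |f x - g x| ≤ c) (n : ℕ) (x : X) : |qn D f n x - qn D g n x| ≤ c := by
  induction n generalizing x with
  | zero => exact hc x
  | succ n ih =>
    rw [qn_succ, qn_succ]
    have h1 := star_close (qn_adm h hf n) (c := c) (g := qn D g n)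
      (fun x => by have := abs_le.1 (ih x); linarith) x
    have h2 := star_close (qn_adm h hg n) (c := c) (g := qn D f n)
      (fun x => by have := abs_le.1 (ih x); linarith) x
    have h3 := abs_le.1 (ih x)
    simp only [qq]
    rw [abs_le]; constructor <;> linarith [h3.1, h3.2]
def pp (D : X → X → ℝ) (f : X → ℝ) (x : X) : ℝ := ⨅ n, qn D f n x
lemma pp_tendsto [Nonempty X] (h : MetFun D) {f : X → ℝ} (hf : Adm D f) (x : X) :
    Filter.Tendsto (fun n => qn D f n x) Filter.atTop (nhds (pp D f x)) :=
  tendsto_atTop_ciInf (qn_anti h hf x)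
    ⟨0, by rintro _ ⟨n, rfl⟩; exact adm_nonneg h (qn_adm h hf n) x⟩
lemma pp_le [Nonempty X] (h : MetFun D) {f : X → ℝ} (hf : Adm D f) (n : ℕ) (x : X) :
    pp D f x ≤ qn D f n x :=
  ciInf_le (f := fun n => qn D f n x)
    ⟨0, by rintro _ ⟨n, rfl⟩; exact adm_nonneg h (qn_adm h hf n) x⟩ n
lemma pp_ext [Nonempty X] (h : MetFun D) {f : X → ℝ} (hf : Adm D f) : IsExt D (pp D f) := by
  have hadm : Adm D (pp D f) := fun x y =>
    ge_of_tendsto' ((pp_tendsto h hf x).add (pp_tendsto h hf y)) fun n => qn_adm h hf n x y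
  refine ⟨hadm, fun x ε hε => ?_⟩
  have hst : Filter.Tendsto (fun n => star D (qn D f n) x) Filter.atTop (nhds (pp D f x)) := by
    have h1 := ((pp_tendsto h hf x).comp (Filter.tendsto_add_atTop_nat 1)).const_mul 2
    have h2 := h1.sub (pp_tendsto h hf x)
    have : 2 * pp D f x - pp D f x = pp D f x := by ring
    rw [this] at h2
    refine h2.congr fun n => ?_
    simp only [Function.comp, qn_succ, qq]; ring
  obtain ⟨n, hn⟩ := (hst.eventually (lt_mem_nhds (show pp D f x - ε / 2 < pp D f x by linarith))).exists
  obtain ⟨y, hy⟩ := exists_lt_of_lt_ciSup (show star D (qn D f n) x - ε/2 < ⨆ y, (D x y - qn D f n y)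
    by simp only [star]; linarith)
  refine ⟨y, ?_⟩
  have := pp_le h hf n y
  linarith
lemma pp_close [Nonempty X] (h : MetFun D) {f g : X → ℝ} (hf : Adm D f) (hg : Adm D g) {c : ℝ}
    (hc : ∀ x, |f x - g x| ≤ c) (x : X) : |pp D f x - pp D g x| ≤ c :=
  le_of_tendsto' ((pp_tendsto h hf x).sub (pp_tendsto h hg x)).abs
    fun n => qn_close h hf hg hc n x
lemma pp_of_ext [Nonempty X] {f : X → ℝ} (hf : IsExt D f) : pp D f = f := by
  have hs : qq D f = f := by
    funext x
    have h1 := star_le hf.adm x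
    have h2 : f x ≤ star D f x := by
      refine le_of_forall_pos_le_add fun ε hε => ?_
      obtain ⟨y, hy⟩ := hf.ext x ε hε
      have := le_star hf.adm x y
      linarith
    simp only [qq]; linarith
  have : ∀ n, qn D f n = f := fun n => by
    induction n with
    | zero => rfl
    | succ n ih => rw [qn_succ, ih, hs]
  funext x
  simp [pp, this]
lemma hull_geodesic [Nonempty X] (h : MetFun D) : @GeodesicSpace (Hull D) (hullMetric h) := by
  letI := hullMetric h
  intro f g
  set ℓ := dist f g with hℓ
  have hdist0 : ∀ a b : Hull D, dist a b = hdist a b := fun _ _ => rfl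
  rcases eq_or_lt_of_le (dist_nonneg : 0 ≤ dist f g) with h0 | hpos
  · refine ⟨fun _ => f, rfl, dist_eq_zero.1 h0.symm, ?_⟩
    intro s hs t ht
    rw [hℓ, ← h0] at hs ht
    have : s = 0 := le_antisymm hs.2 hs.1
    have : t = 0 := le_antisymm ht.2 ht.1
    subst s t
    simp
  · let sg : ℝ → X → ℝ := fun t x =>
      (1 - max 0 (min t ℓ) / ℓ) * f.1 x + (max 0 (min t ℓ) / ℓ) * g.1 x
    have hr : ∀ t, 0 ≤ max 0 (min t ℓ) / ℓ ∧ max 0 (min t ℓ) / ℓ ≤ 1 := fun t =>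
      ⟨div_nonneg (le_max_left _ _) hpos.le, (div_le_one hpos).2 (max_le hpos.le (min_le_right _ _))⟩
    have hadm : ∀ t, Adm D (sg t) := fun t x y => by
      have h1 := f.2.adm x y
      have h2 := g.2.adm x y
      obtain ⟨h3, h4⟩ := hr t
      simp only [sg]
      set r := max 0 (min t ℓ) / ℓ
      nlinarith [mul_le_mul_of_nonneg_left h2 h3, mul_le_mul_of_nonneg_left h1 (sub_nonneg.2 h4)]
    let γ : ℝ → Hull D := fun t => ⟨pp D (sg t), pp_ext h (hadm t)⟩
    have hcl : ∀ s ∈ Icc (0:ℝ) ℓ, ∀ t ∈ Icc (0:ℝ) ℓ, dist (γ s) (γ t) ≤ |s - t| := by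
      intro s hs t ht
      refine hdist_le _ _ fun x => pp_close h (hadm s) (hadm t) (fun x => ?_) x
      simp only [sg]
      rw [min_eq_left hs.2, min_eq_left ht.2, max_eq_right hs.1, max_eq_right ht.1]
      have h1 := le_hdist h f g x
      have h2 : hdist f g = ℓ := rfl
      rw [h2] at h1
      have : (1 - s / ℓ) * f.1 x + s / ℓ * g.1 x - ((1 - t / ℓ) * f.1 x + t / ℓ * g.1 x)
        = (t - s) * ((f.1 x - g.1 x) / ℓ) := by field_simp; ring
      rw [this, abs_mul, abs_div, abs_of_pos hpos, abs_sub_comm s t]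
      exact mul_le_of_le_one_right (abs_nonneg _) ((div_le_one hpos).2 h1)
    have e0 : γ 0 = f := by
      apply Subtype.ext
      show pp D (sg 0) = f.1
      have : sg 0 = f.1 := by funext x; simp [sg, hpos.le]
      rw [this, pp_of_ext f.2]
    have e1 : γ ℓ = g := by
      apply Subtype.ext
      show pp D (sg ℓ) = g.1
      have : sg ℓ = g.1 := by
        funext x
        have e : max 0 ℓ = ℓ := max_eq_right hpos.le
        have e2 : ℓ / ℓ = 1 := div_self hpos.ne'
        simp [sg, e, e2]
      rw [this, pp_of_ext g.2]
    refine ⟨γ, e0, e1, ?_⟩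
    have key : ∀ s ∈ Icc (0:ℝ) ℓ, ∀ t ∈ Icc (0:ℝ) ℓ, s ≤ t → dist (γ s) (γ t) = t - s := by
      intro s hs t ht hst
      have h1 := hcl s hs t ht
      have h2 := hcl 0 ⟨le_rfl, hpos.le⟩ s hs
      have h3 := hcl t ht ℓ ⟨hpos.le, le_rfl⟩
      rw [e0] at h2
      rw [e1] at h3
      rw [abs_sub_comm, abs_of_nonneg (by linarith)] at h1
      rw [abs_sub_comm, abs_of_nonneg (by linarith [hs.1])] at h2
      rw [abs_sub_comm, abs_of_nonneg (by linarith [ht.2])] at h3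
      have h4 := dist_triangle4 f (γ s) (γ t) g
      apply le_antisymm h1
      linarith
    intro s hs t ht
    rcases le_total s t with hst | hst
    · rw [key s hs t ht hst, abs_sub_comm, abs_of_nonneg (by linarith)]
    · rw [dist_comm, key t ht s hs hst, abs_of_nonneg (by linarith)]
lemma hdist_approx [Nonempty X] (f g : Hull D) (h : MetFun D) {ε : ℝ} (hε : 0 < ε) :
    ∃ x y, hdist f g ≤ D x y - f.1 x - g.1 y + ε := by
  obtain ⟨x, hx⟩ := exists_lt_of_lt_ciSup (show hdist f g - ε/2 < ⨆ x, |f.1 x - g.1 x|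
    by simp only [hdist]; linarith)
  rcases abs_cases (f.1 x - g.1 x) with ⟨h1, _⟩ | ⟨h1, _⟩
  · obtain ⟨y, hy⟩ := f.2.ext x (ε/2) (by linarith)
    refine ⟨y, x, ?_⟩
    rw [h.symm]; linarith
  · obtain ⟨y, hy⟩ := g.2.ext x (ε/2) (by linarith)
    exact ⟨x, y, by linarith⟩
lemma le_hdist2 (h : MetFun D) (f g : Hull D) (x y : X) : D x y ≤ f.1 x + g.1 y + hdist f g := by
  have h1 := f.2.adm x y
  have := abs_le.1 (le_hdist h f g y)
  linarith [this.2]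
def FourPt (D : X → X → ℝ) (δ : ℝ) : Prop :=
  ∀ x y z w, D x y + D z w ≤ max (D x z + D y w) (D x w + D y z) + 2 * δ
lemma hull_hyp [Nonempty X] (h : MetFun D) {δ : ℝ} (h4 : FourPt D δ) :
    @GromovHyperbolic (Hull D) (hullMetric h) δ := by
  letI := hullMetric h
  intro f g k l
  refine le_of_forall_pos_le_add fun ε hε => ?_
  obtain ⟨x, y, hxy⟩ := hdist_approx f g h (half_pos hε)
  obtain ⟨z, w, hzw⟩ := hdist_approx k l h (half_pos hε)
  show hdist f g + hdist k l ≤ max (hdist f k + hdist g l) (hdist f l + hdist g k) + 2 * δ + ε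
  have h1 := h4 x y z w
  have a1 := le_hdist2 h f k x z
  have a2 := le_hdist2 h g l y w
  have a3 := le_hdist2 h f l x w
  have a4 := le_hdist2 h g k y z
  rcases le_total (D x z + D y w) (D x w + D y z) with h2 | h2
  · rw [max_eq_right h2] at h1
    have := le_max_right (hdist f k + hdist g l) (hdist f l + hdist g k)
    linarith
  · rw [max_eq_left h2] at h1
    have := le_max_left (hdist f k + hdist g l) (hdist f l + hdist g k)
    linarith
def emb (h : MetFun D) (z : X) : Hull D :=
  ⟨fun x => D x z, fun x y => by have := h.tri x z y; rwa [h.symm z y] at this,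
    fun x ε hε => ⟨z, by simp only [h.self]; linarith⟩⟩
lemma dist_emb [Nonempty X] (h : MetFun D) (f : Hull D) (z : X) : hdist f (emb h z) ≤ f.1 z :=
  hdist_le _ _ fun x => by
    have h1 := f.2.lip h x z
    have h2 := f.2.adm x z
    simp only [emb]
    rw [abs_le]; constructor <;> linarith
def RoughGeod (D : X → X → ℝ) (C : ℝ) : Prop :=
  ∀ x y r, 0 ≤ r → r ≤ D x y → ∃ z, |D x z - r| ≤ C ∧ D x z + D z y ≤ D x y + C
lemma hull_dense [Nonempty X] (h : MetFun D) {δ C : ℝ} (h4 : FourPt D δ) (hC : RoughGeod D C)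
    (f : Hull D) : ∃ z, f.1 z ≤ 3 + 2 * C + 2 * δ := by
  obtain ⟨x⟩ := ‹Nonempty X›
  have : Nonempty X := ⟨x⟩
  obtain ⟨y, hy⟩ := f.2.ext x 1 one_pos
  have hnx := f.2.nonneg h x
  have hny := f.2.nonneg h y
  have hD0 : 0 ≤ D x y := by
    have := h.tri x y x; rw [h.self, h.symm y x] at this; linarith
  obtain ⟨z, hz1, hz2⟩ := hC x y (min (f.1 x) (D x y)) (le_min hnx hD0) (min_le_right _ _)
  refine ⟨z, ?_⟩
  obtain ⟨w, hw⟩ := f.2.ext z 1 one_pos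
  have hr1 : min (f.1 x) (D x y) ≤ f.1 x := min_le_left _ _
  have hr2 : f.1 x - 1 ≤ min (f.1 x) (D x y) := le_min (by linarith) (by linarith)
  have hz1' := abs_le.1 hz1
  have hC0 : 0 ≤ C := (abs_nonneg _).trans hz1
  have e := h4 z w x y
  rw [h.symm z x] at e
  have a1 := f.2.adm w y
  have a2 := f.2.adm w x
  have a3 := f.2.adm x y
  rcases le_total (D x z + D w y) (D z y + D w x) with h2 | h2
  · rw [max_eq_right h2] at e; linarith [hz1'.1, hz1'.2]
  · rw [max_eq_left h2] at e; linarith [hz1'.1, hz1'.2]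
theorem hull_criterion {A : Type u} [Group A] [MulAction A X] [Nonempty X]
    (h : MetFun D) {δ C : ℝ} (hδ : 0 ≤ δ) (h4 : FourPt D δ) (hC : RoughGeod D C)
    (hinv : ∀ (a : A) x y, D (a • x) (a • y) = D x y)
    (hac : ∀ R : ℝ, ∃ L : ℝ, ∃ N : ℕ, ∀ x y : X, L < D x y →
      ∃ s : Finset A, s.card ≤ N ∧ ∀ a : A, D x (a • x) < R → D y (a • y) < R → a ∈ s)
    (x0 : X) (hub : ∀ r : ℝ, ∃ a : A, r < D x0 (a • x0)) :
    ∃ (Y : Type u) (_ : MetricSpace Y) (ρ : A →* (Y ≃ᵢ Y)),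
      HyperbolicGeodesicSpace Y ∧ IsAcylindrical ρ ∧
      ∃ y : Y, ¬ Bornology.IsBounded (Set.range fun g : A => ρ g y) := by
  letI M := hullMetric h
  have hd : ∀ f g : Hull D, dist f g = hdist f g := fun _ _ => rfl
  let act : A → Hull D → Hull D := fun a f => ⟨fun x => f.1 (a⁻¹ • x),
    fun x y => by rw [← hinv a⁻¹]; exact f.2.adm _ _,
    fun x ε hε => by
      obtain ⟨y, hy⟩ := f.2.ext (a⁻¹ • x) ε hε
      refine ⟨a • y, ?_⟩
      simp only [inv_smul_smul]
      rwa [← hinv a⁻¹ x, inv_smul_smul]⟩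
  have act_mul : ∀ a b f, act (a * b) f = act a (act b f) := fun a b f => by
    apply Subtype.ext; funext x; simp [act, mul_smul]
  have act_one : ∀ f, act 1 f = f := fun f => by
    apply Subtype.ext; funext x; simp [act]
  have act_le : ∀ a f g, hdist (act a f) (act a g) ≤ hdist f g := fun a f g =>
    hdist_le _ _ fun x => le_hdist h f g (a⁻¹ • x)
  have act_iso : ∀ a, Isometry (act a) := fun a => Isometry.of_dist_eq fun f g => by
    apply le_antisymm (act_le a f g)
    have := act_le a⁻¹ (act a f) (act a g)
    rwa [← act_mul, ← act_mul, inv_mul_cancel, act_one, act_one] at this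
  let ρ : A →* (Hull D ≃ᵢ Hull D) :=
    { toFun := fun a => ⟨⟨act a, act a⁻¹, fun f => by rw [← act_mul]; simp [act_one],
        fun f => by rw [← act_mul]; simp [act_one]⟩, act_iso a⟩
      map_one' := by ext1 f; exact act_one f
      map_mul' := fun a b => by ext1 f; exact act_mul a b f }
  have hρ : ∀ a f, ρ a f = act a f := fun _ _ => rfl
  have hemb : ∀ a z, act a (emb h z) = emb h (a • z) := fun a z => by
    apply Subtype.ext; funext x
    simp only [act, emb]
    rw [← hinv a, smul_inv_smul]
  have hde : ∀ z w, hdist (emb h z) (emb h w) = D z w := fun z w => by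
    apply le_antisymm
    · exact (dist_emb h (emb h z) w).trans (h.symm w z).le
    · have := le_hdist h (emb h z) (emb h w) w
      simp only [emb, h.self, sub_zero] at this
      rw [h.symm z w]; exact (le_abs_self _).trans this
  refine ⟨Hull D, M, ρ, ⟨hull_geodesic h, δ, hδ, hull_hyp h h4⟩, ?_, emb h x0, ?_⟩
  · intro R hR
    set K := 3 + 2 * C + 2 * δ with hK
    obtain ⟨L, N, hLN⟩ := hac (R + 2 * K)
    refine ⟨max 1 (L + 2 * K), lt_max_of_lt_left one_pos, N, fun f g hfg => ?_⟩
    obtain ⟨z, hz⟩ := hull_dense h h4 hC f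
    obtain ⟨w, hw⟩ := hull_dense h h4 hC g
    have hz' : dist f (emb h z) ≤ K := (dist_emb h f z).trans hz
    have hw' : dist g (emb h w) ≤ K := (dist_emb h g w).trans hw
    have mv : ∀ (f : Hull D) z a, dist f (emb h z) ≤ K → dist f (ρ a f) < R →
        D z (a • z) < R + 2 * K := by
      intro f z a h1 h2
      rw [← hde, ← hd, ← hemb]
      have h3 : dist (act a f) (act a (emb h z)) ≤ K := by rw [(act_iso a).dist_eq]; exact h1
      rw [hρ] at h2
      have := dist_triangle4 (emb h z) f (act a f) (act a (emb h z))
      rw [dist_comm (emb h z) f] at this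
      linarith
    obtain ⟨s, hs, hs'⟩ := hLN z w (by
      rw [← hde, ← hd]
      have := dist_triangle4 f (emb h z) (emb h w) g
      rw [dist_comm (emb h w) g] at this
      have := (max_lt_iff.1 hfg).2
      linarith)
    exact ⟨s, hs, fun a h1 h2 => hs' a (mv f z a hz' h1) (mv g w a hw' h2)⟩
  · intro hb
    obtain ⟨r, hr⟩ := Metric.isBounded_iff.1 hb
    obtain ⟨a, ha⟩ := hub r
    have := hr (mem_range_self 1) (mem_range_self a)
    simp only [hρ, act_one, hemb] at this
    rw [hd, hde] at this
    linarith
end hull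
structure WallSys (A X W : Type u) [Group A] [MulAction A X] [MulAction A W] where
  neg : W → Set X
  pos : W → Set X
  flip : W → W
  lt : W → W → Prop
  B : ℕ
  p : W → X
  disj : ∀ w x, x ∈ neg w → x ∉ pos w
  neg_smul : ∀ (a : A) (w : W) (x : X), a • x ∈ neg (a • w) ↔ x ∈ neg w
  pos_smul : ∀ (a : A) (w : W) (x : X), a • x ∈ pos (a • w) ↔ x ∈ pos w
  lt_smul : ∀ (a : A) w w', lt (a • w) (a • w') ↔ lt w w'
  flip_flip : ∀ w, flip (flip w) = w
  neg_flip : ∀ w, neg (flip w) = pos w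
  irrefl : ∀ w, ¬ lt w w
  trans : ∀ a b c, lt a b → lt b c → lt a c
  ax3 : ∀ a b c, lt a b → lt b c → ∀ y, y ∈ pos a ∨ y ∈ neg c
  fin4 : ∀ a, {b | (∃ x y, (x ∈ neg a ∧ y ∈ pos a) ∧ (x ∈ neg b ∧ y ∈ pos b)) ∧ ¬ lt a b ∧ ¬ lt b a}.Finite
  ax4 : ∀ a, {b | (∃ x y, (x ∈ neg a ∧ y ∈ pos a) ∧ (x ∈ neg b ∧ y ∈ pos b)) ∧ ¬ lt a b ∧ ¬ lt b a}.ncard ≤ B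
  fin5 : ∀ x y, {a | x ∈ neg a ∧ y ∈ pos a}.Finite
  ax6p : ∀ a b, lt a b → pos b ⊆ pos a
  ax6n : ∀ a b, lt a b → neg a ⊆ neg b
  ax7 : ∀ w x y c, x ∈ neg w → y ∈ pos w → x ∈ neg c → y ∈ neg c → p w ∉ pos c
  ax7p : ∀ w c, lt c w → p w ∈ pos c
  ax7n : ∀ w c, lt w c → p w ∈ neg c
  free : ∀ (a : A) (w : W), a • w = w → a = 1
namespace WallSys
variable {A X W : Type u} [Group A] [MulAction A X] [MulAction A W] (S : WallSys A X W)
lemma pos_flip (w) : S.pos (S.flip w) = S.neg w := by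
  rw [← S.neg_flip, S.flip_flip]
def Sep (x y : X) : Set W := {a | x ∈ S.neg a ∧ y ∈ S.pos a}
def d (x y : X) : ℕ := (S.Sep x y).ncard
lemma sep_fin (x y) : (S.Sep x y).Finite := S.fin5 x y
lemma flip_inj : Function.Injective S.flip := fun a b h => by
  rw [← S.flip_flip a, h, S.flip_flip]
lemma sep_flip (x y) : S.flip '' (S.Sep x y) = S.Sep y x := by
  ext a; constructor
  · rintro ⟨b, ⟨h1, h2⟩, rfl⟩
    exact ⟨by rwa [S.neg_flip], by rwa [S.pos_flip]⟩
  · rintro ⟨h1, h2⟩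
    exact ⟨S.flip a, ⟨by rwa [S.neg_flip], by rwa [S.pos_flip]⟩, S.flip_flip a⟩
lemma d_symm (x y) : S.d x y = S.d y x := by
  rw [d, d, ← S.sep_flip x y, ncard_image_of_injective _ S.flip_inj]
lemma d_self (x) : S.d x x = 0 := by
  have : S.Sep x x = ∅ := by
    ext a; simp only [mem_empty_iff_false, iff_false]
    exact fun h => S.disj _ _ h.1 h.2
  rw [d, this, ncard_empty]
lemma sep_smul (a : A) (x y w) : a • w ∈ S.Sep (a • x) (a • y) ↔ w ∈ S.Sep x y := by
  simp only [Sep, mem_setOf_eq, S.neg_smul, S.pos_smul]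
lemma d_smul (a : A) (x y) : S.d (a • x) (a • y) = S.d x y := by
  have : (fun w => a • w) '' (S.Sep x y) = S.Sep (a • x) (a • y) := by
    ext w; constructor
    · rintro ⟨v, hv, rfl⟩; exact (S.sep_smul a x y v).2 hv
    · intro h
      refine ⟨a⁻¹ • w, ?_, by simp⟩
      rw [← S.sep_smul a, smul_inv_smul]; exact h
  rw [d, d, ← this, ncard_image_of_injective _ (MulAction.injective a)]
lemma antichain_le {x y a} (ha : a ∈ S.Sep x y) {T : Set W} (hT : T ⊆ S.Sep x y)
    (h : ∀ b ∈ T, ¬ S.lt a b ∧ ¬ S.lt b a) : T.ncard ≤ S.B :=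
  le_trans (ncard_le_ncard (fun b hb => show _ ∧ _ from ⟨⟨x, y, ha, hT hb⟩, h b hb⟩) (S.fin4 a)) (S.ax4 a)
lemma bad_le {x z} {T : Set W} (hT : T ⊆ S.Sep x z)
    (h3 : ∀ a ∈ T, ∀ b ∈ T, ∀ c ∈ T, S.lt a b → ¬ S.lt b c) : T.ncard ≤ 2 * S.B := by
  have hTf := (S.sep_fin x z).subset hT
  set T1 := {b ∈ T | ∃ a ∈ T, S.lt a b}
  set T2 := {b ∈ T | ¬ ∃ a ∈ T, S.lt a b}
  have hu : T = T1 ∪ T2 := by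
    ext b; simp only [T1, T2, mem_union, mem_sep_iff]; rw [← and_or_left]; exact ⟨fun h => ⟨h, em _⟩, fun h => h.1⟩
  have h1 : T1.ncard ≤ S.B := by
    rcases T1.eq_empty_or_nonempty with h | ⟨m, hm⟩
    · rw [h]; simp
    · refine S.antichain_le (hT hm.1) (fun b hb => hT hb.1) fun b hb => ⟨fun h => ?_, fun h => ?_⟩
      · obtain ⟨a, ha, hab⟩ := hm.2
        exact h3 a ha m hm.1 b hb.1 hab h
      · obtain ⟨a, ha, hab⟩ := hb.2
        exact h3 a ha b hb.1 m hm.1 hab h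
  have h2 : T2.ncard ≤ S.B := by
    rcases T2.eq_empty_or_nonempty with h | ⟨m, hm⟩
    · rw [h]; simp
    · exact S.antichain_le (hT hm.1) (fun b hb => hT hb.1) fun b hb =>
        ⟨fun h => hb.2 ⟨m, hm.1, h⟩, fun h => hm.2 ⟨b, hb.1, h⟩⟩
  have := ncard_union_le T1 T2
  rw [← hu] at this; omega
def Bad (x z y : X) : Set W := {a ∈ S.Sep x z | y ∉ S.pos a ∧ y ∉ S.neg a}
lemma Bad_le (x z y) : (S.Bad x z y).ncard ≤ 2 * S.B :=
  S.bad_le (x := x) (z := z) (fun a ha => ha.1) fun a ha b hb c hc hab hbc => by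
    rcases S.ax3 a b c hab hbc y with h | h
    · exact ha.2.1 h
    · exact hc.2.2 h
lemma Bad_fin (x z y) : (S.Bad x z y).Finite := (S.sep_fin x z).subset fun a ha => ha.1
lemma d_tri (x y z) : S.d x z ≤ S.d x y + S.d y z + 2 * S.B := by
  have hsub : S.Sep x z ⊆ S.Sep x y ∪ S.Sep y z ∪ S.Bad x z y := by
    intro a ha
    by_cases h1 : y ∈ S.pos a
    · exact Or.inl (Or.inl ⟨ha.1, h1⟩)
    by_cases h2 : y ∈ S.neg a
    · exact Or.inl (Or.inr ⟨h2, ha.2⟩)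
    · exact Or.inr ⟨ha, h1, h2⟩
  have h1 := ncard_le_ncard hsub (((S.sep_fin x y).union (S.sep_fin y z)).union (S.Bad_fin x z y))
  have h2 := ncard_union_le (S.Sep x y ∪ S.Sep y z) (S.Bad x z y)
  have h3 := ncard_union_le (S.Sep x y) (S.Sep y z)
  have := S.Bad_le x z y
  simp only [d]; omega
def Q (x z y w : X) : Set W := {a | (x ∈ S.neg a ∧ z ∈ S.neg a) ∧ (y ∈ S.pos a ∧ w ∈ S.pos a)}
def Sg (x y z w : X) : Set W := {a | x ∈ S.neg a ∧ (y ∈ S.pos a ∧ z ∈ S.pos a ∧ w ∈ S.pos a)}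
lemma Q_fin (x z y w) : (S.Q x z y w).Finite := (S.sep_fin x y).subset fun a h => ⟨h.1.1, h.2.1⟩
lemma Sg_fin (x z y w) : (S.Sg x z y w).Finite := (S.sep_fin x z).subset fun a h => ⟨h.1, h.2.1⟩
lemma Q_flip (x z y w) : (S.Q x z y w).ncard = (S.Q y w x z).ncard := by
  have : S.flip '' (S.Q x z y w) = S.Q y w x z := by
    ext a; constructor
    · rintro ⟨b, h, rfl⟩
      simp only [Q, mem_setOf_eq, S.neg_flip, S.pos_flip] at h ⊢; tauto
    · intro h
      refine ⟨S.flip a, ?_, S.flip_flip a⟩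
      simp only [Q, mem_setOf_eq, S.neg_flip, S.pos_flip] at h ⊢; tauto
  rw [← this, ncard_image_of_injective _ S.flip_inj]
lemma Q_swap (x z y w) : S.Q x z y w = S.Q z x w y := by
  ext a; simp only [Q, mem_setOf_eq]; tauto
def Sg' (x y z w : X) : Set W := {a | x ∈ S.pos a ∧ (y ∈ S.neg a ∧ z ∈ S.neg a ∧ w ∈ S.neg a)}
lemma Sg'_card (x y z w) : (S.Sg' x y z w).ncard = (S.Sg x y z w).ncard := by
  have : S.flip '' (S.Sg x y z w) = S.Sg' x y z w := by
    ext a; constructor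
    · rintro ⟨b, h, rfl⟩
      simp only [Sg, Sg', mem_setOf_eq, S.neg_flip, S.pos_flip] at h ⊢; tauto
    · intro h
      refine ⟨S.flip a, ?_, S.flip_flip a⟩
      simp only [Sg, Sg', mem_setOf_eq, S.neg_flip, S.pos_flip] at h ⊢; tauto
  rw [← this, ncard_image_of_injective _ S.flip_inj]
lemma d_upper (x y z w) : S.d x y ≤ 4 * S.B + (S.Sg x y z w).ncard + (S.Sg y x z w).ncard
    + (S.Q x z y w).ncard + (S.Q x w y z).ncard := by
  have hsub : S.Sep x y ⊆ S.Bad x y z ∪ S.Bad x y w ∪ S.Sg x y z w ∪ S.Sg' y x z w ∪ S.Q x z y w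
      ∪ S.Q x w y z := by
    intro a ha
    have := ha.1
    have := ha.2
    simp only [mem_union, Bad, Sg, Sg', Q, mem_setOf_eq]
    tauto
  have hf := ((((((S.Bad_fin x y z).union (S.Bad_fin x y w)).union (S.Sg_fin x y z w)).union
    ((S.sep_fin x y).subset (show S.Sg' y x z w ⊆ _ from fun a h => ⟨h.2.1, h.1⟩))).union (S.Q_fin x z y w)).union
      (S.Q_fin x w y z))
  have h0 := ncard_le_ncard hsub hf
  have h1 := ncard_union_le (S.Bad x y z ∪ S.Bad x y w ∪ S.Sg x y z w ∪ S.Sg' y x z w ∪ S.Q x z y w) (S.Q x w y z)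
  have h2 := ncard_union_le (S.Bad x y z ∪ S.Bad x y w ∪ S.Sg x y z w ∪ S.Sg' y x z w) (S.Q x z y w)
  have h3 := ncard_union_le (S.Bad x y z ∪ S.Bad x y w ∪ S.Sg x y z w) (S.Sg' y x z w)
  have h4 := ncard_union_le (S.Bad x y z ∪ S.Bad x y w) (S.Sg x y z w)
  have h5 := ncard_union_le (S.Bad x y z) (S.Bad x y w)
  have h6 := S.Bad_le x y z
  have h7 := S.Bad_le x y w
  have h8 := S.Sg'_card y x z w
  simp only [d]; omega
lemma d_lower (x y z w) : (S.Sg x y z w).ncard + (S.Sg y x z w).ncard + (S.Q x z y w).ncard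
    ≤ S.d x y := by
  rw [← S.Sg'_card y]
  have hb : (S.Sg' y x z w).Finite :=
    (S.sep_fin x y).subset (show S.Sg' y x z w ⊆ _ from fun a h => ⟨h.2.1, h.1⟩)
  have hd1 : Disjoint (S.Sg x y z w) (S.Sg' y x z w) := by
    rw [Set.disjoint_left]; intro a h1 h2
    exact S.disj _ _ h2.2.2.1 h1.2.2.1
  have hd2 : Disjoint (S.Sg x y z w ∪ S.Sg' y x z w) (S.Q x z y w) := by
    rw [Set.disjoint_left]; rintro a (h1 | h1) h2
    · exact S.disj _ _ h2.1.2 h1.2.2.1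
    · exact S.disj _ _ h1.2.2.2 h2.2.2
  rw [← ncard_union_eq hd1 (S.Sg_fin _ _ _ _) hb, ← ncard_union_eq hd2
    ((S.Sg_fin _ _ _ _).union hb) (S.Q_fin _ _ _ _)]
  refine ncard_le_ncard ?_ (S.sep_fin x y)
  rintro a ((h | h) | h)
  · exact ⟨h.1, h.2.1⟩
  · exact ⟨h.2.1, h.1⟩
  · exact ⟨h.1.1, h.2.1⟩
lemma d_four (x y z w) : S.d x y + S.d z w ≤
    max (S.d x z + S.d y w) (S.d x w + S.d y z) + 10 * S.B := by
  have u1 := S.d_upper x y z w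
  have u2 := S.d_upper z w x y
  have l1 := S.d_lower x z w y
  have l2 := S.d_lower y w z x
  have l3 := S.d_lower x w z y
  have l4 := S.d_lower y z w x
  have e1 : S.Sg x z w y = S.Sg x y z w := by ext; simp only [Sg, mem_setOf_eq]; tauto
  have e2 : S.Sg x w z y = S.Sg x y z w := by ext; simp only [Sg, mem_setOf_eq]; tauto
  have e3 : S.Sg y w z x = S.Sg y x z w := by ext; simp only [Sg, mem_setOf_eq]; tauto
  have e4 : S.Sg y z w x = S.Sg y x z w := by ext; simp only [Sg, mem_setOf_eq]; tauto
  have e5 : S.Sg z x w y = S.Sg z w x y := by ext; simp only [Sg, mem_setOf_eq]; tauto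
  have e6 : S.Sg z y w x = S.Sg z w x y := by ext; simp only [Sg, mem_setOf_eq]; tauto
  have e7 : S.Sg w y z x = S.Sg w z x y := by ext; simp only [Sg, mem_setOf_eq]; tauto
  have e8 : S.Sg w x z y = S.Sg w z x y := by ext; simp only [Sg, mem_setOf_eq]; tauto
  have q1 : (S.Q z x w y).ncard = (S.Q x z y w).ncard := by rw [S.Q_swap]
  have q2 : (S.Q z y w x).ncard = (S.Q x w y z).ncard := by rw [S.Q_flip, S.Q_swap]
  have q3 : (S.Q x w z y).ncard = (S.Q x w y z).ncard := by
    congr 1; ext; simp only [Q, mem_setOf_eq]; tauto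
  have q4 : (S.Q y z w x).ncard = (S.Q x w y z).ncard := by
    rw [S.Q_flip]; congr 1; ext; simp only [Q, mem_setOf_eq]; tauto
  have q5 : (S.Q x z w y).ncard = (S.Q x z y w).ncard := by
    congr 1; ext; simp only [Q, mem_setOf_eq]; tauto
  have q6 : (S.Q y w z x).ncard = (S.Q x z y w).ncard := by
    rw [S.Q_flip]; congr 1; ext; simp only [Q, mem_setOf_eq]; tauto
  rw [e1, e5, q3] at l1
  rw [e3, e7, q4] at l2
  rw [e2, e8, q5] at l3
  rw [e4, e6, q6] at l4
  rw [q1, q2] at u2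
  have key : (S.Q x z y w).ncard ≤ S.B ∨ (S.Q x w y z).ncard ≤ S.B := by
    rcases (S.Q x w y z).eq_empty_or_nonempty with h | ⟨b, hb⟩
    · right; rw [h]; simp
    · left
      refine S.antichain_le (x := x) (y := y) (a := b) ⟨hb.1.1, hb.2.1⟩
        (fun a h => ⟨h.1.1, h.2.1⟩) fun a ha => ⟨fun h => ?_, fun h => ?_⟩
      · exact S.disj _ _ (S.ax6n _ _ h hb.1.2) ha.2.2
      · exact S.disj _ _ (S.ax6n _ _ h ha.1.2) hb.2.2
  have := le_max_left (S.d x z + S.d y w) (S.d x w + S.d y z)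
  have := le_max_right (S.d x z + S.d y w) (S.d x w + S.d y z)
  omega
def Below (x y : X) (α : W) : Set W := {c ∈ S.Sep x y | S.lt c α}
def Above (x y : X) (α : W) : Set W := {c ∈ S.Sep x y | S.lt α c}
def rank (x y : X) (α : W) : ℕ := (S.Below x y α).ncard
lemma below_fin (x y α) : (S.Below x y α).Finite := (S.sep_fin x y).subset fun _ h => h.1
lemma above_fin (x y α) : (S.Above x y α).Finite := (S.sep_fin x y).subset fun _ h => h.1
def Inc (x y : X) (α : W) : Set W := {c ∈ S.Sep x y | ¬ S.lt α c ∧ ¬ S.lt c α}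
lemma inc_fin (x y α) : (S.Inc x y α).Finite := (S.sep_fin x y).subset fun _ h => h.1
lemma inc_le {x y α} (h : α ∈ S.Sep x y) : (S.Inc x y α).ncard ≤ S.B :=
  S.antichain_le h (fun b hb => hb.1) fun b hb => hb.2
lemma rank_lt {x y α β} (hα : α ∈ S.Sep x y) (h : S.lt α β) : S.rank x y α < S.rank x y β := by
  refine ncard_lt_ncard ⟨fun c hc => ⟨hc.1, S.trans _ _ _ hc.2 h⟩, fun hs => ?_⟩ (S.below_fin x y β)
  exact S.irrefl α (hs (⟨hα, h⟩ : α ∈ S.Below x y β)).2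
lemma low_le {x y} {T : Set W} (hT : T ⊆ S.Sep x y) {K : ℕ} (hK : ∀ a ∈ T, S.rank x y a ≤ K) :
    T.ncard ≤ K + S.B ∧ (T.Nonempty → ∃ a ∈ T, T.ncard ≤ S.rank x y a + S.B) := by
  have hTf := (S.sep_fin x y).subset hT
  have key : T.Nonempty → ∃ a ∈ T, T.ncard ≤ S.rank x y a + S.B := by
    intro hne
    obtain ⟨a, ha, hmax⟩ := Set.exists_max_image T (S.rank x y) hTf hne
    refine ⟨a, ha, ?_⟩
    have hsub : T ⊆ S.Below x y a ∪ S.Inc x y a := by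
      intro c hc
      by_cases h : S.lt c a
      · exact Or.inl ⟨hT hc, h⟩
      · refine Or.inr ⟨hT hc, fun h' => ?_, h⟩
        have := S.rank_lt (hT ha) h'
        have := hmax c hc
        omega
    have h1 := ncard_le_ncard hsub ((S.below_fin x y a).union (S.inc_fin x y a))
    have h2 := ncard_union_le (S.Below x y a) (S.Inc x y a)
    have h3 := S.inc_le (hT ha)
    simp only [rank]; omega
  refine ⟨?_, key⟩
  rcases T.eq_empty_or_nonempty with h | h
  · rw [h]; simp
  · obtain ⟨a, ha, h1⟩ := key h
    have := hK a ha
    omega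
lemma low_gt {x y} {r : ℕ} (hr : r < S.d x y) :
    r < {a ∈ S.Sep x y | S.rank x y a ≤ r}.ncard := by
  by_cases h : ∀ a ∈ S.Sep x y, S.rank x y a ≤ r
  · have : {a ∈ S.Sep x y | S.rank x y a ≤ r} = S.Sep x y := by
      ext a; exact ⟨fun h => h.1, fun ha => ⟨ha, h a ha⟩⟩
    rw [this]; exact hr
  · push Not at h
    obtain ⟨a, ha, har⟩ := h
    obtain ⟨b, hb, hmin⟩ := Set.exists_min_image {a ∈ S.Sep x y | r < S.rank x y a} (S.rank x y)
      ((S.sep_fin x y).subset fun _ h => h.1) ⟨a, ha, har⟩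
    refine lt_of_lt_of_le hb.2 (ncard_le_ncard ?_ ((S.sep_fin x y).subset fun _ h => h.1))
    intro c hc
    refine ⟨hc.1, ?_⟩
    by_contra hcr
    have := hmin c ⟨hc.1, by omega⟩
    have := S.rank_lt hc.1 hc.2
    omega
lemma exists_rank {x y} {r : ℕ} (hr : r < S.d x y) :
    ∃ a ∈ S.Sep x y, S.rank x y a ≤ r ∧ r + 1 ≤ S.rank x y a + S.B := by
  have h1 := S.low_gt hr
  obtain ⟨a, ha, h2⟩ := (S.low_le (x := x) (y := y) (T := {a ∈ S.Sep x y | S.rank x y a ≤ r}) (K := r)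
    (fun _ h => h.1) (fun _ h => h.2)).2 (nonempty_of_ncard_ne_zero (by omega))
  exact ⟨a, ha.1, ha.2, by omega⟩
lemma d_p_left {x y α} (hα : α ∈ S.Sep x y) : S.rank x y α ≤ S.d x (S.p α) ∧
    S.d x (S.p α) ≤ S.rank x y α + 3 * S.B := by
  constructor
  · exact ncard_le_ncard (fun c hc => ⟨hc.1.1, S.ax7p _ _ hc.2⟩) (S.sep_fin _ _)
  · have hsub : S.Sep x (S.p α) ⊆ S.Below x y α ∪ S.Inc x y α ∪ S.Bad x (S.p α) y := by
      intro c hc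
      by_cases h1 : y ∈ S.pos c
      · left
        by_cases h2 : S.lt c α
        · exact Or.inl ⟨⟨hc.1, h1⟩, h2⟩
        · exact Or.inr ⟨⟨hc.1, h1⟩, fun h => S.disj _ _ (S.ax7n _ _ h) hc.2, h2⟩
      · exact Or.inr ⟨hc, h1, fun h => S.ax7 α x y c hα.1 hα.2 hc.1 h hc.2⟩
    have h0 := ncard_le_ncard hsub (((S.below_fin x y α).union (S.inc_fin x y α)).union (S.Bad_fin _ _ _))
    have h1 := ncard_union_le (S.Below x y α ∪ S.Inc x y α) (S.Bad x (S.p α) y)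
    have h2 := ncard_union_le (S.Below x y α) (S.Inc x y α)
    have h3 := S.inc_le hα
    have h4 := S.Bad_le x (S.p α) y
    simp only [d, rank]; omega
lemma d_p_right {x y α} (hα : α ∈ S.Sep x y) :
    S.d (S.p α) y + S.rank x y α ≤ S.d x y + 3 * S.B := by
  have hsub : S.Sep (S.p α) y ⊆ S.Above x y α ∪ S.Inc x y α ∪ S.Bad (S.p α) y x := by
    intro c hc
    by_cases h1 : x ∈ S.neg c
    · left
      by_cases h2 : S.lt α c
      · exact Or.inl ⟨⟨h1, hc.2⟩, h2⟩
      · exact Or.inr ⟨⟨h1, hc.2⟩, h2, fun h => S.disj _ _ hc.1 (S.ax7p _ _ h)⟩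
    · refine Or.inr ⟨hc, fun h => ?_, h1⟩
      have := S.ax7 α x y (S.flip c) hα.1 hα.2 (by rwa [S.neg_flip]) (by rw [S.neg_flip]; exact hc.2)
      rw [S.pos_flip] at this
      exact this hc.1
  have h0 := ncard_le_ncard hsub (((S.above_fin x y α).union (S.inc_fin x y α)).union (S.Bad_fin _ _ _))
  have h1 := ncard_union_le (S.Above x y α ∪ S.Inc x y α) (S.Bad (S.p α) y x)
  have h2 := ncard_union_le (S.Above x y α) (S.Inc x y α)
  have h3 := S.inc_le hα
  have h4 := S.Bad_le (S.p α) y x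
  have h5 : (S.Below x y α ∪ S.Above x y α).ncard ≤ S.d x y :=
    ncard_le_ncard (by rintro c (h | h) <;> exact h.1) (S.sep_fin _ _)
  rw [ncard_union_eq (by
    rw [Set.disjoint_left]; intro c h h'
    exact S.irrefl _ (S.trans _ _ _ h.2 h'.2)) (S.below_fin _ _ _) (S.above_fin _ _ _)] at h5
  simp only [d, rank] at *; omega
open Classical in
def DD (x y : X) : ℝ := if x = y then 0 else (S.d x y : ℝ) + 2 * S.B
lemma DD_le (x y) : S.DD x y ≤ (S.d x y : ℝ) + 2 * S.B := by
  unfold DD; split_ifs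
  · positivity
  · exact le_rfl
lemma le_DD (x y) : (S.d x y : ℝ) ≤ S.DD x y := by
  unfold DD; split_ifs with h
  · subst h; simp [S.d_self]
  · have : (0:ℝ) ≤ S.B := by positivity
    linarith
lemma DD_met : MetFun S.DD where
  self x := by simp [DD]
  symm x y := by
    by_cases h : x = y
    · rw [h]
    · rw [DD, DD, if_neg h, if_neg (Ne.symm h), S.d_symm]
  tri x y z := by
    have hB : (0:ℝ) ≤ S.B := by positivity
    have h := S.d_tri x y z
    have h' : (S.d x z : ℝ) ≤ S.d x y + S.d y z + 2 * S.B := by exact_mod_cast h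
    by_cases h1 : x = y
    · subst h1; simp [DD]
    by_cases h2 : y = z
    · subst h2; simp [DD]
    have := S.DD_le x z
    have e1 : S.DD x y = S.d x y + 2 * S.B := by simp [DD, h1]
    have e2 : S.DD y z = S.d y z + 2 * S.B := by simp [DD, h2]
    linarith
lemma DD_four : FourPt S.DD (10 * S.B) := by
  intro x y z w
  have h := S.d_four x y z w
  have hB : (0:ℝ) ≤ S.B := by positivity
  have h' : (S.d x y : ℝ) + S.d z w ≤
    max ((S.d x z : ℝ) + S.d y w) (S.d x w + S.d y z) + 10 * S.B := by exact_mod_cast h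
  have := S.DD_le x y
  have := S.DD_le z w
  have h2 : max ((S.d x z : ℝ) + S.d y w) (S.d x w + S.d y z) ≤
    max (S.DD x z + S.DD y w) (S.DD x w + S.DD y z) :=
    max_le_max (add_le_add (S.le_DD _ _) (S.le_DD _ _)) (add_le_add (S.le_DD _ _) (S.le_DD _ _))
  linarith
lemma DD_rough : RoughGeod S.DD (10 * S.B + 2) := by
  intro x y r hr0 hr
  have hB : (0:ℝ) ≤ S.B := by positivity
  by_cases hd : S.d x y = 0
  · refine ⟨x, ?_, ?_⟩
    · have := S.DD_le x y
      rw [hd] at this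
      rw [S.DD_met.self, zero_sub, abs_neg, abs_of_nonneg hr0]
      push_cast at this; linarith
    · rw [S.DD_met.self]; linarith
  · obtain ⟨a, ha, h1, h2⟩ := S.exists_rank (x := x) (y := y) (r := min ⌊r⌋₊ (S.d x y - 1)) (by omega)
    have h3 := S.d_p_left ha
    have h4 := S.d_p_right ha
    have hub := S.DD_le x y
    refine ⟨S.p a, ?_, ?_⟩
    · have e1 := S.DD_le x (S.p a)
      have e2 := S.le_DD x (S.p a)
      have f1 : (S.rank x y a : ℝ) ≤ S.d x (S.p a) := by exact_mod_cast h3.1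
      have f2 : (S.d x (S.p a) : ℝ) ≤ S.rank x y a + 3 * S.B := by exact_mod_cast h3.2
      have f3 : (S.rank x y a : ℝ) ≤ r := by
        have : S.rank x y a ≤ ⌊r⌋₊ := h1.trans (min_le_left _ _)
        exact le_trans (by exact_mod_cast this) (Nat.floor_le hr0)
      have f4 : r ≤ S.rank x y a + 3 * S.B + 1 := by
        have : min ⌊r⌋₊ (S.d x y - 1) = ⌊r⌋₊ ∨ min ⌊r⌋₊ (S.d x y - 1) = S.d x y - 1 := by omega
        rcases this with h | h <;> rw [h] at h2
        · have := (Nat.lt_floor_add_one r).le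
          have h2' : ((⌊r⌋₊ : ℝ) + 1) ≤ S.rank x y a + S.B := by exact_mod_cast h2
          linarith
        · have h2' : S.d x y ≤ S.rank x y a + S.B := by omega
          have h2'' : (S.d x y : ℝ) ≤ S.rank x y a + S.B := by exact_mod_cast h2'
          linarith
      rw [abs_le]; constructor <;> linarith
    · have e1 := S.DD_le x (S.p a)
      have e2 := S.DD_le (S.p a) y
      have e3 := S.le_DD x y
      have : (S.d x (S.p a) : ℝ) + S.d (S.p a) y ≤ S.d x y + 6 * S.B := by
        have : S.d x (S.p a) + S.d (S.p a) y ≤ S.d x y + 6 * S.B := by omega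
        exact_mod_cast this
      linarith
lemma shift_left {x y x' y' : X} {T : Set W} (hT : T ⊆ S.Sep x' y') {R : ℕ} (h1 : S.d x x' ≤ R)
    (h2 : S.d y y' ≤ R) (hn : ∀ a ∈ T, a ∉ S.Sep x y) : T.ncard ≤ 2 * R + 4 * S.B := by
  have hsub : T ⊆ S.Sep x' x ∪ S.Sep y y' ∪ S.Bad x' y' x ∪ S.Bad x' y' y := by
    intro a ha
    have h := hT ha
    have hn' := hn a ha
    have := h.1
    have := h.2
    simp only [mem_union, Sep, Bad, mem_setOf_eq] at hn' ⊢
    tauto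
  have h0 := ncard_le_ncard hsub ((((S.sep_fin x' x).union (S.sep_fin y y')).union (S.Bad_fin _ _ _)).union (S.Bad_fin _ _ _))
  have h3 := ncard_union_le (S.Sep x' x ∪ S.Sep y y' ∪ S.Bad x' y' x) (S.Bad x' y' y)
  have h4 := ncard_union_le (S.Sep x' x ∪ S.Sep y y') (S.Bad x' y' x)
  have h5 := ncard_union_le (S.Sep x' x) (S.Sep y y')
  have h6 := S.Bad_le x' y' x
  have h7 := S.Bad_le x' y' y
  rw [S.d_symm] at h1
  simp only [d] at *; omega
lemma acyl (R : ℕ) : ∃ L N : ℕ, ∀ x y : X, L < S.d x y →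
    ∃ s : Finset A, s.card ≤ N ∧ ∀ a : A, S.d x (a • x) ≤ R → S.d y (a • y) ≤ R → a ∈ s := by
  set L := 2 * R + 4 * S.B with hL
  refine ⟨L, (2 * L + S.B) * (2 * L + S.B), fun x y hxy => ?_⟩
  set Z := {α ∈ S.Sep x y | S.rank x y α ≤ 2 * L}
  have hZf : Z.Finite := (S.sep_fin x y).subset fun _ h => h.1
  have hZ : Z.ncard ≤ 2 * L + S.B := (S.low_le (fun _ h => h.1) (fun _ h => h.2)).1
  have key : ∀ a : A, S.d x (a • x) ≤ R → S.d y (a • y) ≤ R →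
      ∃ α, α ∈ Z ∧ a • α ∈ Z := by
    intro a h1 h2
    set Wd := {α ∈ S.Sep x y | S.rank x y α ≤ L}
    have hw : L < Wd.ncard := S.low_gt hxy
    have : ∃ α ∈ Wd, a • α ∈ S.Sep x y := by
      by_contra! hcon
      have := S.shift_left (x := x) (y := y) (x' := a • x) (y' := a • y)
        (T := (fun w => a • w) '' Wd) (by
          rintro _ ⟨w, hw, rfl⟩; exact (S.sep_smul a x y w).2 hw.1) h1 h2 (by
          rintro _ ⟨w, hw, rfl⟩; exact hcon w hw)
      rw [ncard_image_of_injective _ (MulAction.injective a)] at this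
      omega
    obtain ⟨α, hα, haα⟩ := this
    refine ⟨α, ⟨hα.1, hα.2.trans (by omega)⟩, haα, ?_⟩
    set T1 := {c ∈ S.Below x y (a • α) | c ∈ S.Sep (a • x) (a • y)}
    set T2 := {c ∈ S.Below x y (a • α) | c ∉ S.Sep (a • x) (a • y)}
    have hu : S.Below x y (a • α) ⊆ T1 ∪ T2 := by
      intro c hc
      by_cases h : c ∈ S.Sep (a • x) (a • y)
      · exact Or.inl ⟨hc, h⟩
      · exact Or.inr ⟨hc, h⟩
    have hT1 : T1.ncard ≤ L := by
      refine le_trans ?_ hα.2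
      have : T1 ⊆ (fun w => a • w) '' S.Below x y α := by
        intro c hc
        refine ⟨a⁻¹ • c, ⟨?_, ?_⟩, by simp⟩
        · rw [← S.sep_smul a, smul_inv_smul]; exact hc.2
        · rw [← S.lt_smul a, smul_inv_smul]; exact hc.1.2
      have := ncard_le_ncard this ((S.below_fin x y α).image _)
      rwa [ncard_image_of_injective _ (MulAction.injective a)] at this
    have hT2 : T2.ncard ≤ L := by
      refine S.shift_left (x := a • x) (y := a • y) (x' := x) (y' := y) (fun c hc => hc.1.1)
        (R := R) (by rwa [S.d_symm]) (by rwa [S.d_symm]) (fun c hc => hc.2)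
    have h3 := ncard_le_ncard hu (((S.below_fin _ _ _).subset fun _ h => h.1).union
      ((S.below_fin _ _ _).subset fun _ h => h.1))
    have h4 := ncard_union_le T1 T2
    simp only [rank]; omega
  have key' : ∀ a : A, ∃ α : W, S.d x (a • x) ≤ R → S.d y (a • y) ≤ R → α ∈ Z ∧ a • α ∈ Z := by
    intro a
    by_cases h1 : S.d x (a • x) ≤ R
    · by_cases h2 : S.d y (a • y) ≤ R
      · obtain ⟨α, h⟩ := key a h1 h2
        exact ⟨α, fun _ _ => h⟩
      · obtain ⟨α, -⟩ := nonempty_of_ncard_ne_zero (s := S.Sep x y) (by unfold d at hxy; omega)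
        exact ⟨α, fun _ h => (h2 h).elim⟩
    · obtain ⟨α, -⟩ := nonempty_of_ncard_ne_zero (s := S.Sep x y) (by unfold d at hxy; omega)
      exact ⟨α, fun h => (h1 h).elim⟩
  choose f hf using key'
  set G := {a : A | S.d x (a • x) ≤ R ∧ S.d y (a • y) ≤ R}
  have hinj : InjOn (fun a => (f a, a • f a)) G := by
    intro a ha b hb hab
    simp only [Prod.mk.injEq] at hab
    obtain ⟨e1, e2⟩ := hab
    rw [e1] at e2
    have := S.free (b⁻¹ * a) (f b) (by rw [mul_smul, e2, inv_smul_smul])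
    rwa [inv_mul_eq_one, eq_comm] at this
  have hmaps : MapsTo (fun a => (f a, a • f a)) G (Z ×ˢ Z) := fun a ha =>
    hf a ha.1 ha.2
  have hGf : G.Finite := Set.Finite.of_injOn hmaps hinj (hZf.prod hZf)
  have hGc := ncard_le_ncard_of_injOn _ hmaps hinj (hZf.prod hZf)
  rw [ncard_prod] at hGc
  refine ⟨hGf.toFinset, ?_, fun a h1 h2 => by rw [Finite.mem_toFinset]; exact ⟨h1, h2⟩⟩
  rw [← ncard_eq_toFinset_card _ hGf]
  exact hGc.trans (Nat.mul_le_mul hZ hZ)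
theorem criterion [Nonempty X] (x0 : X) (hub : ∀ n : ℕ, ∃ a : A, n ≤ S.d x0 (a • x0)) :
    ∃ (Y : Type u) (_ : MetricSpace Y) (ρ : A →* (Y ≃ᵢ Y)),
      HyperbolicGeodesicSpace Y ∧ IsAcylindrical ρ ∧
      ∃ y : Y, ¬ Bornology.IsBounded (Set.range fun g : A => ρ g y) := by
  refine hull_criterion (A := A) S.DD_met (by positivity) S.DD_four S.DD_rough ?_ ?_ x0 ?_
  · intro a x y
    by_cases h : x = y
    · rw [h]; simp [DD]
    · rw [DD, DD, if_neg h, if_neg (fun h' => h (MulAction.injective a h')), S.d_smul]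
  · intro R
    obtain ⟨L, N, h⟩ := S.acyl ⌈R⌉₊
    refine ⟨L + 2 * S.B, N, fun x y hxy => ?_⟩
    obtain ⟨s, hs, hs'⟩ := h x y (by
      have := S.DD_le x y
      have h2 : (L : ℝ) < S.d x y := by linarith
      exact_mod_cast h2)
    have cv : ∀ x y, S.DD x y < R → S.d x y ≤ ⌈R⌉₊ := fun x y h => by
      have h1 := (S.le_DD x y).trans (h.le.trans (Nat.le_ceil R))
      exact_mod_cast h1
    exact ⟨s, hs, fun a h1 h2 => hs' a (cv _ _ h1) (cv _ _ h2)⟩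
  · intro r
    obtain ⟨a, ha⟩ := hub (⌈r⌉₊ + 1)
    refine ⟨a, ?_⟩
    have h1 := S.le_DD x0 (a • x0)
    have h2 := Nat.le_ceil r
    have h3 : ((⌈r⌉₊ : ℝ) + 1) ≤ S.d x0 (a • x0) := by exact_mod_cast ha
    linarith
end WallSys
open scoped Pointwise
section ends
open CategoryTheory
lemma three_pieces {G : Type u} [Group G] (S : Finset G)
    (h : ((cayleyGraph (S : Set G)).end).Infinite) :
    ∃ (K P₁ P₂ P₃ : Set G), K.Finite ∧ (Disjoint P₁ P₂ ∧ Disjoint P₁ P₃ ∧ Disjoint P₂ P₃) ∧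
      ∀ P, (P = P₁ ∨ P = P₂ ∨ P = P₃) → P.Infinite ∧ Disjoint P K ∧
        ∀ x ∈ P, ∀ s, (s ∈ S ∨ s⁻¹ ∈ S) → x * s ∉ K → x * s ∈ P := by
  classical
  set Γ := cayleyGraph (S : Set G)
  obtain ⟨t, ht, htc⟩ := h.exists_subset_card_eq 3
  obtain ⟨e1, e2, e3, h12, h13, h23, rfl⟩ := Finset.card_eq_three.1 htc
  have he1 : e1 ∈ Γ.end := ht (by simp)
  have he2 : e2 ∈ Γ.end := ht (by simp)
  have he3 : e3 ∈ Γ.end := ht (by simp)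
  have dist : ∀ e e' : (j : (Finset G)ᵒᵖ) → Γ.componentComplFunctor.obj j, e ≠ e' → ∃ K : Finset G, e (Opposite.op K) ≠ e' (Opposite.op K) := by
    intro e e' hne
    by_contra! hcon
    exact hne (funext fun K => hcon K.unop)
  obtain ⟨K1, hK1⟩ := dist _ _ h12
  obtain ⟨K2, hK2⟩ := dist _ _ h13
  obtain ⟨K3, hK3⟩ := dist _ _ h23
  set L := K1 ∪ K2 ∪ K3
  have lift : ∀ (e e' : (j : (Finset G)ᵒᵖ) → Γ.componentComplFunctor.obj j) (_ : e ∈ Γ.end) (_ : e' ∈ Γ.end) (K : Finset G), K ⊆ L →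
      e (Opposite.op K) ≠ e' (Opposite.op K) → e (Opposite.op L) ≠ e' (Opposite.op L) := by
    intro e e' he he' K hK hne heq
    have hK' : Opposite.unop (Opposite.op K) ⊆ Opposite.unop (Opposite.op L) := hK
    have a1 := he (opHomOfLE hK')
    have a2 := he' (opHomOfLE hK')
    apply hne
    rw [← a1, ← a2, heq]
  have hinf : ∀ e ∈ Γ.end, ((e (Opposite.op L) : Γ.ComponentCompl L).supp).Infinite := by
    intro e he
    refine (SimpleGraph.ComponentCompl.infinite_iff_in_all_ranges _).mpr (fun M hM => ?_)
    have hM' : Opposite.unop (Opposite.op L) ⊆ Opposite.unop (Opposite.op M) := hM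
    exact ⟨e (Opposite.op M), he (opHomOfLE hM')⟩
  have l12 := lift _ _ he1 he2 K1 (by intro x hx; simp [L, hx]) hK1
  have l13 := lift _ _ he1 he3 K2 (by intro x hx; simp [L, hx]) hK2
  have l23 := lift _ _ he2 he3 K3 (by intro x hx; simp [L, hx]) hK3
  have pd : ∀ C C' : Γ.ComponentCompl L, C ≠ C' → Disjoint C.supp C'.supp := fun C C' h =>
    SimpleGraph.ComponentCompl.pairwise_disjoint h
  refine ⟨L, (e1 (Opposite.op L) : Γ.ComponentCompl L).supp, (e2 (Opposite.op L) : Γ.ComponentCompl L).supp,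
    (e3 (Opposite.op L) : Γ.ComponentCompl L).supp, L.finite_toSet,
    ⟨pd _ _ l12, pd _ _ l13, pd _ _ l23⟩, ?_⟩
  have main : ∀ e ∈ Γ.end, ((e (Opposite.op L) : Γ.ComponentCompl L).supp).Infinite ∧
      Disjoint (e (Opposite.op L) : Γ.ComponentCompl L).supp L ∧
        ∀ x ∈ (e (Opposite.op L) : Γ.ComponentCompl L).supp, ∀ s, (s ∈ S ∨ s⁻¹ ∈ S) → x * s ∉ (L : Set G) →
          x * s ∈ (e (Opposite.op L) : Γ.ComponentCompl L).supp := by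
    intro e he
    refine ⟨hinf e he, (SimpleGraph.ComponentCompl.disjoint_right _).symm, fun x hx s hs hn => ?_⟩
    by_cases h1 : s = 1
    · rwa [h1, mul_one]
    refine SimpleGraph.ComponentCompl.mem_of_adj x (x * s) hx hn ?_
    rw [show Γ = SimpleGraph.fromRel (fun x y => x⁻¹ * y ∈ (S : Set G)) from rfl, SimpleGraph.fromRel_adj]
    refine ⟨fun h => h1 (by simpa using h), ?_⟩
    simpa using hs
  rintro P (rfl | rfl | rfl)
  · exact main _ he1
  · exact main _ he2
  · exact main _ he3
end ends
section cuts
variable {G : Type u} [Group G]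
def bd (S : Finset G) (C : Set G) : Set (G × G) := {p | p.2 ∈ S ∧ p.1 ∈ C ∧ p.1 * p.2 ∉ C}
structure Gen (S : Finset G) : Prop where
  symm : ∀ s ∈ S, s⁻¹ ∈ S
  top : Subgroup.closure (S : Set G) = ⊤
lemma Gen.ind {S : Finset G} (hS : Gen S) (P : G → Prop) (x0 : G) (h0 : P x0)
    (h : ∀ x, P x → ∀ s ∈ S, P (x * s)) : ∀ x, P x := by
  have key : ∀ y ∈ Subgroup.closure (S : Set G), P (x0 * y) := by
    intro y hy
    induction hy using Subgroup.closure_induction_right with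
    | one => simpa using h0
    | mul_right a _ s hs ha => rw [← mul_assoc]; exact h _ ha _ hs
    | mul_inv_cancel a _ s hs ha => rw [← mul_assoc]; exact h _ ha _ (hS.symm s hs)
  intro x
  have := key (x0⁻¹ * x) (by rw [hS.top]; trivial)
  simpa using this
variable {S : Finset G}
lemma Gen.eq_univ (hS : Gen S) {C : Set G} (hne : C.Nonempty) (h : bd S C = ∅) : C = univ := by
  obtain ⟨x0, h0⟩ := hne
  rw [eq_univ_iff_forall]
  refine hS.ind (· ∈ C) x0 h0 fun x hx s hs => ?_
  by_contra hc
  have : (x, s) ∈ bd S C := ⟨hs, hx, hc⟩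
  simp [h] at this
lemma bd_compl_image (hS : Gen S) (C : Set G) :
    bd S Cᶜ = (fun p : G × G => (p.1 * p.2, p.2⁻¹)) '' bd S C := by
  ext ⟨x, s⟩
  constructor
  · rintro ⟨h1, h2, h3⟩
    refine ⟨(x * s, s⁻¹), ⟨hS.symm _ h1, by simpa using h3, by simpa using h2⟩, by simp⟩
  · rintro ⟨⟨y, t⟩, ⟨h1, h2, h3⟩, h⟩
    simp only [Prod.mk.injEq] at h
    obtain ⟨rfl, rfl⟩ := h
    exact ⟨hS.symm _ h1, h3, by simpa using h2⟩
lemma bd_inj : Function.Injective (fun p : G × G => (p.1 * p.2, p.2⁻¹)) := by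
  rintro ⟨x, s⟩ ⟨y, t⟩ h
  simp only [Prod.mk.injEq, inv_inj] at h
  obtain ⟨h, rfl⟩ := h
  simpa using h
lemma bd_compl_ncard (hS : Gen S) (C : Set G) : (bd S Cᶜ).ncard = (bd S C).ncard := by
  rw [bd_compl_image hS, ncard_image_of_injective _ bd_inj]
lemma bd_compl_fin (hS : Gen S) {C : Set G} (h : (bd S C).Finite) : (bd S Cᶜ).Finite := by
  rw [bd_compl_image hS]; exact h.image _
lemma bd_smul (g : G) (C : Set G) :
    bd S (g • C) = (fun p : G × G => (g * p.1, p.2)) '' bd S C := by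
  ext ⟨x, s⟩
  constructor
  · rintro ⟨h1, h2, h3⟩
    rw [mem_smul_set_iff_inv_smul_mem] at h2 h3
    exact ⟨(g⁻¹ * x, s), ⟨h1, h2, by simpa [mul_assoc] using h3⟩, by simp⟩
  · rintro ⟨⟨y, t⟩, ⟨h1, h2, h3⟩, h⟩
    simp only [Prod.mk.injEq] at h
    obtain ⟨rfl, rfl⟩ := h
    refine ⟨h1, ?_, ?_⟩ <;> rw [mem_smul_set_iff_inv_smul_mem]
    · simpa using h2
    · simpa [mul_assoc] using h3
lemma bd_smul_ncard (g : G) (C : Set G) : (bd S (g • C)).ncard = (bd S C).ncard := by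
  rw [bd_smul, ncard_image_of_injective]
  rintro ⟨x, s⟩ ⟨y, t⟩ h
  simpa using h
lemma bd_smul_fin (g : G) {C : Set G} (h : (bd S C).Finite) : (bd S (g • C)).Finite := by
  rw [bd_smul]; exact h.image _
structure Thin (S : Finset G) (C : Set G) : Prop where
  inf : C.Infinite
  cinf : Cᶜ.Infinite
  fin : (bd S C).Finite
  min : ∀ E : Set G, E.Infinite → Eᶜ.Infinite → (bd S E).Finite → (bd S C).ncard ≤ (bd S E).ncard
lemma Thin.compl (hS : Gen S) {C : Set G} (h : Thin S C) : Thin S Cᶜ :=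
  ⟨h.cinf, by simpa using h.inf, bd_compl_fin hS h.fin, fun E a b c => by
    rw [bd_compl_ncard hS]; exact h.min E a b c⟩
lemma Thin.smul {C : Set G} (h : Thin S C) (g : G) : Thin S (g • C) :=
  ⟨h.inf.smul_set, by rw [← smul_set_compl]; exact h.cinf.smul_set, bd_smul_fin g h.fin,
    fun E a b c => by rw [bd_smul_ncard]; exact h.min E a b c⟩
lemma Thin.corner {C D : Set G} (hC : Thin S C) (hD : Thin S D) (h1 : (C ∩ D).Infinite)
    (h2 : (C ∪ D)ᶜ.Infinite) : Thin S (C ∩ D) ∧ Thin S (C ∪ D) := by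
  have hu : bd S (C ∩ D) ∪ bd S (C ∪ D) ⊆ bd S C ∪ bd S D := by
    rintro ⟨x, s⟩ h
    simp only [bd, mem_union, mem_setOf_eq, mem_inter_iff] at h ⊢
    tauto
  have hi : bd S (C ∩ D) ∩ bd S (C ∪ D) ⊆ bd S C ∩ bd S D := by
    rintro ⟨x, s⟩ h
    simp only [bd, mem_union, mem_setOf_eq, mem_inter_iff] at h ⊢
    tauto
  have fU := hC.fin.union hD.fin
  have fI := (fU.subset hu).subset subset_union_left
  have fJ := (fU.subset hu).subset subset_union_right
  have e1 := ncard_union_add_ncard_inter _ _ fI fJ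
  have e2 := ncard_union_add_ncard_inter _ _ hC.fin hD.fin
  have l1 := ncard_le_ncard hu fU
  have l2 := ncard_le_ncard hi (hC.fin.inter_of_left _)
  have i1 : (C ∩ D)ᶜ.Infinite := hC.cinf.mono (compl_subset_compl.2 inter_subset_left)
  have i2 : (C ∪ D).Infinite := hC.inf.mono subset_union_left
  have m1 := hC.min _ h1 i1 fI
  have m2 := hC.min _ i2 h2 fJ
  have m3 := hC.min _ hD.inf hD.cinf hD.fin
  have m4 := hD.min _ hC.inf hC.cinf hC.fin
  refine ⟨⟨h1, i1, fI, fun E a b c => ?_⟩, ⟨i2, h2, fJ, fun E a b c => ?_⟩⟩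
  · have := hC.min E a b c; omega
  · have := hC.min E a b c; omega
def Conn (S : Finset G) (C : Set G) : Prop :=
  ∀ T ⊆ C, T.Nonempty → (∀ c ∈ T, ∀ s ∈ S, c * s ∈ C → c * s ∈ T) → T = C
lemma Thin.conn (hS : Gen S) {C : Set G} (h : Thin S C) : Conn S C := by
  have key : ∀ T ⊆ C, (∀ c ∈ T, ∀ s ∈ S, c * s ∈ C → c * s ∈ T) → T.Infinite →
      C \ T = ∅ := by
    intro T hT hc hinf
    by_contra hne
    have hne' : (C \ T).Nonempty := nonempty_iff_ne_empty.2 hne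
    have hsub : bd S T ⊆ bd S C := by
      rintro ⟨x, s⟩ ⟨a, b, c⟩
      exact ⟨a, hT b, fun h' => c (hc _ b _ a h')⟩
    have hsub2 : bd S (C \ T) ⊆ bd S C := by
      rintro ⟨x, s⟩ ⟨a, b, c⟩
      refine ⟨a, b.1, fun h' => c ⟨h', fun h2 => b.2 ?_⟩⟩
      have := hc _ h2 _ (hS.symm _ a) (by simpa using b.1)
      simpa using this
    have hdis : Disjoint (bd S T) (bd S (C \ T)) := by
      rw [Set.disjoint_left]
      rintro ⟨x, s⟩ ⟨a, b, c⟩ ⟨a', b', c'⟩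
      exact b'.2 b
    have h1 := h.min T hinf (h.cinf.mono (compl_subset_compl.2 hT)) (h.fin.subset hsub)
    have h2 := ncard_le_ncard (union_subset hsub hsub2) h.fin
    rw [ncard_union_eq hdis (h.fin.subset hsub) (h.fin.subset hsub2)] at h2
    have h3 : (bd S (C \ T)).ncard = 0 := by omega
    rw [ncard_eq_zero (h.fin.subset hsub2)] at h3
    have h4 := hS.eq_univ hne' h3
    have : Cᶜ = ∅ := by
      rw [compl_empty_iff, eq_univ_iff_forall]
      intro x
      have : x ∈ C \ T := h4 ▸ mem_univ x
      exact this.1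
    exact h.cinf (by rw [this]; exact finite_empty)
  intro T hT hne hc
  by_cases hinf : T.Infinite
  · exact subset_antisymm hT (diff_eq_empty.1 (key T hT hc hinf))
  · have hi2 : (C \ T).Infinite := h.inf.diff (not_infinite.1 hinf)
    have := key (C \ T) diff_subset (fun c hcc s hs hm => ⟨hm, fun h2 => hcc.2 ?_⟩) hi2
    · rw [sdiff_sdiff_right_self] at this
      obtain ⟨x, hx⟩ := hne
      exact absurd (show x ∈ C ∩ T from ⟨hT hx, hx⟩) (by rw [this]; simp)
    · have := hc _ h2 _ (hS.symm _ hs) (by simpa using hcc.1)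
      simpa using this
lemma Conn.edge {C : Set G} (h : Conn S C) {T : Set G} (h1 : (C ∩ T).Nonempty) (h2 : (C \ T).Nonempty) :
    ∃ c s, s ∈ S ∧ c ∈ C ∧ c ∈ T ∧ c * s ∈ C ∧ c * s ∉ T := by
  by_contra! hcon
  have := h (C ∩ T) inter_subset_left h1 (fun c hc s hs hm => ⟨hm, hcon c s hs hc.1 hc.2 hm⟩)
  obtain ⟨x, hx⟩ := h2
  rw [← this] at hx
  exact hx.2 hx.1.2
lemma thin_fin (hS : Gen S) (x y : G) : {C | Thin S C ∧ x ∈ C ∧ y ∉ C}.Finite := by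
  by_contra hinf
  set I := {C | Thin S C ∧ x ∈ C ∧ y ∉ C} with hI
  haveI : Infinite I := Set.infinite_coe_iff.2 hinf
  set F : Ultrafilter I := Filter.hyperfilter I
  have caseFin : ∀ c : I → Set G, (∀ i, (c i).Infinite ∧ Conn S (c i)) → (∃ z, ∀ i, z ∈ c i) →
      {g | ∀ᶠ i in (F : Filter I), g ∈ c i}.Infinite := by
    intro c hc ⟨z, hz⟩ hfin
    set L := {g | ∀ᶠ i in (F : Filter I), g ∈ c i}
    have e1 : ∀ᶠ i in (F : Filter I), ∀ g ∈ L, g ∈ c i := (Filter.eventually_all_finite hfin).2 (fun g hg => hg)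
    have e2 : ∀ᶠ i in (F : Filter I), ∃ p ∈ L ×ˢ (S : Set G), p.1 * p.2 ∈ c i ∧ p.1 * p.2 ∉ L := by
      filter_upwards [e1] with i hi
      have hzL : z ∈ L := Filter.Eventually.of_forall hz
      obtain ⟨a, s, hs, h1, h2, h3, h4⟩ := (hc i).2.edge (T := L) ⟨z, hz i, hzL⟩
        ((hc i).1.diff hfin).nonempty
      exact ⟨(a, s), ⟨h2, hs⟩, h3, h4⟩
    have hf2 : (L ×ˢ (S : Set G)).Finite := hfin.prod S.finite_toSet
    rw [Ultrafilter.eventually_exists_mem_iff hf2] at e2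
    obtain ⟨p, hp, e2⟩ := e2
    have e3 : ∀ᶠ i in (F : Filter I), p.1 * p.2 ∈ c i := e2.mono fun _ h => h.1
    obtain ⟨i, hi⟩ := e2.exists
    exact hi.2 e3
  have i1 := caseFin (fun i => i.1) (fun i => ⟨i.2.1.inf, i.2.1.conn hS⟩) ⟨x, fun i => i.2.2.1⟩
  have i2 := caseFin (fun i => i.1ᶜ) (fun i => ⟨i.2.1.cinf, (i.2.1.compl hS).conn hS⟩) ⟨y, fun i => i.2.2.2⟩
  set L := {g | ∀ᶠ i in (F : Filter I), g ∈ i.1} with hL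
  have hLc : {g | ∀ᶠ i in (F : Filter I), g ∈ i.1ᶜ} = Lᶜ := by
    ext g
    simp only [hL, mem_compl_iff, mem_setOf_eq]
    exact Ultrafilter.eventually_not
  rw [hLc] at i2
  have hev : ∀ p ∈ bd S L, ∀ᶠ i in (F : Filter I), p ∈ bd S i.1 := by
    rintro ⟨a, s⟩ ⟨h1, h2, h3⟩
    have h3' : a * s ∈ Lᶜ := h3
    rw [← hLc] at h3'
    filter_upwards [h2, h3'] with i a b using ⟨h1, a, b⟩
  obtain ⟨C0, hC0⟩ : I.Nonempty := nonempty_iff_ne_empty.2 (fun h => hinf (by rw [h]; exact finite_empty))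
  have hk : ∀ i : I, (bd S i.1).ncard = (bd S C0).ncard := fun i =>
    le_antisymm (i.2.1.min _ hC0.1.inf hC0.1.cinf hC0.1.fin) (hC0.1.min _ i.2.1.inf i.2.1.cinf i.2.1.fin)
  have hLfin : (bd S L).Finite := by
    by_contra hni
    obtain ⟨t, ht, htc⟩ := Set.Infinite.exists_subset_card_eq hni ((bd S C0).ncard + 1)
    have : ∀ᶠ i in (F : Filter I), ∀ p ∈ t, p ∈ bd S i.1 :=
      (Filter.eventually_all_finset t).2 (fun p hp => hev p (ht hp))
    obtain ⟨i, hi⟩ := this.exists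
    have := ncard_le_ncard (show (t : Set _) ⊆ bd S i.1 from hi) i.2.1.fin
    rw [ncard_coe_finset, hk i] at this
    omega
  have hge := hC0.1.min L i1 i2 hLfin
  have ev : ∀ᶠ i in (F : Filter I), bd S L = bd S i.1 := by
    have := (Filter.eventually_all_finite hLfin).2 hev
    filter_upwards [this] with i hi
    exact eq_of_subset_of_ncard_le hi (by rw [hk i]; exact hge) i.2.1.fin
  have hsub : {i : I | bd S L = bd S i.1}.Subsingleton := by
    have : ∀ i j : I, bd S L = bd S i.1 → bd S L = bd S j.1 → i.1 ∩ j.1 = i.1 := by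
      intro i j hi hj
      refine (i.2.1.conn hS) _ inter_subset_left ⟨x, i.2.2.1, j.2.2.1⟩ (fun c hc s hs hm => ⟨hm, ?_⟩)
      by_contra hn
      have : (c, s) ∈ bd S j.1 := ⟨hs, hc.2, hn⟩
      rw [← hj, hi] at this
      exact this.2.2 hm
    intro i hi j hj
    ext1
    rw [← this i j hi hj, inter_comm, this j i hj hi]
  exact Filter.notMem_hyperfilter_of_finite hsub.finite ev
end cuts
section cuts
variable {G : Type u} [Group G] {S : Finset G}
def Nest (C E : Set G) : Prop := C ⊆ E ∨ E ⊆ C ∨ Disjoint C E ∨ Cᶜ ⊆ E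
lemma Nest.compl_right {C E : Set G} (h : Nest C E) : Nest C Eᶜ := by
  rcases h with h | h | h | h
  · exact Or.inr (Or.inr (Or.inl (disjoint_compl_right_iff_subset.2 h)))
  · exact Or.inr (Or.inr (Or.inr (compl_subset_compl.2 h)))
  · exact Or.inl (subset_compl_iff_disjoint_right.2 h)
  · exact Or.inr (Or.inl (compl_subset_comm.1 h))
lemma Nest.symm {C E : Set G} (h : Nest C E) : Nest E C := by
  rcases h with h | h | h | h
  · exact Or.inr (Or.inl h)
  · exact Or.inl h
  · exact Or.inr (Or.inr (Or.inl h.symm))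
  · exact Or.inr (Or.inr (Or.inr (compl_subset_comm.1 h)))
lemma Nest.compl_left {C E : Set G} (h : Nest C E) : Nest Cᶜ E := h.symm.compl_right.symm
lemma nest_compl_right {C E : Set G} : Nest C Eᶜ ↔ Nest C E :=
  ⟨fun h => by simpa using h.compl_right, fun h => h.compl_right⟩
lemma nest_smul {C E : Set G} (g : G) : Nest (g • C) (g • E) ↔ Nest C E := by
  unfold Nest
  rw [← smul_set_compl]
  simp only [smul_set_subset_smul_set_iff, disjoint_smul_set]
def NN (S : Finset G) (C : Set G) : Set (Set G) := {E | Thin S E ∧ ¬ Nest C E}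
lemma NN_fin (hS : Gen S) {C : Set G} (hC : Thin S C) : (NN S C).Finite := by
  have : NN S C ⊆ ⋃ p ∈ bd S C, ⋃ q ∈ bd S C, {E | Thin S E ∧ p.1 ∈ E ∧ q.1 ∉ E} := by
    rintro E ⟨hE, hn⟩
    unfold Nest at hn
    push Not at hn
    obtain ⟨n1, n2, n3, n4⟩ := hn
    obtain ⟨a, ha⟩ := not_subset.1 n1
    obtain ⟨b, hb⟩ := not_subset.1 n2
    obtain ⟨c, hc⟩ := not_disjoint_iff.1 n3
    obtain ⟨d, hd⟩ := not_subset.1 n4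
    obtain ⟨x, s, hs, h1, h2, h3, h4⟩ := (hE.conn hS).edge (T := C) ⟨c, hc.2, hc.1⟩ ⟨b, hb.1, hb.2⟩
    obtain ⟨x', s', hs', h1', h2', h3', h4'⟩ := ((hE.compl hS).conn hS).edge (T := C) ⟨a, ha.2, ha.1⟩ ⟨d, hd.2, hd.1⟩
    simp only [mem_iUnion]
    exact ⟨(x, s), ⟨hs, h2, h4⟩, (x', s'), ⟨hs', h2', h4'⟩, hE, h1, h1'⟩
  exact (hC.fin.biUnion fun p _ => hC.fin.biUnion fun q _ => thin_fin hS _ _).subset this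
lemma NN_compl (C : Set G) : NN S Cᶜ = NN S C := by
  ext E
  simp only [NN, mem_setOf_eq]
  constructor
  · rintro ⟨a, b⟩; exact ⟨a, fun h => b h.compl_left⟩
  · rintro ⟨a, b⟩; exact ⟨a, fun h => b (by simpa using h.compl_left)⟩
lemma NN_smul (g : G) (C : Set G) : NN S (g • C) = (fun E => g • E) '' NN S C := by
  ext E
  constructor
  · rintro ⟨a, b⟩
    refine ⟨g⁻¹ • E, ⟨a.smul _, fun h => b ?_⟩, by simp⟩
    have := (nest_smul g).2 h
    simpa using this
  · rintro ⟨E, ⟨a, b⟩, rfl⟩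
    exact ⟨a.smul g, fun h => b ((nest_smul g).1 h)⟩
lemma NN_smul_ncard (g : G) (C : Set G) : (NN S (g • C)).ncard = (NN S C).ncard := by
  rw [NN_smul, ncard_image_of_injective _ (MulAction.injective g)]
lemma NN_key (hS : Gen S) {C D : Set G} (hC : Thin S C) (hD : Thin S D) (hn : ¬ Nest C D)
    (h1 : (C ∩ D).Infinite) (h2 : (C ∪ D)ᶜ.Infinite) :
    Thin S (C ∩ D) ∧ Thin S (C ∪ D) ∧
      (NN S (C ∩ D)).ncard + (NN S (C ∪ D)).ncard < (NN S C).ncard + (NN S D).ncard := by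
  obtain ⟨hI, hU⟩ := hC.corner hD h1 h2
  refine ⟨hI, hU, ?_⟩
  have hn' := hn
  unfold Nest at hn
  push Not at hn
  obtain ⟨n1, n2, n3, n4⟩ := hn
  obtain ⟨a, ha⟩ := not_subset.1 n1
  obtain ⟨b, hb⟩ := not_subset.1 n2
  obtain ⟨c, hc⟩ := not_disjoint_iff.1 n3
  obtain ⟨d, hd⟩ := not_subset.1 n4
  have k1 : ∀ E, Nest C E → Nest D E → Nest (C ∩ D) E ∧ Nest (C ∪ D) E := by
    intro E e1 e2
    clear hn' n1 n2 n3 n4 hI hU hC hD h1 h2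
    unfold Nest at *
    simp only [subset_def, Set.disjoint_left, mem_compl_iff, mem_inter_iff, mem_union] at *
    rcases e1 with e1 | e1 | e1 | e1 <;> rcases e2 with e2 | e2 | e2 | e2 <;> grind
  have k2 : ∀ C D E : Set G, Nest C E → Nest (C ∩ D) E ∨ Nest (C ∪ D) E := by
    rintro C D E (e | e | e | e)
    · exact Or.inl (Or.inl (inter_subset_left.trans e))
    · exact Or.inr (Or.inr (Or.inl (e.trans subset_union_left)))
    · exact Or.inl (Or.inr (Or.inr (Or.inl (e.mono_left inter_subset_left))))
    · exact Or.inr (Or.inr (Or.inr (Or.inr ((compl_subset_compl.2 subset_union_left).trans e))))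
  have hu : NN S (C ∩ D) ∪ NN S (C ∪ D) ⊂ NN S C ∪ NN S D := by
    refine ⟨?_, fun h => ?_⟩
    · rintro E (⟨e, h⟩ | ⟨e, h⟩)
      · by_contra hcon
        simp only [mem_union, NN, mem_setOf_eq, not_or, not_and, not_not] at hcon
        exact h (k1 E (hcon.1 e) (hcon.2 e)).1
      · by_contra hcon
        simp only [mem_union, NN, mem_setOf_eq, not_or, not_and, not_not] at hcon
        exact h (k1 E (hcon.1 e) (hcon.2 e)).2
    · have : C ∈ NN S C ∪ NN S D := Or.inr ⟨hC, fun h => hn' h.symm⟩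
      rcases h this with ⟨_, h⟩ | ⟨_, h⟩
      · exact h (Or.inl inter_subset_left)
      · exact h (Or.inr (Or.inl subset_union_left))
  have hi : NN S (C ∩ D) ∩ NN S (C ∪ D) ⊆ NN S C ∩ NN S D := by
    rintro E ⟨⟨e, h1⟩, ⟨_, h2⟩⟩
    refine ⟨⟨e, fun h => (k2 C D E h).elim h1 h2⟩, ⟨e, fun h => ?_⟩⟩
    have := k2 D C E h
    rw [inter_comm, union_comm] at this
    exact this.elim h1 h2
  have f1 := NN_fin hS hI
  have f2 := NN_fin hS hU
  have f3 := NN_fin hS hC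
  have f4 := NN_fin hS hD
  have e1 := ncard_union_add_ncard_inter _ _ f1 f2
  have e2 := ncard_union_add_ncard_inter _ _ f3 f4
  have l1 := ncard_lt_ncard hu (f3.union f4)
  have l2 := ncard_le_ncard hi (f3.inter_of_left _)
  omega
lemma exists_nested (hS : Gen S) {C0 : Set G} (hinf : C0.Infinite) (hcinf : C0ᶜ.Infinite)
    (hfin : (bd S C0).Finite) : ∃ D, Thin S D ∧ ∀ g : G, Nest D (g • D) := by
  classical
  obtain ⟨C1, hC1, hmin1⟩ := exists_minimalFor_of_wellFoundedLT
    (fun C : Set G => C.Infinite ∧ Cᶜ.Infinite ∧ (bd S C).Finite) (fun C => (bd S C).ncard) ⟨C0, hinf, hcinf, hfin⟩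
  have hT : Thin S C1 := ⟨hC1.1, hC1.2.1, hC1.2.2, fun E a b c => by
    by_contra hlt; exact hlt (hmin1 ⟨a, b, c⟩ (le_of_not_ge hlt))⟩
  obtain ⟨C, hC, hmin⟩ := exists_minimalFor_of_wellFoundedLT (fun C : Set G => Thin S C) (fun C => (NN S C).ncard) ⟨C1, hT⟩
  have hmin' : ∀ E, Thin S E → (NN S C).ncard ≤ (NN S E).ncard := fun E hE => by
    by_contra hlt; exact hlt (hmin hE (le_of_not_ge hlt))
  refine ⟨C, hC, fun g => ?_⟩
  by_contra hn
  have hD := hC.smul g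
  have key : ∀ D, Thin S D → (NN S D).ncard = (NN S C).ncard → ¬ Nest C D → (C ∩ D).Infinite → (C ∪ D)ᶜ.Infinite → False := by
    intro D hD he hn h1 h2
    obtain ⟨a, b, c⟩ := NN_key hS hC hD hn h1 h2
    have := hmin' _ a
    have := hmin' _ b
    omega
  have he : (NN S (g • C)).ncard = (NN S C).ncard := NN_smul_ncard g C
  set D := g • C
  by_cases h1 : (C ∩ D).Infinite ∧ (C ∪ D)ᶜ.Infinite
  · exact key D hD he hn h1.1 h1.2
  · refine key Dᶜ (hD.compl hS) (by rw [NN_compl, he]) (fun h => hn (nest_compl_right.1 h)) ?_ ?_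
    · by_contra hf
      apply h1
      rw [not_infinite] at hf
      constructor
      · intro h'
        exact hC.inf ((h'.union hf).subset (by rw [← inter_union_distrib_left]; simp))
      · intro h'
        refine hD.cinf ((h'.union hf).subset ?_)
        intro x hx
        by_cases hc : x ∈ C
        · exact Or.inr ⟨hc, hx⟩
        · exact Or.inl (by simp; exact ⟨hc, hx⟩)
    · by_contra hf
      apply h1
      rw [not_infinite] at hf
      constructor
      · intro h'
        refine hD.inf ((h'.union hf).subset ?_)
        intro x hx
        by_cases hc : x ∈ C
        · exact Or.inl ⟨hc, hx⟩
        · exact Or.inr (by simp; exact ⟨hc, hx⟩)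
      · intro h'
        refine hC.cinf ((h'.union hf).subset ?_)
        intro x hx
        by_cases hc : x ∈ D
        · exact Or.inr (by simp; exact ⟨hx, hc⟩)
        · exact Or.inl (by simp; exact ⟨hx, hc⟩)
end cuts
section cuts
variable {G : Type u} [Group G]
structure Cut (D : Set G) : Prop where
  inf : D.Infinite
  cinf : Dᶜ.Infinite
  ai : ∀ g, {x | x ∈ D ∧ x * g ∉ D}.Finite
  nest : ∀ g : G, Nest D (g • D)
def HH (D : Set G) : Set (Set G) := {Z | ∃ x : G, Z = x • D ∨ Z = x • Dᶜ}
lemma mem_sm {g x : G} {D : Set G} : x ∈ g • D ↔ g⁻¹ * x ∈ D := mem_smul_set_iff_inv_smul_mem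
lemma mul_mem_sm {g x : G} {D : Set G} : g * x ∈ g • D ↔ x ∈ D := by rw [mem_sm]; simp
lemma sm_ssub {a : G} {A B : Set G} : a • A ⊂ a • B ↔ A ⊂ B := by
  simp only [ssubset_iff_subset_not_subset, smul_set_subset_smul_set_iff]
lemma AI_compl {D : Set G} (h : ∀ g, {x | x ∈ D ∧ x * g ∉ D}.Finite) (g : G) :
    {x | x ∈ Dᶜ ∧ x * g ∉ Dᶜ}.Finite := by
  refine ((h g⁻¹).image (fun x => x * g⁻¹)).subset ?_
  rintro x ⟨h1, h2⟩
  exact ⟨x * g, ⟨by simpa using h2, by simpa using h1⟩, by simp⟩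
lemma AI_smul {D : Set G} (h : ∀ g, {x | x ∈ D ∧ x * g ∉ D}.Finite) (a g : G) :
    {x | x ∈ a • D ∧ x * g ∉ a • D}.Finite := by
  refine ((h g).image (fun x => a * x)).subset ?_
  rintro x ⟨h1, h2⟩
  rw [mem_sm] at h1 h2
  exact ⟨a⁻¹ * x, ⟨h1, by simpa [mul_assoc] using h2⟩, by simp⟩
lemma AI_deep {D : Set G} (h : ∀ g, {x | x ∈ D ∧ x * g ∉ D}.Finite) (hinf : D.Infinite)
    {F : Set G} (hF : F.Finite) {B : Set G} (hB : B.Finite) : ∃ x ∈ D, x ∉ B ∧ ∀ f ∈ F, x * f ∈ D := by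
  have : (B ∪ ⋃ f ∈ F, {x | x ∈ D ∧ x * f ∉ D}).Finite := hB.union (hF.biUnion fun f _ => h f)
  obtain ⟨x, hx, hn⟩ := (hinf.diff this).nonempty
  simp only [mem_union, mem_iUnion, mem_setOf_eq, not_or, not_exists, not_and, not_not] at hn
  exact ⟨x, hx, hn.1, fun f hf => hn.2 f hf hx⟩
namespace Cut
variable {D : Set G}
lemma compl (h : Cut D) : Cut Dᶜ :=
  ⟨h.cinf, by simpa using h.inf, AI_compl h.ai, fun g => by
    rw [smul_set_compl]; exact (h.nest g).compl_left.compl_right⟩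
lemma HH_compl_eq : HH Dᶜ = HH D := by
  ext Z; simp only [HH, compl_compl, mem_setOf_eq]; constructor <;> rintro ⟨x, h⟩ <;> exact ⟨x, h.symm⟩
lemma HHc {Z : Set G} (h : Z ∈ HH D) : Zᶜ ∈ HH D := by
  obtain ⟨x, rfl | rfl⟩ := h
  · exact ⟨x, Or.inr (by rw [smul_set_compl])⟩
  · exact ⟨x, Or.inl (by rw [smul_set_compl, compl_compl])⟩
lemma HHs {Z : Set G} (g : G) (h : Z ∈ HH D) : g • Z ∈ HH D := by
  obtain ⟨x, rfl | rfl⟩ := h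
  · exact ⟨g * x, Or.inl (by rw [mul_smul])⟩
  · exact ⟨g * x, Or.inr (by rw [mul_smul])⟩
lemma HHD (x : G) : x • D ∈ HH D := ⟨x, Or.inl rfl⟩
lemma HHDc (x : G) : x • Dᶜ ∈ HH D := ⟨x, Or.inr rfl⟩
lemma HHD1 : D ∈ HH D := ⟨1, Or.inl (by simp)⟩
lemma nestD (h : Cut D) (x y : G) : Nest (x • D) (y • D) := by
  rw [← nest_smul x⁻¹]
  simpa [smul_smul] using h.nest (x⁻¹ * y)
lemma nestH (h : Cut D) {Z Y : Set G} (hZ : Z ∈ HH D) (hY : Y ∈ HH D) : Nest Z Y := by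
  obtain ⟨x, rfl | rfl⟩ := hZ <;> obtain ⟨y, rfl | rfl⟩ := hY <;> try simp only [smul_set_compl]
  · exact h.nestD x y
  · exact (h.nestD x y).compl_right
  · exact (h.nestD x y).compl_left
  · exact (h.nestD x y).compl_left.compl_right
lemma infH (h : Cut D) {Z : Set G} (hZ : Z ∈ HH D) : Z.Infinite := by
  obtain ⟨x, rfl | rfl⟩ := hZ
  · exact h.inf.smul_set
  · exact h.cinf.smul_set
lemma aiH (h : Cut D) {Z : Set G} (hZ : Z ∈ HH D) : ∀ g, {x | x ∈ Z ∧ x * g ∉ Z}.Finite := by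
  obtain ⟨x, rfl | rfl⟩ := hZ
  · exact AI_smul h.ai x
  · exact AI_smul (AI_compl h.ai) x
lemma t1 (h : Cut D) (a b : G) : {x : G | a ∈ x • D ∧ b ∉ x • D}.Finite := by
  refine ((h.ai (a⁻¹ * b)).image (fun y => a * y⁻¹)).subset ?_
  rintro x ⟨h1, h2⟩
  rw [mem_sm] at h1 h2
  exact ⟨x⁻¹ * a, ⟨h1, by simpa [mul_assoc] using h2⟩, by simp⟩
lemma t1H (h : Cut D) (a b : G) : {Z | Z ∈ HH D ∧ a ∈ Z ∧ b ∉ Z}.Finite := by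
  refine (((h.t1 a b).image (fun x => x • D)).union ((h.compl.t1 a b).image (fun x => x • Dᶜ))).subset ?_
  rintro Z ⟨⟨x, rfl | rfl⟩, h1, h2⟩
  · exact Or.inl ⟨x, ⟨h1, h2⟩, rfl⟩
  · exact Or.inr ⟨x, ⟨h1, h2⟩, rfl⟩
lemma stab (h : Cut D) (x : G) : {z : G | z • D = x • D}.Finite := by
  obtain ⟨a, ha⟩ := (h.infH (HHD x)).nonempty
  obtain ⟨b, hb⟩ := (h.infH (HHc (HHD x))).nonempty
  refine (h.t1 a b).subset ?_
  intro z hz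
  simp only [mem_setOf_eq] at hz ⊢
  rw [hz]; exact ⟨ha, hb⟩
lemma stabH (h : Cut D) {Z Y : Set G} (hZ : Z ∈ HH D) : {z : G | z • Z = Y}.Finite := by
  obtain ⟨x, hx⟩ := hZ
  rcases (eq_empty_or_nonempty {z : G | z • Z = Y}) with he | ⟨z0, hz0⟩
  · rw [he]; exact finite_empty
  rcases hx with rfl | rfl
  · refine ((h.stab (z0 * x)).image (fun y => y * x⁻¹)).subset ?_
    intro z hz
    refine ⟨z * x, ?_, by simp⟩
    simp only [mem_setOf_eq] at hz hz0 ⊢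
    rw [mul_smul, mul_smul, hz, hz0]
  · refine ((h.compl.stab (z0 * x)).image (fun y => y * x⁻¹)).subset ?_
    intro z hz
    refine ⟨z * x, ?_, by simp⟩
    simp only [mem_setOf_eq] at hz hz0 ⊢
    rw [mul_smul, mul_smul, hz, hz0]
lemma deep (h : Cut D) {J J' Z : Set G} (hJ : J ∈ HH D) (hZ : Z ∈ HH D)
    (hd : Disjoint J J') {p p' : G} (hp : p ∈ J) (hp' : p' ∈ J') (h1 : p ∈ Z) (h2 : p' ∈ Z) :
    J ⊆ Z ∨ J' ⊆ Z := by
  rcases h.nestH hJ hZ with n | n | n | n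
  · exact Or.inl n
  · exact absurd hp' (Set.disjoint_left.1 hd (n h2))
  · exact absurd h1 (Set.disjoint_left.1 n hp)
  · exact Or.inr ((subset_compl_iff_disjoint_left.2 hd).trans n)
lemma excl (h : Cut D) {a b : G} (ha : a • D ⊆ D) (hb : b • D ⊆ D) (hab : Disjoint (a • D) (b • D)) :
    ∃ u : G, u • Dᶜ ⊆ D := by
  by_contra! hno
  have sub : ∀ x y : G, D ⊆ x • D → D ⊆ y • D → x • D ⊆ y • D ∨ y • D ⊆ x • D := by
    intro x y hx hy
    rcases h.nestD x y with n | n | n | n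
    · exact Or.inl n
    · exact Or.inr n
    · obtain ⟨d, hd⟩ := h.inf.nonempty
      exact absurd (hy hd) (Set.disjoint_left.1 n (hx hd))
    · exfalso
      apply hno (y⁻¹ * x)
      rw [mul_smul, smul_set_compl]
      exact smul_set_subset_iff_subset_inv_smul_set.2 (by simpa using n)
  set B : G → Set (Set G) := fun x => {Z | (∃ z : G, Z = z • D) ∧ D ⊆ Z ∧ Z ⊂ x • D} with hB
  have Bfin : ∀ x, (B x).Finite := by
    intro x
    obtain ⟨d, hd⟩ := h.inf.nonempty
    obtain ⟨e, he⟩ := (h.infH (HHc (HHD x))).nonempty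
    refine (h.t1H d e).subset ?_
    rintro Z ⟨⟨z, rfl⟩, h1, h2⟩
    exact ⟨HHD z, h1 hd, fun h' => he (h2.1 h')⟩
  set N : G → ℕ := fun x => (B x).ncard with hN
  have mulM : ∀ x y : G, D ⊆ x • D → D ⊆ y • D → D ⊆ (x * y) • D := by
    intro x y hx hy
    rw [mul_smul]
    exact hx.trans (smul_set_mono hy)
  have Nadd : ∀ x y : G, D ⊆ x • D → D ⊆ y • D → N (x * y) = N x + N y := by
    intro x y hx hy
    have e : B (x * y) = B x ∪ (fun Z => x • Z) '' B y := by
      ext Z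
      constructor
      · rintro ⟨⟨z, rfl⟩, h1, h2⟩
        by_cases hc : z • D ⊂ x • D
        · exact Or.inl ⟨⟨z, rfl⟩, h1, hc⟩
        · right
          have hxz : x • D ⊆ z • D := by
            rcases sub z x h1 hx with h' | h'
            · by_contra hn
              exact hc ⟨h', hn⟩
            · exact h'
          refine ⟨x⁻¹ • z • D, ⟨⟨x⁻¹ * z, by rw [mul_smul]⟩, ?_, ?_⟩, by simp⟩
          · rw [← smul_set_subset_iff_subset_inv_smul_set]; exact hxz
          · rw [← sm_ssub (a := x)]
            simpa [mul_smul] using h2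
      · rintro (⟨⟨z, rfl⟩, h1, h2⟩ | ⟨_, ⟨⟨z, rfl⟩, h1, h2⟩, rfl⟩)
        · exact ⟨⟨z, rfl⟩, h1, h2.trans_subset (by rw [mul_smul]; exact smul_set_mono hy)⟩
        · refine ⟨⟨x * z, by simp [mul_smul]⟩, hx.trans (smul_set_mono h1), ?_⟩
          rw [mul_smul]; exact sm_ssub.2 h2
    have dis : Disjoint (B x) ((fun Z => x • Z) '' B y) := by
      rw [Set.disjoint_left]
      rintro _ ⟨_, _, h2⟩ ⟨Z, ⟨_, h1, _⟩, rfl⟩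
      exact h2.2 (smul_set_mono h1)
    simp only [hN]
    rw [e, ncard_union_eq dis (Bfin x) ((Bfin y).image _), ncard_image_of_injective _ (MulAction.injective x)]
  have Nle : ∀ x y : G, D ⊆ x • D → x • D ⊂ y • D → N x < N y := by
    intro x y hx hxy
    refine ncard_lt_ncard ⟨?_, fun hc => ?_⟩ (Bfin y)
    · rintro Z ⟨h1, h2, h3⟩; exact ⟨h1, h2, h3.trans hxy⟩
    · exact (hc (show x • D ∈ B y from ⟨⟨x, rfl⟩, hx, hxy⟩)).2.2.2 subset_rfl
  have Ninj : ∀ x y : G, D ⊆ x • D → D ⊆ y • D → N x = N y → x • D = y • D := by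
    intro x y hx hy he
    by_contra hne
    rcases sub x y hx hy with h' | h'
    · have := Nle x y hx (h'.ssubset_of_ne hne); omega
    · have := Nle y x hy (h'.ssubset_of_ne (Ne.symm hne)); omega
  have N1 : N 1 = 0 := by
    have := Nadd 1 1 (by simp) (by simp)
    rw [mul_one] at this; omega
  have Mpow : ∀ x : G, D ⊆ x • D → ∀ n : ℕ, D ⊆ x ^ n • D ∧ N (x ^ n) = n * N x := by
    intro x hx n
    induction n with
    | zero => simp [N1]
    | succ n ih => 
      rw [pow_succ]
      exact ⟨mulM _ _ ih.1 hx, by rw [Nadd _ _ ih.1 hx, ih.2]; ring⟩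
  have ha' : D ⊆ a⁻¹ • D := smul_set_subset_iff_subset_inv_smul_set.1 ha
  have hb' : D ⊆ b⁻¹ • D := smul_set_subset_iff_subset_inv_smul_set.1 hb
  have pos : ∀ a b : G, D ⊆ a⁻¹ • D → b • D ⊆ D → Disjoint (a • D) (b • D) → 0 < N a⁻¹ := by
    intro a b ha hb hab
    rw [← N1]
    apply Nle _ _ (by simp)
    refine ⟨by simpa using ha, fun hc => ?_⟩
    have h1 : D ⊆ a • D := by
      have := smul_set_mono (a := a) hc
      simpa using this
    obtain ⟨d, hd⟩ := (h.infH (HHD b)).nonempty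
    exact Set.disjoint_left.1 hab (h1 (hb hd)) hd
  have pa := pos a b ha' hb hab
  have pb := pos b a hb' ha hab.symm
  set A := (a⁻¹) ^ N b⁻¹ with hA
  set B' := (b⁻¹) ^ N a⁻¹ with hB'
  obtain ⟨A1, A2⟩ := Mpow a⁻¹ ha' (N b⁻¹)
  obtain ⟨B1, B2⟩ := Mpow b⁻¹ hb' (N a⁻¹)
  rw [← hA] at A1 A2
  rw [← hB'] at B1 B2
  have hf : ∀ i : ℕ, (A ^ (i + 1))⁻¹ * B' * A ^ i ∈ {z : G | z • D = (1 : G) • D} := by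
    intro i
    simp only [mem_setOf_eq, one_smul]
    obtain ⟨a1, a2⟩ := Mpow A A1 i
    obtain ⟨a3, a4⟩ := Mpow A A1 (i + 1)
    have := Ninj (B' * A ^ i) (A ^ (i + 1)) (mulM _ _ B1 a1) a3 (by
      rw [Nadd _ _ B1 a1, a2, a4, B2, A2]; ring)
    rw [mul_assoc, mul_smul, this, ← mul_smul]; simp
  have hfin := h.stab 1
  obtain ⟨i, -, j, -, hij, he⟩ := Set.infinite_univ.exists_lt_map_eq_of_mapsTo (f := fun i : ℕ => (A ^ (i + 1))⁻¹ * B' * A ^ i) (fun i _ => hf i) hfin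
  obtain ⟨n, rfl⟩ := Nat.exists_eq_add_of_lt hij
  have hcomm : A ^ (n + 1) * B' = B' * A ^ (n + 1) := by
    have e1 : A ^ (i + n + 1 + 1) = A ^ (n + 1) * A ^ (i + 1) := by rw [← pow_add]; congr 1; omega
    have e2 : A ^ (i + n + 1) = A ^ (n + 1) * A ^ i := by rw [← pow_add]; congr 1; omega
    have he' : (A ^ (i + 1))⁻¹ * B' * A ^ i = (A ^ (i + n + 1 + 1))⁻¹ * B' * A ^ (i + n + 1) := he
    rw [e1, e2, mul_inv_rev] at he'
    have : B' = (A ^ (n + 1))⁻¹ * B' * A ^ (n + 1) := by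
      have := congrArg (fun z => A ^ (i + 1) * z * (A ^ i)⁻¹) he'
      simp only [mul_assoc, mul_inv_cancel_left, mul_inv_cancel, mul_one] at this
      simpa [mul_assoc] using this
    calc A ^ (n + 1) * B' = A ^ (n + 1) * ((A ^ (n + 1))⁻¹ * B' * A ^ (n + 1)) := by rw [← this]
      _ = _ := by group
  have subp : ∀ a : G, a • D ⊆ D → ∀ n : ℕ, a ^ n • D ⊆ D := by
    intro a ha n
    induction n with
    | zero => simp
    | succ n ih => rw [pow_succ, mul_smul]; exact (smul_set_mono ha).trans ih
  have subp1 : ∀ a : G, a • D ⊆ D → ∀ n : ℕ, 0 < n → a ^ n • D ⊆ a • D := by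
    intro a ha n hn
    obtain ⟨m, rfl⟩ := Nat.exists_eq_add_of_lt hn
    rw [zero_add, pow_succ', mul_smul]; exact smul_set_mono (subp a ha m)
  have i1 : (A ^ (n + 1))⁻¹ = a ^ (N b⁻¹ * (n + 1)) := by rw [hA, ← pow_mul, inv_pow, inv_inv]
  have i2 : B'⁻¹ = b ^ (N a⁻¹) := by rw [hB', inv_pow, inv_inv]
  have hc2 : a ^ (N b⁻¹ * (n + 1)) * b ^ (N a⁻¹) = b ^ (N a⁻¹) * a ^ (N b⁻¹ * (n + 1)) := by
    rw [← i1, ← i2, ← mul_inv_rev, ← mul_inv_rev, hcomm]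
  have s1 : (a ^ (N b⁻¹ * (n + 1)) * b ^ (N a⁻¹)) • D ⊆ a • D := by
    rw [mul_smul]; exact (smul_set_mono (subp b hb _)).trans (subp1 a ha _ (by positivity))
  have s2 : (a ^ (N b⁻¹ * (n + 1)) * b ^ (N a⁻¹)) • D ⊆ b • D := by
    rw [hc2, mul_smul]; exact (smul_set_mono (subp a ha _)).trans (subp1 b hb _ pa)
  obtain ⟨d, hd⟩ := (h.infH (HHD (a ^ (N b⁻¹ * (n + 1)) * b ^ (N a⁻¹)))).nonempty
  exact Set.disjoint_left.1 hab (s1 hd) (s2 hd)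
end Cut
end cuts
section cuts
variable {G : Type u} [Group G]
lemma AI_of_bd {S : Finset G} (hS : Gen S) {C : Set G} (h : (bd S C).Finite) :
    ∀ g, {x | x ∈ C ∧ x * g ∉ C}.Finite := by
  refine hS.ind _ 1 (by simp) fun g hg s hs => ?_
  refine (hg.union (h.image (fun p => p.1 * g⁻¹))).subset ?_
  rintro x ⟨h1, h2⟩
  by_cases hc : x * g ∈ C
  · exact Or.inr ⟨(x * g, s), ⟨hs, hc, by simpa [mul_assoc] using h2⟩, by simp⟩
  · exact Or.inl ⟨h1, hc⟩
structure CutSys (D : Set G) : Prop extends Cut D where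
  u1 : ∃ u : G, u • Dᶜ ⊆ D
  u2 : ∃ u : G, u • D ⊆ Dᶜ
  y : ∃ y1 y2 : G, y1 • D ⊆ D ∧ y2 • D ⊆ D ∧ Disjoint (y1 • D) (y2 • D)
lemma exists_cutsys [Group.FG G] (h : InfinitelyManyEnds G) :
    ∃ S : Finset G, Gen S ∧ 1 ∈ S ∧ ∃ D : Set G, CutSys D := by
  classical
  obtain ⟨S0, hS0⟩ := Group.fg_def.1 (inferInstance : Group.FG G)
  set S : Finset G := S0 ∪ S0.image (fun x => x⁻¹) ∪ {1} with hSdef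
  have memS : ∀ s, s ∈ S ↔ s ∈ S0 ∨ s⁻¹ ∈ S0 ∨ s = 1 := by
    intro s
    simp only [hSdef, Finset.mem_union, Finset.mem_image, Finset.mem_singleton, or_assoc]
    constructor
    · rintro (h | ⟨a, h, rfl⟩ | h)
      · exact Or.inl h
      · exact Or.inr (Or.inl (by simpa using h))
      · exact Or.inr (Or.inr h)
    · rintro (h | h | h)
      · exact Or.inl h
      · exact Or.inr (Or.inl ⟨s⁻¹, h, by simp⟩)
      · exact Or.inr (Or.inr h)
  have hS : Gen S := by
    refine ⟨fun s hs => ?_, ?_⟩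
    · rw [memS] at hs ⊢
      simp only [inv_inv, inv_eq_one]; tauto
    · rw [eq_top_iff, ← hS0]
      exact Subgroup.closure_mono (fun s hs => by simp [hSdef, Finset.mem_coe.1 hs])
  refine ⟨S, hS, by simp [hSdef], ?_⟩
  obtain ⟨K, P1, P2, P3, hK, ⟨d12, d13, d23⟩, hP⟩ := three_pieces S0 (h S0 hS0)
  have hPbd : ∀ P, (P = P1 ∨ P = P2 ∨ P = P3) → (bd S P).Finite := by
    intro P hPP
    obtain ⟨p1, p2, p3⟩ := hP P hPP
    refine ((hK.prod S.finite_toSet).image (fun q => (q.1 * q.2⁻¹, q.2))).subset ?_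
    rintro ⟨x, s⟩ ⟨h1, h2, h3⟩
    refine ⟨(x * s, s), ⟨?_, h1⟩, by simp⟩
    by_contra hn
    rcases (memS s).1 h1 with h' | h' | h'
    · exact h3 (p3 x h2 s (Or.inl h') hn)
    · exact h3 (p3 x h2 s (Or.inr h') hn)
    · exact h3 (by simpa [h'] using h2)
  obtain ⟨D, hT, hnest⟩ := exists_nested hS (hP P1 (by simp)).1
    ((hP P2 (by simp)).1.mono (subset_compl_iff_disjoint_left.2 d12)) (hPbd P1 (by simp))
  have hD : Cut D := ⟨hT.inf, hT.cinf, AI_of_bd hS hT.fin, hnest⟩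
  have hconn : ∀ Z ∈ HH D, Conn S Z := by
    rintro Z ⟨x, rfl | rfl⟩
    · exact (hT.smul x).conn hS
    · exact ((hT.compl hS).smul x).conn hS
  obtain ⟨dp, hdp⟩ := hD.inf.nonempty
  obtain ⟨dm, hdm⟩ := hD.cinf.nonempty
  have hJ : ∀ P, (P = P1 ∨ P = P2 ∨ P = P3) → ∃ J ∈ HH D, J ⊆ P := by
    intro P hPP
    obtain ⟨p1, p2, p3⟩ := hP P hPP
    have hB : (⋃ k ∈ K, ⋃ l ∈ K, {x : G | k ∈ x • D ∧ l ∉ x • D}).Finite :=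
      hK.biUnion fun k _ => hK.biUnion fun l _ => hD.t1 k l
    obtain ⟨x, hx, hxB, hxF⟩ := AI_deep (AI_of_bd hS (hPbd P hPP)) p1 (F := {dp, dm}) (by simp) hB
    simp only [mem_iUnion, mem_setOf_eq, not_exists, not_and, not_not] at hxB
    have key : ∀ J ∈ HH D, Disjoint J K → (J ∩ P).Nonempty → J ⊆ P := by
      intro J hJ hdj hne
      have := hconn J hJ (J ∩ P) inter_subset_left hne (fun c hc s hs hm => ⟨hm, ?_⟩)
      · rw [← this]; exact inter_subset_right
      · by_contra hn
        have hnK : c * s ∉ K := Set.disjoint_left.1 hdj hm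
        rcases (memS s).1 hs with h' | h' | h'
        · exact hn (p3 c hc.2 s (Or.inl h') hnK)
        · exact hn (p3 c hc.2 s (Or.inr h') hnK)
        · exact hn (by simpa [h'] using hc.2)
    by_cases hc : ∃ k ∈ K, k ∈ x • D
    · obtain ⟨k, hk, hkx⟩ := hc
      refine ⟨x • Dᶜ, Cut.HHDc x, key _ (Cut.HHDc x) ?_ ⟨x * dm, mul_mem_sm.2 hdm, hxF dm (by simp)⟩⟩
      rw [Set.disjoint_right]
      intro l hl hl'
      rw [smul_set_compl] at hl'
      exact hl' (hxB k hk l hl hkx)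
    · push Not at hc
      refine ⟨x • D, Cut.HHD x, key _ (Cut.HHD x) ?_ ⟨x * dp, mul_mem_sm.2 hdp, hxF dp (by simp)⟩⟩
      rw [Set.disjoint_right]
      exact hc
  obtain ⟨J1, hJ1, s1⟩ := hJ P1 (by simp)
  obtain ⟨J2, hJ2, s2⟩ := hJ P2 (by simp)
  obtain ⟨J3, hJ3, s3⟩ := hJ P3 (by simp)
  have e12 := d12.mono s1 s2
  have e13 := d13.mono s1 s3
  have e23 := d23.mono s2 s3
  obtain ⟨q1, hq1⟩ := (hD.infH hJ1).nonempty
  obtain ⟨q2, hq2⟩ := (hD.infH hJ2).nonempty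
  obtain ⟨q3, hq3⟩ := (hD.infH hJ3).nonempty
  have two : ∀ Z ∈ HH D, ∃ J ∈ HH D, ∃ J' ∈ HH D, J ⊆ Z ∧ J' ⊆ Z ∧ Disjoint J J' := by
    intro Z hZ
    obtain ⟨x, hx, -, hxF⟩ := AI_deep (hD.aiH hZ) (hD.infH hZ) (F := {q1, q2, q3}) (by simp) finite_empty
    have t1 := hxF q1 (by simp)
    have t2 := hxF q2 (by simp)
    have t3 := hxF q3 (by simp)
    have f12 : Disjoint (x • J1) (x • J2) := (disjoint_smul_set (a := x)).2 e12
    have f13 : Disjoint (x • J1) (x • J3) := (disjoint_smul_set (a := x)).2 e13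
    have f23 : Disjoint (x • J2) (x • J3) := (disjoint_smul_set (a := x)).2 e23
    have g1 := Cut.HHs x hJ1
    have g2 := Cut.HHs x hJ2
    have g3 := Cut.HHs x hJ3
    have r1 := mul_mem_sm (g := x) |>.2 hq1
    have r2 := mul_mem_sm (g := x) |>.2 hq2
    have r3 := mul_mem_sm (g := x) |>.2 hq3
    rcases hD.deep g1 hZ f12 r1 r2 t1 t2 with a | a
    · rcases hD.deep g2 hZ f23 r2 r3 t2 t3 with b | b
      · exact ⟨_, g1, _, g2, a, b, f12⟩
      · exact ⟨_, g1, _, g3, a, b, f13⟩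
    · rcases hD.deep g1 hZ f13 r1 r3 t1 t3 with b | b
      · exact ⟨_, g1, _, g2, b, a, f12⟩
      · exact ⟨_, g2, _, g3, a, b, f23⟩
  have exu : ∀ D : Set G, Cut D → (∀ Z ∈ HH D, ∃ J ∈ HH D, ∃ J' ∈ HH D, J ⊆ Z ∧ J' ⊆ Z ∧ Disjoint J J') →
      ∃ u : G, u • Dᶜ ⊆ D := by
    intro D hD two
    obtain ⟨J, ⟨a, rfl | rfl⟩, J', ⟨b, rfl | rfl⟩, h1, h2, h3⟩ := two D Cut.HHD1
    · exact hD.excl h1 h2 h3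
    · exact ⟨b, h2⟩
    · exact ⟨a, h1⟩
    · exact ⟨a, h1⟩
  obtain ⟨u1, hu1⟩ := exu D hD two
  obtain ⟨u2, hu2⟩ := exu Dᶜ hD.compl (by rw [Cut.HH_compl_eq]; exact two)
  rw [compl_compl] at hu2
  have inD : ∀ Z ∈ HH D, ∃ y : G, y • D ⊆ Z := by
    rintro Z ⟨x, rfl | rfl⟩
    · exact ⟨x, subset_rfl⟩
    · exact ⟨x * u2, by rw [mul_smul]; exact smul_set_mono hu2⟩
  obtain ⟨J, hJ, J', hJ', h1, h2, h3⟩ := two D Cut.HHD1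
  obtain ⟨y1, hy1⟩ := inD J hJ
  obtain ⟨y2, hy2⟩ := inD J' hJ'
  exact ⟨D, ⟨hD, ⟨u1, hu1⟩, ⟨u2, hu2⟩, ⟨y1, y2, hy1.trans h1, hy2.trans h2, h3.mono hy1 hy2⟩⟩⟩
namespace CutSys
variable {D : Set G}
lemma inD (h : CutSys D) {Z : Set G} (hZ : Z ∈ HH D) : ∃ y : G, y • D ⊆ Z := by
  obtain ⟨u, hu⟩ := h.u2
  obtain ⟨x, rfl | rfl⟩ := hZ
  · exact ⟨x, subset_rfl⟩
  · exact ⟨x * u, by rw [mul_smul]; exact smul_set_mono hu⟩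
lemma compl (h : CutSys D) : CutSys Dᶜ := by
  obtain ⟨u1, hu1⟩ := h.u1
  obtain ⟨u2, hu2⟩ := h.u2
  obtain ⟨y1, y2, a, b, c⟩ := h.y
  refine ⟨h.toCut.compl, ⟨u2, by simpa using hu2⟩, ⟨u1, by simpa using hu1⟩, u2 * y1 * u1, u2 * y2 * u1, ?_, ?_, ?_⟩
  · rw [mul_smul, mul_smul]; exact (smul_set_mono ((smul_set_mono hu1).trans a)).trans hu2
  · rw [mul_smul, mul_smul]; exact (smul_set_mono ((smul_set_mono hu1).trans b)).trans hu2
  · simp only [mul_smul]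
    exact (disjoint_smul_set (a := u2)).2 (c.mono (smul_set_mono hu1) (smul_set_mono hu1))
lemma t4 (h : CutSys D) {H : Set G} (hH : H ∈ HH D) : {x : G | (x • D \ H).Finite ∧ (H \ x • D).Finite}.Finite := by
  obtain ⟨y1, y2, a, b, c⟩ := h.y
  have two : ∀ Z ∈ HH D, ∃ J ∈ HH D, ∃ J' ∈ HH D, J ⊆ Z ∧ J' ⊆ Z ∧ Disjoint J J' := by
    intro Z hZ
    obtain ⟨y, hy⟩ := h.inD hZ
    refine ⟨_, Cut.HHs y (Cut.HHD y1), _, Cut.HHs y (Cut.HHD y2), (smul_set_mono a).trans hy, (smul_set_mono b).trans hy, (disjoint_smul_set (a := y)).2 c⟩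
  obtain ⟨J1, k1, J2, k2, l1, l2, l3⟩ := two H hH
  obtain ⟨K1, k3, K2, k4, l4, l5, l6⟩ := two Hᶜ (Cut.HHc hH)
  obtain ⟨q1, hq1⟩ := (h.infH k1).nonempty
  obtain ⟨q2, hq2⟩ := (h.infH k2).nonempty
  obtain ⟨q3, hq3⟩ := (h.infH k3).nonempty
  obtain ⟨q4, hq4⟩ := (h.infH k4).nonempty
  have hF : ({q1, q2, q3, q4} : Set G).Finite := by simp
  refine (hF.biUnion fun p _ => hF.biUnion fun q _ => h.t1 p q).subset ?_
  rintro x ⟨f1, f2⟩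
  simp only [mem_iUnion]
  by_contra! hcon
  simp only [mem_setOf_eq, not_and, not_not] at hcon
  by_cases hx : q1 ∈ x • D
  · rcases h.deep k3 (Cut.HHD x) l6 hq3 hq4 (hcon q1 (by simp) q3 (by simp) hx) (hcon q1 (by simp) q4 (by simp) hx) with m | m
    · exact h.infH k3 (f1.subset fun z hz => ⟨m hz, l4 hz⟩)
    · exact h.infH k4 (f1.subset fun z hz => ⟨m hz, l5 hz⟩)
  · have hx2 : q2 ∉ x • D := fun h2 => hx (hcon q2 (by simp) q1 (by simp) h2)
    rcases h.deep k1 (Cut.HHc (Cut.HHD x)) l3 hq1 hq2 hx hx2 with m | m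
    · exact h.infH k1 (f2.subset fun z hz => ⟨l1 hz, m hz⟩)
    · exact h.infH k2 (f2.subset fun z hz => ⟨l2 hz, m hz⟩)
end CutSys
end cuts
section metric
variable {G : Type u} [Group G]
def sep (D : Set G) (x y : G) : Set (Set G) := {Z | Z ∈ HH D ∧ x ∈ Z ∧ y ∉ Z}
def dd (D : Set G) (x y : G) : ℕ := (sep D x y).ncard
def gps (D : Set G) (p x y : G) : Set (Set G) := {Z | Z ∈ HH D ∧ p ∈ Z ∧ x ∉ Z ∧ y ∉ Z}
def gp (D : Set G) (p x y : G) : ℕ := (gps D p x y).ncard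
namespace Cut
variable {D : Set G}
lemma sep_fin (h : Cut D) (x y : G) : (sep D x y).Finite := h.t1H x y
lemma gps_fin (h : Cut D) (p x y : G) : (gps D p x y).Finite := (h.t1H p x).subset fun Z hZ => ⟨hZ.1, hZ.2.1, hZ.2.2.1⟩
lemma compl_image_ncard (A B : Set (Set G)) (hAB : ∀ Z, Z ∈ B ↔ Zᶜ ∈ A) : B.ncard = A.ncard := by
  have : B = (fun Z : Set G => Zᶜ) '' A := by
    ext Z; rw [hAB, ]
    constructor
    · intro h; exact ⟨_, h, by simp⟩
    · rintro ⟨Y, h, rfl⟩; simpa using h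
  rw [this, ncard_image_of_injective _ _root_.compl_injective]
lemma HHc_iff {Z : Set G} : Zᶜ ∈ HH D ↔ Z ∈ HH D := ⟨fun h => by simpa using HHc h, HHc⟩
lemma HHs_iff {Z : Set G} {g : G} : g • Z ∈ HH D ↔ Z ∈ HH D := ⟨fun h => by simpa using HHs g⁻¹ h, HHs g⟩
lemma dd_symm (x y : G) : dd D x y = dd D y x :=
  compl_image_ncard _ _ fun Z => by simp [sep, HHc_iff]; tauto
lemma dd_self (x : G) : dd D x x = 0 := by
  have : sep D x x = ∅ := by ext Z; simp [sep]
  rw [dd, this, ncard_empty]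
lemma dd_smul (g x y : G) : dd D (g * x) (g * y) = dd D x y := by
  have : sep D (g * x) (g * y) = (fun Z => g • Z) '' sep D x y := by
    ext Z
    constructor
    · rintro ⟨h1, h2, h3⟩
      refine ⟨g⁻¹ • Z, ⟨HHs _ h1, ?_, ?_⟩, by simp⟩
      · rw [mem_sm]; simpa using h2
      · rw [mem_sm]; simpa using h3
    · rintro ⟨Z, ⟨h1, h2, h3⟩, rfl⟩
      exact ⟨HHs _ h1, mul_mem_sm.2 h2, fun h => h3 (mul_mem_sm.1 h)⟩
  rw [dd, this, ncard_image_of_injective _ (MulAction.injective g)]; rfl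
lemma gp_symm (p x y : G) : gp D p x y = gp D p y x := by
  unfold gp; congr 1; ext Z; simp [gps]; tauto
lemma dd_split (h : Cut D) (p x y : G) : dd D p x = gp D p x y + gp D x p y := by
  have e : gp D x p y = {Z | Z ∈ HH D ∧ p ∈ Z ∧ x ∉ Z ∧ y ∈ Z}.ncard :=
    compl_image_ncard _ _ fun Z => by simp [gps, HHc_iff]; tauto
  have hd : Disjoint (gps D p x y) {Z | Z ∈ HH D ∧ p ∈ Z ∧ x ∉ Z ∧ y ∈ Z} := by
    rw [Set.disjoint_left]; rintro Z ⟨_, _, _, h1⟩ ⟨_, _, _, h2⟩; exact h1 h2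
  rw [e, dd, gp, ← ncard_union_eq hd (h.gps_fin _ _ _) ((h.t1H p x).subset fun Z hZ => ⟨hZ.1, hZ.2.1, hZ.2.2.1⟩)]
  congr 1; ext Z; simp [sep, gps]; tauto
lemma gp_formula (h : Cut D) (p x y : G) : dd D p x + dd D p y = dd D x y + 2 * gp D p x y := by
  have e1 := h.dd_split p x y
  have e2 := h.dd_split p y x
  have e3 := h.dd_split x y p
  rw [gp_symm p y x] at e2
  rw [gp_symm x y p, gp_symm y x p] at e3
  omega
lemma dd_tri (h : Cut D) (x y z : G) : dd D x z ≤ dd D x y + dd D y z := by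
  have := h.gp_formula y x z
  rw [dd_symm y x] at this
  omega
lemma gps_chain (h : Cut D) {p x : G} {Z Y : Set G} (hZ : Z ∈ HH D) (hY : Y ∈ HH D)
    (h1 : p ∈ Z) (h2 : p ∈ Y) (h3 : x ∉ Z) (h4 : x ∉ Y) : Z ⊆ Y ∨ Y ⊆ Z := by
  rcases h.nestH hZ hY with n | n | n | n
  · exact Or.inl n
  · exact Or.inr n
  · exact absurd h2 (Set.disjoint_left.1 n h1)
  · exact absurd (n h3) h4
lemma gp_min (h : Cut D) (p x y z : G) : gp D p x y ≤ gp D p x z ∨ gp D p y z ≤ gp D p x z := by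
  by_cases hs : gps D p x y ⊆ gps D p y z
  · left
    refine ncard_le_ncard (fun Z hZ => ?_) (h.gps_fin _ _ _)
    have := hs hZ
    exact ⟨hZ.1, hZ.2.1, hZ.2.2.1, this.2.2.2⟩
  · right
    obtain ⟨Y, hY, hYn⟩ := not_subset.1 hs
    refine ncard_le_ncard (fun Z hZ => ⟨hZ.1, hZ.2.1, ?_, hZ.2.2.2⟩) (h.gps_fin _ _ _)
    have hz : z ∈ Y := by
      by_contra hn
      exact hYn ⟨hY.1, hY.2.1, hY.2.2.2, hn⟩
    rcases h.gps_chain hY.1 hZ.1 hY.2.1 hZ.2.1 hY.2.2.2 hZ.2.2.1 with n | n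
    · exact absurd (n hz) hZ.2.2.2
    · exact fun hx => hY.2.2.1 (n hx)
lemma four_pt (h : Cut D) (x y z w : G) :
    dd D x y + dd D z w ≤ dd D x z + dd D y w ∨ dd D x y + dd D z w ≤ dd D x w + dd D y z := by
  have e1 := h.gp_formula x y z
  have e2 := h.gp_formula x y w
  have e3 := h.gp_formula x z w
  have e4 := h.gp_min x z y w
  rw [gp_symm x z y] at e4
  have := dd_symm (D := D) z w
  omega
lemma loc_fwd (h : Cut D) (P : ℕ → G) (A b r : ℕ) (hA : 2 * b < A)
    (h1 : ∀ i, i + 1 ≤ r → A ≤ dd D (P i) (P (i + 1)))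
    (h2 : ∀ i, i + 2 ≤ r → gp D (P (i + 1)) (P i) (P (i + 2)) ≤ b) :
    ∀ n i, i + 2 + n ≤ r → gp D (P (i + 1)) (P i) (P (i + 2 + n)) ≤ b := by
  intro n
  induction n with
  | zero => intro i hi; exact h2 i hi
  | succ n ih =>
    intro i hi
    have a1 := ih (i + 1) (by omega)
    rw [show i + 1 + 2 + n = i + 2 + (n + 1) by ring, show i + 1 + 1 = i + 2 by ring] at a1
    have a2 := h2 i (by omega)
    have a3 := h.gp_min (P (i + 1)) (P i) (P (i + 2 + (n + 1))) (P (i + 2))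
    have a4 := h.dd_split (P (i + 1)) (P (i + 2)) (P (i + 2 + (n + 1)))
    have a5 := h1 (i + 1) (by omega)
    rw [show i + 1 + 1 = i + 2 by ring] at a5
    rw [gp_symm (P (i + 1)) (P (i + 2 + (n + 1)))] at a3
    omega
lemma loc_bwd (h : Cut D) (P : ℕ → G) (A b r : ℕ) (hA : 2 * b < A)
    (h1 : ∀ i, i + 1 ≤ r → A ≤ dd D (P i) (P (i + 1)))
    (h2 : ∀ i, i + 2 ≤ r → gp D (P (i + 1)) (P i) (P (i + 2)) ≤ b) :
    ∀ j, j + 2 ≤ r → gp D (P (j + 1)) (P 0) (P (j + 2)) ≤ b := by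
  intro j
  induction j with
  | zero => intro hj; exact h2 0 hj
  | succ j ih =>
    intro hj
    have a1 := ih (by omega)
    have a2 := h2 (j + 1) hj
    have a3 := h.gp_min (P (j + 2)) (P (j + 3)) (P 0) (P (j + 1))
    have a4 := h.dd_split (P (j + 1)) (P (j + 2)) (P 0)
    have a5 := h1 (j + 1) (by omega)
    rw [show j + 1 + 1 = j + 2 by ring] at a2 a5
    rw [show j + 1 + 2 = j + 3 by ring] at a2
    rw [gp_symm (P (j + 2)) (P (j + 1)) (P (j + 3))] at a2
    rw [gp_symm (P (j + 1)) (P 0) (P (j + 2))] at a1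
    rw [gp_symm (P (j + 2)) (P (j + 3)) (P 0), gp_symm (P (j + 2)) (P 0) (P (j + 1))] at a3
    show gp D (P (j + 2)) (P 0) (P (j + 3)) ≤ b
    omega
end Cut
end metric
section bbt
variable {G : Type u} [Group G]
def mm (H W : Set G) : Prop := H ⊆ W ∨ Hᶜ ⊂ W
def Rep (D H : Set G) (q : G) : Prop := H = q • D ∨ H = q • Dᶜ
def SameV (D H H' : Set G) : Prop := ∀ Y ∈ HH D, mm H Y ↔ mm H' Y
lemma Rep.HH {D H : Set G} {q : G} (h : Rep D H q) : H ∈ HH D := ⟨q, h⟩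
lemma Rep.compl {D H : Set G} {q : G} (h : Rep D H q) : Rep D Hᶜ q := by
  rcases h with rfl | rfl
  · right; rw [smul_set_compl]
  · left; rw [smul_set_compl, compl_compl]
lemma Rep.smul {D H : Set G} {q : G} (g : G) (h : Rep D H q) : Rep D (g • H) (g * q) := by
  rcases h with rfl | rfl
  · left; rw [mul_smul]
  · right; rw [mul_smul]
lemma mm_mono {H W W' : Set G} (h : mm H W) (hw : W ⊆ W') : mm H W' :=
  h.imp (fun h => h.trans hw) (fun h => h.trans_subset hw)
lemma mm_smul (g : G) {H W : Set G} : mm (g • H) (g • W) ↔ mm H W := by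
  simp only [mm, ← smul_set_compl, smul_set_subset_smul_set_iff, sm_ssub]
namespace Cut
variable {D : Set G}
lemma mm_or (h : Cut D) {H W : Set G} (hH : H ∈ HH D) (hW : W ∈ HH D) : mm H W ∨ mm H Wᶜ := by
  rcases h.nestH hH hW with n | n | n | n
  · exact Or.inl (Or.inl n)
  · by_cases e : H ⊆ W
    · exact Or.inl (Or.inl e)
    · right; right; exact ⟨compl_subset_compl.2 n, fun hh => e (compl_subset_compl.1 hh)⟩
  · right; left; exact n.subset_compl_right
  · by_cases e : H ⊆ Wᶜ
    · exact Or.inr (Or.inl e)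
    · left; right; exact ⟨n, fun hh => e (by intro x hx hxw; exact hh hxw hx)⟩
lemma mm_not (h : Cut D) {H W : Set G} (hH : H ∈ HH D) (h1 : mm H W) (h2 : mm H Wᶜ) : False := by
  obtain ⟨a, ha⟩ := (h.infH hH).nonempty
  obtain ⟨b, hb⟩ := (h.infH (HHc hH)).nonempty
  rcases h1 with h1 | h1 <;> rcases h2 with h2 | h2
  · exact h2 ha (h1 ha)
  · exact h2.2 (compl_subset_compl.2 h1)
  · exact h1.2 (fun x hx hxH => h2 hxH hx)
  · exact h2.1 hb (h1.1 hb)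
lemma mm_compl (h : Cut D) {H W : Set G} (hH : H ∈ HH D) (hW : W ∈ HH D) : mm H Wᶜ ↔ ¬ mm H W :=
  ⟨fun h1 h2 => h.mm_not hH h2 h1, fun h1 => (h.mm_or hH hW).resolve_left h1⟩
lemma sameV_of (h : Cut D) {H H' : Set G} (hH : H ∈ HH D) (hH' : H' ∈ HH D)
    (hs : ∀ Y ∈ HH D, mm H Y → mm H' Y) : SameV D H H' := fun Y hY =>
  ⟨hs Y hY, fun h1 => by
    by_contra h2
    rw [← h.mm_compl hH hY] at h2
    exact h.mm_not hH' h1 (hs _ (HHc hY) h2)⟩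
lemma mm_fin (h : Cut D) {H : Set G} (hH : H ∈ HH D) (g : G) :
    {Y | Y ∈ HH D ∧ mm H Y ∧ g ∉ Y}.Finite := by
  obtain ⟨a, ha⟩ := (h.infH hH).nonempty
  obtain ⟨b, hb⟩ := (h.infH (HHc hH)).nonempty
  refine ((h.t1H a g).union (h.t1H b g)).subset ?_
  rintro Y ⟨h1, h2 | h2, h3⟩
  · exact Or.inl ⟨h1, h2 ha, h3⟩
  · exact Or.inr ⟨h1, h2.1 hb, h3⟩
lemma mm_fin2 (h : Cut D) {H H' : Set G} (hH : H ∈ HH D) (hH' : H' ∈ HH D) :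
    {Y | Y ∈ HH D ∧ mm H Y ∧ ¬ mm H' Y}.Finite := by
  obtain ⟨a, ha⟩ := (h.infH hH').nonempty
  obtain ⟨b, hb⟩ := (h.infH (HHc hH')).nonempty
  refine ((h.mm_fin hH a).union (h.mm_fin hH b)).subset ?_
  rintro Y ⟨h1, h2, h3⟩
  rw [← h.mm_compl hH' h1] at h3
  rcases h3 with h3 | h3
  · exact Or.inl ⟨h1, h2, h3 ha⟩
  · exact Or.inr ⟨h1, h2, h3.1 hb⟩
lemma exists_W0 (h : Cut D) : ∃ W0 y, Rep D W0 y ∧ ∀ Y ∈ HH D, mm W0 Y ↔ (1 : G) ∈ Y := by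
  obtain ⟨Z, hZ, h1⟩ : ∃ Z ∈ HH D, (1 : G) ∈ Z := by
    by_cases h1 : (1 : G) ∈ D
    · exact ⟨D, HHD1, h1⟩
    · exact ⟨Dᶜ, HHc HHD1, h1⟩
  obtain ⟨b, hb⟩ := (h.infH (HHc hZ)).nonempty
  obtain ⟨W0, hW0, hm⟩ := (h.t1H 1 b).exists_minimal ⟨Z, hZ, h1, hb⟩
  obtain ⟨y, hy⟩ := hW0.1
  have key : ∀ Y ∈ HH D, (1 : G) ∈ Y → mm W0 Y := by
    intro Y hY hY1
    rcases h.nestH hW0.1 hY with n | n | n | n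
    · exact Or.inl n
    · exact Or.inl (hm ⟨hY, hY1, fun hh => hW0.2.2 (n hh)⟩ n)
    · exact absurd hY1 (Set.disjoint_left.1 n hW0.2.1)
    · exact Or.inr ⟨n, fun hh => hh hY1 hW0.2.1⟩
  refine ⟨W0, y, hy, fun Y hY => ⟨fun hmm => ?_, key Y hY⟩⟩
  by_contra hn
  exact h.mm_not hW0.1 hmm (key _ (HHc hY) hn)
def GN (D W0 : Set G) (y : G) (u : Set G) (g : G) (H : Set G) (q : G) : Prop :=
  Rep D H q ∧ SameV D u H ∧ (((∀ Y ∈ HH D, mm u Y → g ∈ Y) ∧ q = g * y) ∨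
    (g ∉ H ∧ ∀ Y ∈ HH D, mm u Y → g ∉ Y → H ⊆ Y))
lemma GN_exists (h : Cut D) {W0 : Set G} {y : G} (hy : Rep D W0 y)
    (hW : ∀ Y ∈ HH D, mm W0 Y ↔ (1 : G) ∈ Y) {u : Set G} (hu : u ∈ HH D) (g : G) :
    ∃ H q, GN D W0 y u g H q := by
  by_cases hall : ∀ Y ∈ HH D, mm u Y → g ∈ Y
  · refine ⟨g • W0, g * y, hy.smul g, ?_, Or.inl ⟨hall, rfl⟩⟩
    refine h.sameV_of hu (HHs g hy.HH) fun Y hY hm => ?_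
    have := (hW _ (HHs g⁻¹ hY)).2 (by rw [mem_sm]; simpa using hall Y hY hm)
    rw [← mm_smul g] at this; simpa using this
  · push Not at hall
    obtain ⟨Y0, hY0, m0, g0⟩ := hall
    obtain ⟨Y, hYY, hm⟩ := (h.mm_fin hu g).exists_minimal ⟨Y0, hY0, m0, g0⟩
    obtain ⟨hY, mY, gY⟩ := hYY
    obtain ⟨q, hq⟩ := hY
    have key : ∀ W ∈ HH D, mm u W → Y ⊆ W ∨ Yᶜ ⊆ W := by
      intro W hW mW
      rcases h.nestH ⟨q, hq⟩ hW with n | n | n | n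
      · exact Or.inl n
      · exact Or.inl (hm ⟨hW, mW, fun hh => gY (n hh)⟩ n)
      · exact (h.mm_not hu mW (mm_mono mY n.subset_compl_right)).elim
      · exact Or.inr n
    refine ⟨Y, q, hq, h.sameV_of hu ⟨q, hq⟩ fun W hW mW => ?_, Or.inr ⟨gY, fun W hW mW gW => ?_⟩⟩
    · rcases key W hW mW with k | k
      · exact Or.inl k
      · refine Or.inr ⟨k, fun hh => h.mm_not hu mY (mm_mono mW hh)⟩
    · exact (key W hW mW).resolve_right fun k => gW (k gY)
lemma GN_of_node (h : Cut D) {W0 : Set G} {y : G} {u H : Set G} {q : G} (hq : Rep D H q) (hs : SameV D u H) :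
    ∃ g, GN D W0 y u g H q := by
  obtain ⟨g, hg⟩ := (h.infH (HHc hq.HH)).nonempty
  refine ⟨g, hq, hs, Or.inr ⟨hg, fun Y hY mY gY => ?_⟩⟩
  rcases (hs Y hY).1 mY with k | k
  · exact k
  · exact absurd (k.1 hg) gY
lemma GN_close (h : Cut D) (y σ : G) : ∃ P : Set G, P.Finite ∧ ∀ (W0 u : Set G) (g : G) (H : Set G) (q : G) (H' : Set G) (q' : G),
    GN D W0 y u g H q → GN D W0 y u (g * σ) H' q' → q⁻¹ * q' ∈ P := by
  set R : Set G := {y, σ * y} ∪ ({x : G | 1 ∈ x • D ∧ σ ∉ x • D} ∪ {x : G | σ ∈ x • D ∧ 1 ∉ x • D}) with hR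
  have hRf : R.Finite := (toFinite _).union ((h.t1 1 σ).union (h.t1 σ 1))
  set E : Set G := {z : G | z • D = D} ∪ {z : G | z • D = Dᶜ} with hE
  have hEf : E.Finite := (h.stabH HHD1).union (h.stabH HHD1)
  refine ⟨E ∪ R⁻¹ * R, hEf.union (hRf.inv.mul hRf), ?_⟩
  have inR : ∀ (g : G) (H : Set G) (q : G), Rep D H q → (g ∈ H ∧ g * σ ∉ H ∨ g * σ ∈ H ∧ g ∉ H) → g⁻¹ * q ∈ R := by
    intro g H q hq hh
    right
    rcases hq with rfl | rfl
    · simp only [mem_sm, mem_union, mem_setOf_eq, mul_inv_rev, inv_inv, mul_one, mul_assoc] at hh ⊢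
      tauto
    · simp only [mem_sm, mem_union, mem_setOf_eq, mul_inv_rev, inv_inv, mul_one, mul_assoc, mem_compl_iff, not_not] at hh ⊢
      tauto
  have fin : ∀ g q q' : G, g⁻¹ * q ∈ R → g⁻¹ * q' ∈ R → q⁻¹ * q' ∈ E ∪ R⁻¹ * R := by
    intro g q q' h1 h2
    right
    exact ⟨(g⁻¹ * q)⁻¹, by simpa using h1, _, h2, by simp⟩
  rintro W0 u g H q H' q' ⟨a1, a2, a3⟩ ⟨b1, b2, b3⟩
  have uH : mm u H := (a2 H a1.HH).2 (Or.inl subset_rfl)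
  have uH' : mm u H' := (b2 H' b1.HH).2 (Or.inl subset_rfl)
  rcases a3 with ⟨a3, rfl⟩ | ⟨a3, a4⟩ <;> rcases b3 with ⟨b3, rfl⟩ | ⟨b3, b4⟩
  · exact fin g _ _ (by simp [hR]) (by simp [hR, mul_assoc])
  · exact fin g _ _ (by simp [hR]) (inR g _ _ b1 (Or.inl ⟨a3 _ b1.HH uH', b3⟩))
  · exact fin g _ _ (inR g _ _ a1 (Or.inr ⟨b3 _ a1.HH uH, a3⟩)) (by simp [hR, mul_assoc])
  · by_cases c1 : g * σ ∈ H
    · have c2 : g ∈ H' := by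
        by_contra c2
        exact b3 (a4 _ b1.HH uH' c2 c1)
      exact fin g _ _ (inR g _ _ a1 (Or.inr ⟨c1, a3⟩)) (inR g _ _ b1 (Or.inl ⟨c2, b3⟩))
    · have c3 := b4 _ a1.HH uH c1
      have c2 := a4 _ b1.HH uH' (fun hh => a3 (c3 hh))
      have e := c2.antisymm c3
      left
      rcases a1 with a1 | a1 <;> rcases b1 with b1 | b1 <;> rw [a1, b1] at e
      · left; show _ • D = D; rw [mul_smul, ← e]; simp
      · right; show _ • D = Dᶜ; rw [mul_smul, ← compl_compl (q' • D), ← smul_set_compl, ← e, ← smul_set_compl]; simp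
      · right; show _ • D = Dᶜ; rw [mul_smul, ← e]; simp
      · left; show _ • D = D; rw [mul_smul, ← compl_compl (q' • D), ← smul_set_compl, ← e, ← smul_set_compl]; simp
lemma class_cross (h : Cut D) {S : Finset G} (hS : Gen S) : ∃ P : Set G, P.Finite ∧
    ∀ H q H' q', Rep D H q → Rep D H' q' → SameV D H H' → ∀ A : Set G, q ∈ A → q' ∉ A →
    ∃ H1 q1, Rep D H1 q1 ∧ SameV D H H1 ∧ ∃ π ∈ P, q1 ∈ A ∧ q1 * π ∉ A := by
  obtain ⟨W0, y, hy, hW⟩ := h.exists_W0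
  choose P hP hPP using h.GN_close y
  refine ⟨P 1 ∪ ⋃ σ ∈ (S : Set G), P σ, (hP 1).union (S.finite_toSet.biUnion fun σ _ => hP σ), ?_⟩
  intro H q H' q' h1 h2 h3 A hq hq'
  by_contra! hno
  obtain ⟨g, hg⟩ := h.GN_of_node (W0 := W0) (y := y) h1 (fun Y _ => Iff.rfl)
  obtain ⟨g', hg'⟩ := h.GN_of_node (W0 := W0) (y := y) h2 h3
  have all : ∀ x, ∀ H1 q1, GN D W0 y H x H1 q1 → q1 ∈ A := by
    refine hS.ind _ g ?_ ?_
    · intro H1 q1 hn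
      have := hno H q h1 (fun Y _ => Iff.rfl) (q⁻¹ * q1) (Or.inl (hPP 1 W0 H g _ _ _ _ hg (by simpa using hn))) hq
      simpa using this
    · intro x hx σ hσ H1 q1 hn
      obtain ⟨H2, q2, hn2⟩ := h.GN_exists hy hW h1.HH x
      have := hno H2 q2 hn2.1 hn2.2.1 (q2⁻¹ * q1) (Or.inr (mem_biUnion hσ (hPP σ W0 H x _ _ _ _ hn2 hn))) (hx _ _ hn2)
      simpa using this
  exact hq' (all g' _ _ hg')
end Cut
end bbt
section bbt2
lemma tri_comb {ι μ : Type*} (F : Finset ι) (M : Finset μ) (r : ι → ℕ) (hr : Set.InjOn r F)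
    (c : ι → μ → Prop) (α β : ι → μ) (hα : ∀ i ∈ F, α i ∈ M) (hβ : ∀ i ∈ F, β i ∈ M)
    (h1 : ∀ i ∈ F, c i (α i) ∧ ¬ c i (β i))
    (h2 : ∀ i ∈ F, ∀ k ∈ F, r i < r k → (c i (α k) ↔ c i (β k))) : F.card ≤ M.card := by
  classical
  let v : F → (M → ℚ) := fun i m => (if m.1 = α i then 1 else 0) - (if m.1 = β i then 1 else 0)
  have ev : ∀ (i k : F), ∑ m : M, v k m * (if c i.1 m.1 then 1 else 0) =
      (if c i.1 (α k) then 1 else 0) - (if c i.1 (β k) then 1 else 0) := by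
    intro i k
    have e1 : ∀ (a : μ) (ha : a ∈ M), ∑ m : M, (if m.1 = a then (1:ℚ) else 0) * (if c i.1 m.1 then 1 else 0) = if c i.1 a then 1 else 0 := by
      intro a ha
      rw [Finset.sum_eq_single ⟨a, ha⟩]
      · simp
      · intro b _ hb
        rw [if_neg, zero_mul]
        intro hh; exact hb (Subtype.ext hh)
      · intro hh; exact absurd (Finset.mem_univ _) hh
    simp only [v, sub_mul, Finset.sum_sub_distrib]
    rw [e1 _ (hα _ k.2), e1 _ (hβ _ k.2)]
  have li : LinearIndependent ℚ v := by
    rw [Fintype.linearIndependent_iff]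
    intro a ha
    by_contra! hne
    obtain ⟨i0, hi0⟩ := hne
    obtain ⟨i, hi, hmin⟩ := Finset.exists_min_image (Finset.univ.filter fun i => a i ≠ 0) (fun i : F => r i) ⟨i0, by simpa using hi0⟩
    have e : ∑ m : M, (∑ k : F, a k • v k) m * (if c i.1 m.1 then 1 else 0) = 0 := by rw [ha]; simp
    have e2 : ∑ m : M, (∑ k : F, a k • v k) m * (if c i.1 m.1 then (1:ℚ) else 0) = ∑ k : F, a k * ∑ m : M, v k m * (if c i.1 m.1 then 1 else 0) := by
      simp only [Finset.sum_apply, Pi.smul_apply, smul_eq_mul, Finset.sum_mul, Finset.mul_sum, mul_assoc]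
      exact Finset.sum_comm
    rw [e2, Finset.sum_eq_single i] at e
    · rw [ev, if_pos (h1 _ i.2).1, if_neg (h1 _ i.2).2] at e
      simp at hi; apply hi; simpa using e
    · intro k _ hk
      by_cases hak : a k = 0
      · rw [hak, zero_mul]
      · have := hmin k (by simpa using hak)
        have lt : r i < r k := lt_of_le_of_ne this fun hh => hk (Subtype.ext (hr k.2 i.2 hh.symm))
        rw [ev]
        have := h2 _ i.2 _ k.2 lt
        simp [this]
    · intro hh; exact absurd (Finset.mem_univ _) hh
  have := li.fintype_card_le_finrank
  simpa using this
variable {G : Type u} [Group G]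
namespace Cut
variable {D : Set G}
lemma left_cross (h : Cut D) {P : Set G} (hP : ∀ H q H' q', Rep D H q → Rep D H' q' → SameV D H H' → ∀ A : Set G, q ∈ A → q' ∉ A →
    ∃ H1 q1, Rep D H1 q1 ∧ SameV D H H1 ∧ ∃ π ∈ P, q1 ∈ A ∧ q1 * π ∉ A)
    {H0 H1 Wp : Set G} {q0 xp : G} (hq0 : Rep D H0 q0) (hH1 : H1 ∈ HH D) (hp : Rep D Wp xp)
    (m0 : mm H0 Wp) (m1 : ¬ mm H1 Wp) {A : Set G} (hA : q0 ∈ A) (hA' : xp ∉ A) :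
    ∃ W ∈ HH D, mm H0 W ∧ W ⊆ Wp ∧ ∃ H q, Rep D H q ∧ SameV D W H ∧ ∃ π ∈ P, q ∈ A ∧ q * π ∉ A := by
  have fin := h.mm_fin2 hq0.HH hH1
  obtain ⟨W, ⟨⟨hW, k0, k1⟩, kp, x, hx, hxA⟩, hmin⟩ := (fin.subset (t := {W | (W ∈ HH D ∧ mm H0 W ∧ ¬ mm H1 W) ∧ W ⊆ Wp ∧ ∃ x, Rep D W x ∧ x ∉ A})
    (fun W hW => hW.1)).exists_minimal ⟨Wp, ⟨hp.HH, m0, m1⟩, subset_rfl, xp, hp, hA'⟩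
  refine ⟨W, hW, k0, kp, ?_⟩
  have fin2 : ∀ {K q}, Rep D K q → SameV D W K → q ∈ A → ∃ H q, Rep D H q ∧ SameV D W H ∧ ∃ π ∈ P, q ∈ A ∧ q * π ∉ A := by
    intro K q hK hs hq
    obtain ⟨H, q1, a, b, c⟩ := hP K q W x hK hx (fun Y hY => (hs Y hY).symm) A hq hxA
    exact ⟨H, q1, a, fun Y hY => (hs Y hY).trans (b Y hY), c⟩
  by_cases hex : ∃ V, (V ∈ HH D ∧ mm H0 V ∧ ¬ mm H1 V) ∧ V ⊂ W
  · obtain ⟨V0, hV0⟩ := hex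
    obtain ⟨V, ⟨⟨hV, l0, l1⟩, hVW⟩, hmax⟩ := (fin.subset (t := {V | (V ∈ HH D ∧ mm H0 V ∧ ¬ mm H1 V) ∧ V ⊂ W})
      (fun W hW => hW.1)).exists_maximal ⟨V0, hV0⟩
    obtain ⟨z, hz⟩ := hV
    have hzA : z ∈ A := by
      by_contra hn
      exact hVW.2 (hmin ⟨⟨⟨z, hz⟩, l0, l1⟩, hVW.1.trans kp, z, hz, hn⟩ hVW.1)
    refine fin2 (Rep.compl hz) ?_ hzA
    refine h.sameV_of hW (HHc ⟨z, hz⟩) fun Y hY mY => ?_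
    unfold mm; rw [compl_compl]
    rcases mY with mY | mY
    · exact Or.inr (hVW.trans_subset mY)
    · rcases h.nestH ⟨z, hz⟩ hY with n | n | n | n
      · by_cases e : Y ⊆ V
        · exfalso
          obtain ⟨b, hb⟩ := (h.infH (HHc hW)).nonempty
          exact hb (hVW.1 (e (mY.1 hb)))
        · exact Or.inr ⟨n, e⟩
      · exfalso
        obtain ⟨b, hb⟩ := (h.infH (HHc hW)).nonempty
        exact hb (hVW.1 (n (mY.1 hb)))
      · have hYW : Yᶜ ⊂ W := ⟨compl_subset_comm.1 mY.1, fun hh => mY.2 fun y hy hw => hh hw hy⟩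
        have := hmax (y := Yᶜ) ⟨⟨HHc hY, mm_mono l0 n.subset_compl_right, fun hh => k1 (mm_mono hh hYW.1)⟩, hYW⟩ n.subset_compl_right
        exact Or.inl (compl_subset_comm.1 this)
      · exact Or.inl n
  · refine fin2 hq0 ?_ hA
    refine h.sameV_of hW hq0.HH fun Y hY mY => ?_
    rcases mY with mY | mY
    · exact mm_mono k0 mY
    · by_contra hn
      rw [← h.mm_compl hq0.HH hY] at hn
      have hYW : Yᶜ ⊂ W := ⟨compl_subset_comm.1 mY.1, fun hh => mY.2 fun y hy hw => hh hw hy⟩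
      exact hex ⟨Yᶜ, ⟨HHc hY, hn, fun hh => k1 (mm_mono hh hYW.1)⟩, hYW⟩
lemma sandwich (h : Cut D) {W V C : Set G} (hW : W ∈ HH D) (hV : V ∈ HH D) (hWV : W ⊆ V)
    (h1 : mm W C) (h2 : mm Vᶜ Cᶜ) : W ⊆ C ∧ C ⊆ V := by
  obtain ⟨a, ha⟩ := (h.infH hW).nonempty
  obtain ⟨b, hb⟩ := (h.infH (HHc hV)).nonempty
  have hbW : b ∉ W := fun hh => hb (hWV hh)
  rcases h1 with h1 | h1 <;> rcases h2 with h2 | h2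
  · exact ⟨h1, compl_subset_compl.1 h2⟩
  · rw [compl_compl] at h2; exact absurd (h1 ha) (h2.1 (hWV ha))
  · exact absurd (h1.1 hbW) (h2 hb)
  · rw [compl_compl] at h2
    exact absurd (fun x hx hxW => h2.1 (hWV hxW) hx) h1.2
lemma word_bound (h : Cut D) {S : Finset G} (hS : Gen S) : ∀ x : G, ∃ L : ℕ, ∀ (ω : G ≃* G) (t : G) (l : ℕ),
    (∀ σ ∈ S, dd D t (ω σ * t) ≤ l) → dd D t (ω x * t) ≤ L * l := by
  refine hS.ind _ 1 ⟨0, fun ω t l _ => by simp [dd_self]⟩ ?_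
  rintro x ⟨L, hL⟩ s hs
  refine ⟨L + 1, fun ω t l hl => ?_⟩
  have := h.dd_tri t (ω x * t) (ω (x * s) * t)
  rw [map_mul, mul_assoc (ω x), dd_smul] at this
  rw [map_mul, mul_assoc (ω x)]
  have := hL ω t l hl
  have := hl s hs
  rw [add_mul, one_mul]; omega
lemma fiber_bound (h : Cut D) {Z : Set G} (hZ : Z ∈ HH D) : ∃ c : ℕ, ∀ (ω : G ≃* G) (t π : G),
    {q | ω q * t ∈ Z ∧ ω (q * π) * t ∉ Z}.Finite ∧ {q | ω q * t ∈ Z ∧ ω (q * π) * t ∉ Z}.ncard ≤ c * dd D t (ω π * t) := by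
  classical
  refine ⟨{z : G | z • Z = Z}.ncard, fun ω t π => ?_⟩
  set A := {q | ω q * t ∈ Z ∧ ω (q * π) * t ∉ Z} with hA
  let f : G → Set G := fun q => (ω q)⁻¹ • Z
  have mt : ∀ q ∈ A, f q ∈ sep D t (ω π * t) := by
    rintro q ⟨h1, h2⟩
    refine ⟨HHs _ hZ, ?_, ?_⟩
    · rw [mem_sm]; simpa using h1
    · rw [mem_sm]; simpa [mul_assoc] using h2
  have inj : ∀ q0, {q | f q = f q0}.Finite ∧ {q | f q = f q0}.ncard ≤ {z : G | z • Z = Z}.ncard := by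
    intro q0
    have hs : (fun q => ω q0 * (ω q)⁻¹) '' {q | f q = f q0} ⊆ {z : G | z • Z = Z} := by
      rintro _ ⟨q, hq, rfl⟩
      simp only [f, mem_setOf_eq] at hq ⊢
      rw [mul_smul, hq]; simp
    have hi : Function.Injective (fun q => ω q0 * (ω q)⁻¹) := by
      intro a b hab; simpa using hab
    have fz : {z : G | z • Z = Z}.Finite := h.stabH hZ
    refine ⟨(fz.subset hs).of_finite_image hi.injOn, ?_⟩
    rw [← ncard_image_of_injective _ hi]
    exact ncard_le_ncard hs fz
  have hAf : A.Finite := by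
    refine ((h.sep_fin t (ω π * t)).preimage' (f := f) ?_).subset mt
    intro b hb
    by_cases hne : (f ⁻¹' {b}).Nonempty
    · obtain ⟨q0, rfl⟩ := hne
      exact (inj q0).1
    · rw [not_nonempty_iff_eq_empty.1 hne]; exact finite_empty
  refine ⟨hAf, ?_⟩
  rw [ncard_eq_toFinset_card _ hAf, dd, ncard_eq_toFinset_card _ (h.sep_fin t (ω π * t))]
  refine Finset.card_le_mul_card_image_of_maps_to (f := f) (fun q hq => by simpa using mt q (by simpa using hq)) _ ?_
  intro b hb
  by_cases hne : ∃ q0, f q0 = b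
  · obtain ⟨q0, rfl⟩ := hne
    refine le_trans ?_ (inj q0).2
    rw [ncard_eq_toFinset_card _ (inj q0).1]
    refine Finset.card_le_card ?_
    intro q hq; simp at hq ⊢; exact hq.2
  · rw [Finset.filter_false_of_mem]
    · simp
    · intro q hq hh; exact hne ⟨q, hh⟩
end Cut
end bbt2
section bbt3
variable {G : Type u} [Group G]
def ZZ (D : Set G) (b : Bool) : Set G := if b then D else Dᶜ
lemma rep_iff {D H : Set G} {q : G} : Rep D H q ↔ ∃ b, H = q • ZZ D b := by
  constructor
  · rintro (h | h)
    · exact ⟨true, h⟩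
    · exact ⟨false, h⟩
  · rintro ⟨_ | _, h⟩
    · exact Or.inr h
    · exact Or.inl h
lemma mem_of_eq_sm {F Z : Set G} {k a : G} (e : F = k • Z) : a ∈ F ↔ k⁻¹ * a ∈ Z := by rw [e, mem_sm]
def hts (D Z : Set G) (y : G) : Set (Set G) := {Z' | Z' ∈ HH D ∧ Z ⊆ Z' ∧ y ∉ Z'}
namespace Cut
variable {D : Set G}
lemma ZZH (b : Bool) : ZZ D b ∈ HH D := by
  cases b
  · exact HHc HHD1
  · exact HHD1
lemma hts_fin (h : Cut D) {Z : Set G} (hZ : Z ∈ HH D) (y : G) : (hts D Z y).Finite := by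
  obtain ⟨a, ha⟩ := (h.infH hZ).nonempty
  exact (h.t1H a y).subset fun W hW => ⟨hW.1, hW.2.1 ha, hW.2.2⟩
lemma hts_chain (h : Cut D) {Z : Set G} (hZ : Z ∈ HH D) {y : G} {A B : Set G} (hA : A ∈ hts D Z y)
    (hB : B ∈ hts D Z y) : A ⊆ B ∨ B ⊆ A := by
  obtain ⟨a, ha⟩ := (h.infH hZ).nonempty
  exact h.gps_chain hA.1 hB.1 (hA.2.1 ha) (hB.2.1 ha) hA.2.2 hB.2.2
lemma rep_fin (h : Cut D) {W : Set G} : {z : G | Rep D W z}.Finite := by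
  refine ((h.stabH (Y := W) HHD1).union (h.stabH (Y := W) (HHc HHD1))).subset ?_
  rintro z (hz | hz)
  · exact Or.inl hz.symm
  · exact Or.inr hz.symm
lemma label_bound (h : Cut D) {S : Finset G} (hS : Gen S) {P : Set G} (hP : P.Finite) : ∃ K : ℕ,
    ∀ (ω : G ≃* G) (t : G) (l : ℕ), (∀ σ ∈ S, dd D t (ω σ * t) ≤ l) → ∃ M : Finset (Bool × Set G × G), M.card ≤ K * l ∧
      ∀ δ H q, Rep D H q → (∃ π ∈ P, ω q * t ∈ ZZ D δ ∧ ω (q * π) * t ∉ ZZ D δ) → (δ, H, q) ∈ M := by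
  classical
  choose c hc using fun δ => h.fiber_bound (ZZH (D := D) δ)
  choose L hL using h.word_bound hS
  refine ⟨∑ δ : Bool, ∑ π ∈ hP.toFinset, 2 * (c δ * L π), fun ω t l hl => ?_⟩
  refine ⟨Finset.univ.biUnion fun δ : Bool => hP.toFinset.biUnion fun π =>
    ((Finset.univ : Finset Bool) ×ˢ (hc δ ω t π).1.toFinset).image fun p => (δ, p.2 • ZZ D p.1, p.2), ?_, ?_⟩
  · refine Finset.card_biUnion_le.trans ?_
    rw [Finset.sum_mul]
    refine Finset.sum_le_sum fun δ _ => ?_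
    refine Finset.card_biUnion_le.trans ?_
    rw [Finset.sum_mul]
    refine Finset.sum_le_sum fun π _ => ?_
    refine Finset.card_image_le.trans ?_
    rw [Finset.card_product, ← ncard_eq_toFinset_card _ (hc δ ω t π).1]
    have := (hc δ ω t π).2
    have h2 := hL π ω t l hl
    calc _ ≤ 2 * (c δ * (L π * l)) := by
          simp only [Finset.card_univ, Fintype.card_bool]
          gcongr
          exact this.trans (by gcongr)
      _ = _ := by ring
  · rintro δ H q hq ⟨π, hπ, h1, h2⟩
    obtain ⟨b, rfl⟩ := rep_iff.1 hq
    simp only [Finset.mem_biUnion, Finset.mem_univ, true_and, Finset.mem_image, Finset.mem_product, Finite.mem_toFinset, mem_setOf_eq]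
    exact ⟨δ, π, hπ, (b, q), ⟨h1, h2⟩, rfl⟩
theorem bbt (h : Cut D) {S : Finset G} (hS : Gen S) : ∃ K : ℕ,
    ∀ (ω : G ≃* G) (t : G) (l : ℕ), (∀ σ ∈ S, dd D t (ω σ * t) ≤ l) → ∀ Z ∈ HH D, ∀ x : G,
      {g | g ∈ x • D ∧ ω g * t ∈ Z}.Infinite → {g | g ∉ x • D ∧ ω g * t ∈ Z}.Infinite →
      (hts D Z (ω x * t)).ncard ≤ K * l := by
  classical
  obtain ⟨P, hPf, hP⟩ := h.class_cross hS
  obtain ⟨K, hK⟩ := h.label_bound hS hPf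
  refine ⟨K, fun ω t l hl Z hZ x i1 i2 => ?_⟩
  obtain ⟨M, hM, hMm⟩ := hK ω t l hl
  have node : ∀ X ∈ HH D, {g | g ∈ X ∧ ω g * t ∈ Z}.Infinite → ∃ H q, Rep D H q ∧ H ⊆ X ∧ ω q * t ∈ Z := by
    intro X hX hi
    obtain ⟨a, ha⟩ := h.inf.nonempty
    obtain ⟨b, hb⟩ := h.cinf.nonempty
    obtain ⟨g, ⟨hg, hgZ⟩, hn⟩ := (hi.diff ((h.aiH hX a).union (h.aiH hX b))).nonempty
    simp only [mem_union, mem_setOf_eq, not_or, not_and, not_not] at hn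
    have ga := hn.1 hg
    have gb := hn.2 hg
    rcases h.nestH (HHD g) hX with n | n | n | n
    · exact ⟨_, g, Or.inl rfl, n, hgZ⟩
    · exact absurd (mul_mem_sm.1 (n gb)) hb
    · exact absurd ga (Set.disjoint_left.1 n (mul_mem_sm.2 ha))
    · exact ⟨_, g, Or.inr rfl, by rw [smul_set_compl]; exact n, hgZ⟩
  obtain ⟨H0, q0, r0, s0, z0⟩ := node _ (HHD x) i1
  obtain ⟨H1, q1, r1, s1, z1⟩ := node _ (HHc (HHD x)) i2
  have Xf : {z : G | ∃ W, (W ∈ HH D ∧ mm H0 W ∧ ¬ mm H1 W) ∧ Rep D W z}.Finite := by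
    refine ((h.mm_fin2 r0.HH r1.HH).biUnion (t := fun W => {z : G | Rep D W z}) fun W _ => h.rep_fin).subset ?_
    rintro z ⟨W, hW, hz⟩
    exact mem_biUnion hW hz
  obtain ⟨xp, ⟨Wp, ⟨hWp, mp0, mp1⟩, hrp⟩, hmax⟩ := exists_max_image _ (fun z => (hts D Z (ω z * t)).ncard) Xf
    ⟨x, x • D, ⟨HHD x, Or.inl s0, fun hh => h.mm_not r1.HH hh (Or.inl s1)⟩, Or.inl rfl⟩
  have hx := hmax x ⟨x • D, ⟨HHD x, Or.inl s0, fun hh => h.mm_not r1.HH hh (Or.inl s1)⟩, Or.inl rfl⟩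
  refine (hx.trans ?_).trans hM
  set T := hts D Z (ω xp * t) with hT
  have Tf : T.Finite := h.hts_fin hZ _
  have data : ∀ F, ∃ (δ : Bool) (k : G) (W Hα : Set G) (qα : G) (V Hβ : Set G) (qβ : G), F ∈ T → (F = k • ZZ D δ ∧
      (W ∈ HH D ∧ mm H0 W ∧ W ⊆ Wp ∧ Rep D Hα qα ∧ SameV D W Hα ∧ ∃ π ∈ P, ω qα * t ∈ F ∧ ω (qα * π) * t ∉ F) ∧
      (V ∈ HH D ∧ mm H1 V ∧ V ⊆ Wpᶜ ∧ Rep D Hβ qβ ∧ SameV D V Hβ ∧ ∃ π ∈ P, ω qβ * t ∈ F ∧ ω (qβ * π) * t ∉ F)) := by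
    intro F
    by_cases hF : F ∈ T
    · obtain ⟨k, hk⟩ := hF.1
      obtain ⟨δ, hδ⟩ := rep_iff.1 hk
      obtain ⟨W, a1, a2, a3, Hα, qα, a4, a5, a6⟩ := h.left_cross hP r0 r1.HH hrp mp0 mp1 (A := {q | ω q * t ∈ F}) (hF.2.1 z0) hF.2.2
      obtain ⟨V, b1, b2, b3, Hβ, qβ, b4, b5, b6⟩ := h.left_cross hP r1 r0.HH hrp.compl ((h.mm_compl r1.HH hWp).2 mp1)
        (fun hh => h.mm_not r0.HH mp0 hh) (A := {q | ω q * t ∈ F}) (hF.2.1 z1) hF.2.2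
      exact ⟨δ, k, W, Hα, qα, V, Hβ, qβ, fun _ => ⟨hδ, ⟨a1, a2, a3, a4, a5, a6⟩, b1, b2, b3, b4, b5, b6⟩⟩
    · exact ⟨true, 1, ∅, ∅, 1, ∅, ∅, 1, fun hh => absurd hh hF⟩
  choose δ k W Hα qα V Hβ qβ hd using data
  let gg : Set G → G := fun F => ω.symm (k F)⁻¹
  have ogg : ∀ F, ω (gg F) = (k F)⁻¹ := fun F => by simp [gg]
  let r : Set G → ℕ := fun F => {Z' | Z' ∈ T ∧ Z' ⊂ F}.ncard
  have rb : ∀ F ∈ T, r F + {Z' | Z' ∈ T ∧ F ⊆ Z'}.ncard = T.ncard := by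
    intro F hF
    have hdis : Disjoint {Z' | Z' ∈ T ∧ Z' ⊂ F} {Z' | Z' ∈ T ∧ F ⊆ Z'} := by
      rw [Set.disjoint_left]; rintro Y ⟨_, h1⟩ ⟨_, h2⟩; exact h1.2 h2
    rw [← ncard_union_eq hdis (Tf.subset fun Y hY => hY.1) (Tf.subset fun Y hY => hY.1)]
    congr 1; ext Y
    constructor
    · rintro (hY | hY) <;> exact hY.1
    · intro hY
      by_cases hs : F ⊆ Y
      · exact Or.inr ⟨hY, hs⟩
      · exact Or.inl ⟨hY, (h.hts_chain hZ hF hY).resolve_left hs, hs⟩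
  have rlt : ∀ F ∈ T, ∀ F' ∈ T, F ⊂ F' → r F < r F' := by
    intro F hF F' hF' hlt
    refine ncard_lt_ncard ⟨fun Y hY => ⟨hY.1, hY.2.trans hlt⟩, fun hh => ?_⟩ (Tf.subset fun Y hY => hY.1)
    exact (hh ⟨hF, hlt⟩).2.2 subset_rfl
  rw [ncard_eq_toFinset_card _ Tf]
  refine tri_comb Tf.toFinset M r ?_ (fun F p => p.1 = δ F ∧ mm p.2.1 (gg F • Wp))
    (fun F => (δ F, gg F • Hα F, gg F * qα F)) (fun F => (δ F, gg F • Hβ F, gg F * qβ F)) ?_ ?_ ?_ ?_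
  · intro F hF F' hF' he
    simp only [Finite.coe_toFinset] at hF hF'
    rcases h.hts_chain hZ hF hF' with hc | hc
    · by_contra hne
      exact (rlt F hF F' hF' (hc.ssubset_of_ne hne)).ne he
    · by_contra hne
      exact (rlt F' hF' F hF (hc.ssubset_of_ne (Ne.symm hne))).ne he.symm
  · intro F hF
    obtain ⟨e, ⟨a1, a2, a3, a4, a5, π, hπ, a6, a7⟩, -⟩ := hd F (by simpa using hF)
    refine hMm _ _ _ (a4.smul _) ⟨π, hπ, ?_, ?_⟩
    · rw [mem_of_eq_sm e] at a6; rw [map_mul, ogg, mul_assoc]; exact a6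
    · rw [mem_of_eq_sm e] at a7; rw [mul_assoc, map_mul, ogg, mul_assoc]; exact a7
  · intro F hF
    obtain ⟨e, -, ⟨a1, a2, a3, a4, a5, π, hπ, a6, a7⟩⟩ := hd F (by simpa using hF)
    refine hMm _ _ _ (a4.smul _) ⟨π, hπ, ?_, ?_⟩
    · rw [mem_of_eq_sm e] at a6; rw [map_mul, ogg, mul_assoc]; exact a6
    · rw [mem_of_eq_sm e] at a7; rw [mul_assoc, map_mul, ogg, mul_assoc]; exact a7
  · intro F hF
    obtain ⟨e, ⟨a1, a2, a3, a4, a5, -⟩, ⟨b1, b2, b3, b4, b5, -⟩⟩ := hd F (by simpa using hF)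
    refine ⟨⟨rfl, (mm_smul _).2 ((a5 _ hWp).1 (Or.inl a3))⟩, fun hh => ?_⟩
    exact h.mm_not b4.HH ((mm_smul _).1 hh.2) ((b5 _ (HHc hWp)).1 (Or.inl b3))
  · intro I hI J hJ hlt
    rw [Finite.mem_toFinset] at hI hJ
    obtain ⟨eI, -, -⟩ := hd I hI
    obtain ⟨eJ, ⟨a1, a2, a3, a4, a5, -⟩, ⟨b1, b2, b3, b4, b5, -⟩⟩ := hd J hJ
    by_cases hδ : δ J = δ I
    swap
    · constructor <;> exact fun hh => absurd hh.1 hδ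
    set z := (gg J)⁻¹ * (gg I * xp) with hz
    obtain ⟨s, sI, pz⟩ : ∃ s : G, s • I = J ∧ ω z * t = s * (ω xp * t) := by
      refine ⟨k J * (k I)⁻¹, ?_, by simp [hz, ogg, mul_assoc]⟩
      have e1 : (k I)⁻¹ • I = ZZ D (δ I) := by
        conv_lhs => arg 2; rw [eI]
        simp
      rw [mul_smul, e1, ← hδ, ← eJ]
    have bad : ∀ C, Rep D C z → mm (Hα J) C → ¬ mm (Hβ J) C → False := by
      intro C hC m1 m2
      rw [← h.mm_compl b4.HH hC.HH] at m2
      have m1' := (a5 _ hC.HH).2 m1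
      have m2' := (b5 _ (HHc hC.HH)).2 m2
      have sw := h.sandwich (V := (V J)ᶜ) a1 (HHc b1) (a3.trans (subset_compl_comm.1 b3)) m1' (by simpa using m2')
      have := hmax z ⟨C, ⟨hC.HH, mm_mono a2 sw.1, fun hh => h.mm_not r1.HH hh (mm_mono b2 (subset_compl_comm.1 sw.2))⟩, hC⟩
      have i1 := rb I hI
      have zJ : ω z * t ∉ J := by rw [pz, ← sI, mul_mem_sm]; exact hI.2.2
      have e3 : ((fun Y => s • Y) '' {Z' | Z' ∈ T ∧ I ⊆ Z'}).ncard = {Z' | Z' ∈ T ∧ I ⊆ Z'}.ncard :=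
        ncard_image_of_injective _ (MulAction.injective _)
      have le : r J + {Z' | Z' ∈ T ∧ I ⊆ Z'}.ncard ≤ (hts D Z (ω z * t)).ncard := by
        rw [← e3]
        have f1 : {Z' | Z' ∈ T ∧ Z' ⊂ J}.Finite := Tf.subset fun Y hY => hY.1
        have f2 : {Z' | Z' ∈ T ∧ I ⊆ Z'}.Finite := Tf.subset fun Y hY => hY.1
        have hdis : Disjoint {Z' | Z' ∈ T ∧ Z' ⊂ J} ((fun Y => s • Y) '' {Z' | Z' ∈ T ∧ I ⊆ Z'}) := by
          rw [Set.disjoint_left]; rintro _ ⟨_, h1⟩ ⟨Y, ⟨_, h2⟩, rfl⟩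
          apply h1.2; rw [← sI]; exact smul_set_mono h2
        show {Z' | Z' ∈ T ∧ Z' ⊂ J}.ncard + _ ≤ _
        rw [← ncard_union_eq hdis f1 (f2.image _)]
        refine ncard_le_ncard ?_ (h.hts_fin hZ _)
        rintro Y (⟨h1, h2⟩ | ⟨Y, ⟨h1, h2⟩, rfl⟩)
        · exact ⟨h1.1, h1.2.1, fun hh => zJ (h2.1 hh)⟩
        · refine ⟨HHs _ h1.1, hJ.2.1.trans ?_, ?_⟩
          · rw [← sI]; exact smul_set_mono h2
          · rw [pz, mul_mem_sm]; exact h1.2.2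
      omega
    have hC0 : Rep D ((gg J)⁻¹ • (gg I • Wp)) z := (hrp.smul _).smul _
    have tr : ∀ H : Set G, mm (gg J • H) (gg I • Wp) ↔ mm H ((gg J)⁻¹ • (gg I • Wp)) := by
      intro H; rw [← mm_smul (gg J)⁻¹]; simp
    simp only [hδ, true_and, tr]
    constructor
    · intro m; by_contra hn; exact bad _ hC0 m hn
    · intro m; by_contra hn
      rw [← h.mm_compl a4.HH hC0.HH] at hn
      exact bad _ hC0.compl hn fun hh => h.mm_not b4.HH m hh
end Cut
end bbt3
section serre
variable {G : Type u} [Group G]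
namespace Cut
variable {D : Set G}
lemma adj (h : Cut D) : ∃ K0 : ℕ, ∀ x0 : G, ∃ B : Set (Set G), B.Finite ∧ B.ncard ≤ K0 ∧
    ∀ Z ∈ HH D, x0 ∉ Z → Z ∈ B ∨ Z ⊂ x0 • D ∨ Z ⊂ (x0 • D)ᶜ := by
  obtain ⟨a, ha⟩ := h.inf.nonempty
  obtain ⟨b, hb⟩ := h.cinf.nonempty
  refine ⟨dd D a 1 + dd D b 1, fun x0 => ⟨sep D (x0 * a) x0 ∪ sep D (x0 * b) x0, (h.sep_fin _ _).union (h.sep_fin _ _), ?_, ?_⟩⟩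
  · refine (ncard_union_le _ _).trans ?_
    have e1 := dd_smul (D := D) x0 a 1
    have e2 := dd_smul (D := D) x0 b 1
    rw [mul_one] at e1 e2
    exact (add_le_add e1.le e2.le)
  · intro Z hZ hx
    by_cases c1 : x0 * a ∈ Z
    · exact Or.inl (Or.inl ⟨hZ, c1, hx⟩)
    by_cases c2 : x0 * b ∈ Z
    · exact Or.inl (Or.inr ⟨hZ, c2, hx⟩)
    right
    rcases h.nestH hZ (HHD x0) with n | n | n | n
    · exact Or.inl ⟨n, fun hh => c1 (hh (mul_mem_sm.2 ha))⟩
    · exact absurd (n (mul_mem_sm.2 ha)) c1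
    · exact Or.inr ⟨n.subset_compl_right, fun hh => c2 (hh (fun h3 => hb (mul_mem_sm.1 h3)))⟩
    · exact absurd (mul_mem_sm.1 (n c2)) hb
lemma exists_rank (h : Cut D) {x y : G} : ∀ n < dd D x y, ∃ Z ∈ sep D x y, {Y | Y ∈ sep D x y ∧ Y ⊂ Z}.ncard = n := by
  classical
  have key : ∀ (n : ℕ) (A : Set (Set G)), A ⊆ sep D x y → n < A.ncard → ∃ Z ∈ A, {Y | Y ∈ A ∧ Y ⊂ Z}.ncard = n := by
    intro n
    induction n with
    | zero =>
      intro A hA hn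
      have Af := (h.sep_fin x y).subset hA
      obtain ⟨Z, hZ, hm⟩ := Af.exists_minimal ((ncard_pos Af).1 hn)
      refine ⟨Z, hZ, ?_⟩
      rw [ncard_eq_zero (Af.subset fun Y hY => hY.1), eq_empty_iff_forall_notMem]
      rintro Y ⟨h1, h2⟩
      exact h2.2 (hm h1 h2.1)
    | succ n ih =>
      intro A hA hn
      have Af := (h.sep_fin x y).subset hA
      obtain ⟨Z0, hZ0, hm⟩ := Af.exists_minimal ((ncard_pos Af).1 (by omega))
      have hc := ncard_diff_singleton_add_one hZ0 Af
      obtain ⟨Z, hZ, hr⟩ := ih (A \ {Z0}) (diff_subset.trans hA) (by omega)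
      refine ⟨Z, hZ.1, ?_⟩
      have e : {Y | Y ∈ A ∧ Y ⊂ Z} = insert Z0 {Y | Y ∈ A \ {Z0} ∧ Y ⊂ Z} := by
        ext Y
        simp only [mem_setOf_eq, mem_insert_iff, mem_diff, mem_singleton_iff]
        constructor
        · intro hY; by_cases e : Y = Z0
          · exact Or.inl e
          · exact Or.inr ⟨⟨hY.1, e⟩, hY.2⟩
        · rintro (rfl | hY)
          · refine ⟨hZ0, ?_⟩
            have hne : Y ≠ Z := fun e => hZ.2 e.symm
            rcases h.gps_chain (hA hZ0).1 (hA hZ.1).1 (hA hZ0).2.1 (hA hZ.1).2.1 (hA hZ0).2.2 (hA hZ.1).2.2 with n | n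
            · exact n.ssubset_of_ne hne
            · exact absurd ((hm hZ.1 n).antisymm n) hne
          · exact ⟨hY.1.1, hY.2⟩
      rw [e, ncard_insert_of_notMem (by simp) (Af.subset fun Y hY => hY.1.1), hr]
  exact fun n hn => key n _ subset_rfl hn
lemma mid (h : Cut D) : ∃ K0 : ℕ, ∀ x y, ∃ x0, 2 * dd D x x0 ≤ dd D x y + 2 * K0 ∧ 2 * dd D y x0 ≤ dd D x y + 2 * K0 := by
  obtain ⟨K0, hK⟩ := h.adj
  refine ⟨K0, fun x y => ?_⟩
  by_cases hL : dd D x y = 0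
  · exact ⟨x, by simp [dd_self], by rw [dd_symm y x]; omega⟩
  obtain ⟨Z, hZ, hr⟩ := h.exists_rank ((dd D x y - 1) / 2) (show _ < dd D x y by omega)
  obtain ⟨x0, hx0⟩ := hZ.1
  obtain ⟨B, Bf, Bc, hB⟩ := hK x0
  have hB' : ∀ Y ∈ HH D, x0 ∉ Y → Y ∈ B ∨ Y ⊂ Z ∨ Y ⊂ Zᶜ := by
    intro Y hY hx
    have := hB Y hY hx
    rcases hx0 with rfl | rfl
    · exact this
    · rw [smul_set_compl, compl_compl]; tauto
  have f1 : {Y | Y ∈ sep D x y ∧ Y ⊂ Z}.Finite := (h.sep_fin x y).subset fun Y hY => hY.1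
  have f2 : {Y | Y ∈ sep D x y ∧ Z ⊂ Y}.Finite := (h.sep_fin x y).subset fun Y hY => hY.1
  have e : {Y | Y ∈ sep D x y ∧ Y ⊂ Z}.ncard + {Y | Y ∈ sep D x y ∧ Z ⊂ Y}.ncard + 1 ≤ dd D x y := by
    have hdis : Disjoint {Y | Y ∈ sep D x y ∧ Y ⊂ Z} {Y | Y ∈ sep D x y ∧ Z ⊂ Y} := by
      rw [Set.disjoint_left]; rintro Y ⟨_, h1⟩ ⟨_, h2⟩; exact h1.2 h2.1
    rw [← ncard_union_eq hdis f1 f2, ← ncard_insert_of_notMem (a := Z) (by simp) (f1.union f2)]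
    refine ncard_le_ncard ?_ (h.sep_fin x y)
    rintro Y (rfl | hY | hY)
    exacts [hZ, hY.1, hY.1]
  have b1 : dd D x x0 ≤ {Y | Y ∈ sep D x y ∧ Y ⊂ Z}.ncard + K0 := by
    refine (ncard_le_ncard (t := {Y | Y ∈ sep D x y ∧ Y ⊂ Z} ∪ B) ?_ (f1.union Bf)).trans ((ncard_union_le _ _).trans (by omega))
    rintro Y ⟨hY, h1, h2⟩
    rcases hB' Y hY h2 with k | k | k
    · exact Or.inr k
    · exact Or.inl ⟨⟨hY, h1, fun hh => hZ.2.2 (k.1 hh)⟩, k⟩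
    · exact absurd hZ.2.1 (k.1 h1)
  have b2 : dd D y x0 ≤ {Y | Y ∈ sep D x y ∧ Z ⊂ Y}.ncard + K0 := by
    rw [← compl_image_ncard {Y | Y ∈ sep D x y ∧ Z ⊂ Y} {Y | Yᶜ ∈ sep D x y ∧ Z ⊂ Yᶜ} (fun _ => Iff.rfl)]
    have f3 : {Y | Yᶜ ∈ sep D x y ∧ Z ⊂ Yᶜ}.Finite := by
      refine (f2.image (fun Y => Yᶜ)).subset ?_
      intro Y hY; exact ⟨Yᶜ, hY, compl_compl _⟩
    refine (ncard_le_ncard (t := {Y | Yᶜ ∈ sep D x y ∧ Z ⊂ Yᶜ} ∪ B) ?_ (f3.union Bf)).trans ((ncard_union_le _ _).trans (by omega))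
    rintro Y ⟨hY, h1, h2⟩
    rcases hB' Y hY h2 with k | k | k
    · exact Or.inr k
    · exact absurd (k.1 h1) hZ.2.2
    · have hs : Z ⊂ Yᶜ := ⟨subset_compl_comm.1 k.1, fun hh => k.2 (compl_subset_comm.1 hh)⟩
      exact Or.inl ⟨⟨HHc hY, hs.1 hZ.2.1, fun hh => hh h1⟩, hs⟩
  exact ⟨x0, by omega, by omega⟩
lemma serre_pair (h : Cut D) (H K o : G) (m : ℕ) (h1 : dd D o (H * H * o) ≤ dd D o (H * o) + m)
    (h2 : dd D o (K * K * o) ≤ dd D o (K * o) + m) (h3 : dd D o (H * K * (H * K) * o) ≤ dd D o (H * K * o) + m) :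
    dd D o (H * K * o) ≤ max (dd D o (H * o)) (dd D o (K * o)) + m := by
  have inv : ∀ a, dd D o (a⁻¹ * o) = dd D o (a * o) := by
    intro a; rw [← dd_smul a]; simp [dd_symm]
  have two : ∀ a b, dd D (a⁻¹ * o) (b * o) = dd D o (a * b * o) := by
    intro a b; rw [← dd_smul a]; simp [mul_assoc]
  have e1 := h.gp_formula o (H⁻¹ * o) (K * o)
  have e2 := h.gp_formula o (H⁻¹ * o) (H * o)
  have e3 := h.gp_formula o (K⁻¹ * o) (K * o)
  have e4 := h.gp_formula o ((H * K)⁻¹ * o) (H * K * o)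
  have e5 := h.gp_formula o (K⁻¹ * o) ((H * K)⁻¹ * o)
  have e6 := h.gp_formula o (H * o) (H * K * o)
  rw [inv, two] at e1 e2 e3 e4
  rw [inv, inv, two] at e5
  rw [show dd D (H * o) (H * K * o) = dd D o (K * o) by rw [mul_assoc, dd_smul]] at e6
  rw [show dd D o (K * (H * K)⁻¹ * o) = dd D o (H * o) by rw [← inv H]; simp] at e5
  have g1 := h.gp_min o (H⁻¹ * o) (H * o) (K * o)
  have g2 := h.gp_min o (H * o) (K⁻¹ * o) (K * o)
  have g3 := h.gp_min o (K⁻¹ * o) ((H * K)⁻¹ * o) (H * o)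
  have g4 := h.gp_min o (H * o) (H * K * o) ((H * K)⁻¹ * o)
  rw [gp_symm o (K⁻¹ * o) (H * o)] at g3
  rw [gp_symm o (H * o) ((H * K)⁻¹ * o), gp_symm o (H * K * o)] at g4
  by_contra hc
  have := le_max_left (dd D o (H * o)) (dd D o (K * o))
  have := le_max_right (dd D o (H * o)) (dd D o (K * o))
  omega
end Cut
lemma CutSys.unbdd {D : Set G} (h : CutSys D) (t : G) (L : ℕ) : ∃ g : G, L < dd D t (g * t) := by
  obtain ⟨y1, y2, s1, s2, dj⟩ := h.y
  obtain ⟨a, ha⟩ := h.cinf.nonempty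
  have lt : y1 • D ⊂ D := ⟨s1, fun hh => by
    obtain ⟨b, hb⟩ := (h.toCut.infH (Cut.HHD y2)).nonempty
    exact Set.disjoint_left.1 dj (hh (s2 hb)) hb⟩
  by_contra! hb
  have bd : ∀ x y : G, dd D x y ≤ 2 * L := by
    intro x y
    have e1 := hb (x * t⁻¹)
    have e2 := hb (y * t⁻¹)
    simp only [inv_mul_cancel_right] at e1 e2
    have := h.toCut.dd_tri x t y
    rw [Cut.dd_symm x t] at this
    omega
  have chain : ∀ n : ℕ, ∀ m, y1 ^ (n + m) • D ⊆ y1 ^ n • D := by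
    intro n m
    induction m with
    | zero => rfl
    | succ m ih => rw [← add_assoc, pow_succ, mul_smul]; exact (smul_set_mono s1).trans ih
  have chainlt : ∀ n m : ℕ, n < m → y1 ^ m • D ⊂ y1 ^ n • D := by
    intro n m hnm
    obtain ⟨k, rfl⟩ := Nat.exists_eq_add_of_lt hnm
    rw [show n + k + 1 = (n + 1) + k by ring]
    refine (chain (n+1) k).trans_ssubset ?_
    rw [pow_succ, mul_smul]; exact sm_ssub.2 lt
  obtain ⟨b, hb'⟩ := (h.toCut.infH (Cut.HHD (y1 ^ (2 * L + 1)))).nonempty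
  have sub : (fun n : ℕ => y1 ^ n • D) '' (Finset.range (2 * L + 1) : Set ℕ) ⊆ sep D b a := by
    rintro _ ⟨n, hn, rfl⟩
    simp at hn
    refine ⟨Cut.HHD _, (chainlt _ _ (Nat.lt_succ_of_le hn)).1 hb', fun hh => ha ?_⟩
    have := chain 0 n
    simp at this; exact this hh
  have inj : Function.Injective (fun n : ℕ => y1 ^ n • D) := by
    intro n m hnm
    simp only at hnm
    rcases lt_trichotomy n m with hl | hl | hl
    · exact absurd hnm (chainlt _ _ hl).ne'
    · exact hl
    · exact absurd hnm (chainlt _ _ hl).ne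
  have := ncard_le_ncard sub (h.toCut.sep_fin b a)
  rw [ncard_image_of_injective _ inj, ncard_coe_finset, Finset.card_range] at this
  have := bd b a
  unfold dd at this
  omega
open Classical in
lemma CutSys.serre {D : Set G} (h : CutSys D) {S : Finset G} (hS : Gen S) (h1S : 1 ∈ S) : ∃ C : ℕ, ∀ ω : G ≃* G,
    ∃ (t : G) (l : ℕ), (∀ σ ∈ S, dd D t (ω σ * t) ≤ l) ∧ 1 ≤ l ∧ ∃ u ∈ S * S * S, ∃ m, 1 ≤ m ∧ l ≤ C * m ∧
      dd D t (ω u * t) + m ≤ dd D t (ω u * ω u * t) := by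
  obtain ⟨K0, hmid⟩ := h.toCut.mid
  refine ⟨2 * K0 + 2, fun ω => ?_⟩
  let lam : G → ℕ := fun t => S.sup fun σ => dd D t (ω σ * t)
  obtain ⟨t, ht⟩ : ∃ t, ∀ t', lam t ≤ lam t' := by
    obtain ⟨t, ht⟩ := Function.argmin_le lam |> fun hh => (⟨Function.argmin lam, fun t' => hh t'⟩ : ∃ t, ∀ t', lam t ≤ lam t')
    exact ⟨t, ht⟩
  set L := lam t with hL
  have lamle : ∀ σ ∈ S, dd D t (ω σ * t) ≤ L := fun σ hσ => Finset.le_sup (f := fun σ => dd D t (ω σ * t)) hσ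
  obtain ⟨s, hs, hsL⟩ : ∃ s ∈ S, L = dd D t (ω s * t) := Finset.exists_mem_eq_sup S ⟨1, h1S⟩ (fun σ => dd D t (ω σ * t))
  set m := (S * S * S).sup fun u => dd D t (ω u * ω u * t) - dd D t (ω u * t) with hm
  have hmle : ∀ u ∈ S * S * S, dd D t (ω u * ω u * t) ≤ dd D t (ω u * t) + m := by
    intro u hu
    have := Finset.le_sup (f := fun u => dd D t (ω u * ω u * t) - dd D t (ω u * t)) hu
    omega
  have m1 : ∀ a ∈ S, a ∈ S * S * S := fun a ha => by
    have := Finset.mul_mem_mul (Finset.mul_mem_mul ha h1S) h1S; simpa using this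
  have m2 : ∀ a ∈ S, ∀ b ∈ S, a * b ∈ S * S * S := fun a ha b hb => by
    have := Finset.mul_mem_mul (Finset.mul_mem_mul ha hb) h1S; simpa using this
  have m3 : ∀ a ∈ S, ∀ b ∈ S, ∀ c ∈ S, a * b * c ∈ S * S * S := fun a ha b hb c hc =>
    Finset.mul_mem_mul (Finset.mul_mem_mul ha hb) hc
  have pair : ∀ a b, a ∈ S * S * S → b ∈ S * S * S → a * b ∈ S * S * S →
      dd D t (ω (a * b) * t) ≤ max (dd D t (ω a * t)) (dd D t (ω b * t)) + m := by
    intro a b ha hb hab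
    have := h.toCut.serre_pair (ω a) (ω b) t m (hmle a ha) (hmle b hb) (by have := hmle _ hab; rwa [map_mul] at this)
    rwa [map_mul]
  have inv : ∀ a, dd D t ((ω a)⁻¹ * t) = dd D t (ω a * t) := by
    intro a; rw [← Cut.dd_smul (ω a)]; simp [Cut.dd_symm]
  have p1 : ∀ τ ∈ S, dd D t (ω τ * (ω s * t)) ≤ L + m := by
    intro τ hτ
    have := pair τ s (m1 _ hτ) (m1 _ hs) (m2 _ hτ _ hs)
    rw [map_mul, mul_assoc] at this
    have := max_le (lamle τ hτ) (lamle s hs)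
    omega
  have p2 : ∀ τ ∈ S, dd D (ω s * t) (ω τ * t) ≤ L + m := by
    intro τ hτ
    rw [← Cut.dd_smul (ω τ)⁻¹, Cut.dd_symm]
    have := p1 _ (hS.symm _ hτ)
    rw [map_inv] at this; simpa using this
  have p3 : ∀ τ ∈ S, dd D (ω s * t) (ω τ * (ω s * t)) ≤ L + 2 * m := by
    intro τ hτ
    rw [← Cut.dd_smul (ω s)⁻¹]
    have := pair s⁻¹ (τ * s) (m1 _ (hS.symm _ hs)) (m2 _ hτ _ hs) (by rw [← mul_assoc]; exact m3 _ (hS.symm _ hs) _ hτ _ hs)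
    simp only [map_mul, map_inv, mul_assoc] at this
    rw [inv] at this
    have := max_le ((lamle s hs).trans (Nat.le_add_right L m)) (p1 τ hτ)
    simp only [inv_mul_cancel_left]
    omega
  have m_pos : 1 ≤ m := by
    by_contra hm0
    have hm0 : m = 0 := by omega
    rw [hm0] at p1 p2 p3
    have all : ∀ w : G, dd D t (ω w * t) ≤ L ∧ dd D t (ω w * (ω s * t)) ≤ L ∧ dd D (ω s * t) (ω w * t) ≤ L ∧ dd D (ω s * t) (ω w * (ω s * t)) ≤ L := by
      refine hS.ind _ 1 ?_ ?_
      · simp only [map_one, one_mul, Cut.dd_self]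
        rw [Cut.dd_symm (ω s * t)]; omega
      · rintro w ⟨w1, w2, w3, w4⟩ τ hτ
        have st : ∀ p q, dd D p (ω w * t) ≤ L → dd D p (ω w * (ω s * t)) ≤ L → dd D q t ≤ L → dd D q (ω s * t) ≤ L → dd D p (ω w * q) ≤ L := by
          intro p q k1 k2 k3 k4
          have e := h.toCut.four_pt p (ω w * q) (ω w * t) (ω w * (ω s * t))
          simp only [Cut.dd_smul] at e
          omega
        have q1 := lamle τ hτ
        have q2 := p1 τ hτ
        have q3 := p2 τ hτ
        have q4 := p3 τ hτ
        simp only [map_mul, mul_assoc]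
        refine ⟨st _ _ w1 w2 ?_ ?_, st _ _ w1 w2 ?_ ?_, st _ _ w3 w4 ?_ ?_, st _ _ w3 w4 ?_ ?_⟩ <;> rw [Cut.dd_symm] <;> omega
    obtain ⟨g, hg⟩ := h.unbdd t L
    have := (all (ω.symm g)).1
    simp at this; omega
  have hLm : L ≤ 2 * K0 + 2 * m := by
    obtain ⟨x0, c1, c2⟩ := hmid t (ω s * t)
    rw [← hsL] at c1 c2
    refine (ht x0).trans (Finset.sup_le fun τ hτ => ?_)
    have fp : ∀ z, 2 * dd D x0 z + L ≤ 2 * dd D t z + 2 * K0 ∨ 2 * dd D x0 z + L ≤ 2 * dd D (ω s * t) z + 2 * K0 := by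
      intro z
      have e := h.toCut.four_pt t (ω s * t) x0 z
      rw [← hsL] at e
      have := Cut.dd_symm (D := D) t z
      omega
    have fp' : ∀ z, 2 * dd D z (ω τ * x0) + L ≤ 2 * dd D z (ω τ * t) + 2 * K0 ∨ 2 * dd D z (ω τ * x0) + L ≤ 2 * dd D z (ω τ * (ω s * t)) + 2 * K0 := by
      intro z
      have tr : ∀ w, dd D z (ω τ * w) = dd D w ((ω τ)⁻¹ * z) := by
        intro w; rw [← Cut.dd_smul (ω τ)⁻¹, Cut.dd_symm]; simp
      rw [tr, tr, tr]; exact fp _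
    have a0 := fp (ω τ * x0)
    have a1 := fp' t
    have a2 := fp' (ω s * t)
    have q1 := lamle τ hτ
    have q2 := p1 τ hτ
    have q3 := p2 τ hτ
    have q4 := p3 τ hτ
    omega
  obtain ⟨u, hu, hum⟩ : ∃ u ∈ S * S * S, m = dd D t (ω u * ω u * t) - dd D t (ω u * t) :=
    Finset.exists_mem_eq_sup (S * S * S) ⟨1, m1 1 h1S⟩ _
  refine ⟨t, max L 1, fun σ hσ => (lamle σ hσ).trans (le_max_left _ _), le_max_right _ _, u, hu, m, m_pos, ?_, by omega⟩
  have : 2 * K0 ≤ 2 * K0 * m := Nat.le_mul_of_pos_right _ m_pos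
  rw [add_mul]
  refine max_le (by omega) (by omega)
end serre
section cent
variable {G : Type u} [Group G]
namespace Cut
variable {D : Set G}
lemma growth (h : Cut D) (H t : G) (hg : dd D t (H * t) < dd D t (H * H * t)) : ∃ Z ∈ HH D, H • Z ⊂ Z := by
  have e1 := h.gp_formula t (H⁻¹ * t) (H * t)
  have i1 : dd D t (H⁻¹ * t) = dd D t (H * t) := by rw [← dd_smul H]; simp [dd_symm]
  have i2 : dd D (H⁻¹ * t) (H * t) = dd D t (H * H * t) := by rw [← dd_smul H]; simp [mul_assoc]
  rw [i1, i2] at e1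
  by_contra! hno
  have hgp : gp D (H * t) t (H * H * t) = gp D t (H⁻¹ * t) (H * t) := by
    have e := h.gp_formula (H * t) t (H * H * t)
    rw [mul_assoc H H t, dd_smul, dd_symm (H * t) t, ← mul_assoc] at e
    omega
  have sub : sep D (H * t) t ⊆ gps D (H * t) t (H * H * t) ∪ {Z | Zᶜ ∈ gps D t (H⁻¹ * t) (H * t)} := by
    rintro Z ⟨hZ, a, b⟩
    by_contra hn
    simp only [mem_union, not_or, gps, mem_setOf_eq, not_and, not_not, mem_compl_iff] at hn
    have c1 := hn.1 hZ a b
    have c2 : H⁻¹ * t ∉ Z := fun hh => hn.2 (HHc hZ) b hh a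
    apply hno Z hZ
    refine ⟨?_, fun hh => b (by have := hh a; rw [mem_sm] at this; simpa using this)⟩
    rcases h.nestH hZ (HHs H hZ) with n | n | n | n
    · exact absurd (n a) (by rw [mem_sm]; simpa using b)
    · exact n
    · exact absurd (show H * H * t ∈ H • Z by rw [mem_sm]; simpa [mul_assoc] using a) (Set.disjoint_left.1 n c1)
    · exact absurd (n b) (by rw [mem_sm]; exact c2)
  have f : {Z | Zᶜ ∈ gps D t (H⁻¹ * t) (H * t)}.Finite := by
    refine ((h.gps_fin t (H⁻¹ * t) (H * t)).image (fun Z => Zᶜ)).subset ?_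
    intro Z hZ; exact ⟨Zᶜ, hZ, compl_compl _⟩
  have c := (ncard_le_ncard sub ((h.gps_fin _ _ _).union f)).trans (ncard_union_le _ _)
  rw [compl_image_ncard (gps D t (H⁻¹ * t) (H * t)) {Z | Zᶜ ∈ gps D t (H⁻¹ * t) (H * t)} (fun _ => Iff.rfl)] at c
  have : (sep D (H * t) t).ncard = dd D t (H * t) := dd_symm _ _
  change _ ≤ gp D (H * t) t (H * H * t) + gp D t (H⁻¹ * t) (H * t) at c
  omega
lemma act_fin (h : Cut D) {Y : Set G} (hY : Y ∈ HH D) (a b : G) : {w : G | a ∈ w • Y ∧ b ∉ w • Y}.Finite := by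
  refine ((h.sep_fin a b).biUnion (t := fun W => {w : G | w • Y = W}) fun W _ => h.stabH hY).subset ?_
  rintro w ⟨h1, h2⟩
  exact mem_biUnion (⟨HHs w hY, h1, h2⟩ : w • Y ∈ sep D a b) rfl
def xi (h : G) (Z : Set G) (Y : Set G) : Prop := ∃ n : ℕ, h ^ n • Z ⊆ Y
lemma pow_anti {h : G} {Z : Set G} (hz : h • Z ⊂ Z) {n m : ℕ} (hnm : n ≤ m) : h ^ m • Z ⊆ h ^ n • Z := by
  obtain ⟨k, rfl⟩ := Nat.exists_eq_add_of_le hnm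
  induction k with
  | zero => rfl
  | succ k ih =>
    rw [← add_assoc, pow_succ, mul_smul]
    exact (smul_set_mono hz.1).trans (ih (by omega))
lemma pow_inj {h : G} {Z : Set G} (hz : h • Z ⊂ Z) : Function.Injective (fun n : ℕ => h ^ n) := by
  have key : ∀ n m : ℕ, n < m → h ^ n ≠ h ^ m := by
    intro n m hnm e
    have a : h ^ m • Z ⊆ h ^ (n + 1) • Z := pow_anti hz hnm
    rw [← e, pow_succ, mul_smul] at a
    exact (sm_ssub.2 hz : h ^ n • h • Z ⊂ h ^ n • Z).2 a
  intro n m e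
  rcases lt_trichotomy n m with c | c | c
  · exact absurd e (key _ _ c)
  · exact c
  · exact absurd e.symm (key _ _ c)
lemma xi_or (h : Cut D) {k : G} {Z Y : Set G} (hZ : Z ∈ HH D) (hz : k • Z ⊂ Z) (hY : Y ∈ HH D) : xi k Z Y ∨ xi k Z Yᶜ := by
  by_contra! hn
  simp only [xi, not_exists] at hn
  obtain ⟨a, ha⟩ := (h.infH (HHc hZ)).nonempty
  obtain ⟨b, hb⟩ := (h.infH hY).nonempty
  obtain ⟨b', hb'⟩ := (h.infH (HHc hY)).nonempty
  have an : ∀ n : ℕ, a ∉ k ^ n • Z := fun n hh => ha (by simpa using pow_anti hz (Nat.zero_le n) hh)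
  have sub : range (fun n : ℕ => k ^ n) ⊆ {w : G | b ∈ w • Z ∧ a ∉ w • Z} ∪ {w : G | b' ∈ w • Z ∧ a ∉ w • Z} := by
    rintro _ ⟨n, rfl⟩
    rcases h.nestH (HHs (k ^ n) hZ) hY with c | c | c | c
    · exact absurd c (hn.1 n)
    · exact Or.inl ⟨c hb, an n⟩
    · exact absurd c.subset_compl_right (hn.2 n)
    · exact Or.inr ⟨compl_subset_comm.1 c hb', an n⟩
  exact (infinite_range_of_injective (pow_inj hz)) (((h.act_fin hZ b a).union (h.act_fin hZ b' a)).subset sub)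
lemma xi_disj (h : Cut D) {k : G} {Z Y Y' : Set G} (hZ : Z ∈ HH D) (hz : k • Z ⊂ Z) (h1 : xi k Z Y) (h2 : xi k Z Y') :
    ¬ Disjoint Y Y' := by
  obtain ⟨n, hn⟩ := h1
  obtain ⟨m, hm⟩ := h2
  obtain ⟨a, ha⟩ := (h.infH (HHs (k ^ (max n m)) hZ)).nonempty
  exact fun hd => Set.disjoint_left.1 hd (hn (pow_anti hz (le_max_left _ _) ha)) (hm (pow_anti hz (le_max_right _ _) ha))
lemma xi_smul (h : Cut D) {k z : G} {Z Y : Set G} (hZ : Z ∈ HH D) (hz : k • Z ⊂ Z) (hc : Commute z k) (hY : Y ∈ HH D)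
    (h1 : xi k Z Y) : xi k Z (z • Y) := by
  by_contra hn
  obtain ⟨m, hm⟩ := (h.xi_or hZ hz (HHs z hY)).resolve_left hn
  obtain ⟨n, hn⟩ := h1
  obtain ⟨p, hp⟩ := (h.infH hZ).nonempty
  have sub : (fun j : ℕ => (k ^ j)⁻¹) '' {j | max n m ≤ j} ⊆ {w : G | z * p ∈ w • (z • Y) ∧ p ∉ w • (z • Y)} := by
    rintro _ ⟨j, hj, rfl⟩
    simp only [mem_setOf_eq] at hj ⊢
    constructor
    · rw [mem_sm, inv_inv, ← mul_assoc, ← (hc.pow_right j).eq, mul_assoc, mul_mem_sm]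
      exact hn (pow_anti hz (le_trans (le_max_left _ _) hj) (mul_mem_sm.2 hp))
    · rw [mem_sm, inv_inv]
      exact hm (pow_anti hz (le_trans (le_max_right _ _) hj) (mul_mem_sm.2 hp))
  refine ((Set.Ici_infinite (max n m)).image ?_) ((h.act_fin (HHs z hY) (z * p) p).subset sub)
  intro a _ b _ hab
  exact pow_inj hz (inv_injective hab)
lemma cent_aux (h : Cut D) {k1 k2 k3 : G} {Z1 Z2 Z3 : Set G} (H1 : Z1 ∈ HH D) (H2 : Z2 ∈ HH D) (H3 : Z3 ∈ HH D)
    (z1 : k1 • Z1 ⊂ Z1) (z2 : k2 • Z2 ⊂ Z2) (z3 : k3 • Z3 ⊂ Z3) (d12 : Disjoint Z1 Z2) (d13 : Disjoint Z1 Z3) (d23 : Disjoint Z2 Z3) :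
    {z : G | Commute z k1 ∧ Commute z k2 ∧ Commute z k3}.Finite := by
  set L : Set (Set G) := {Y | Y ∈ HH D ∧ xi k1 Z1 Y ∧ xi k2 Z2 Yᶜ ∧ xi k3 Z3 Yᶜ} with hL
  have LZ : Z1 ∈ L := ⟨H1, ⟨0, by simp⟩, ⟨0, by simpa using d12.symm.subset_compl_right⟩, ⟨0, by simpa using d13.symm.subset_compl_right⟩⟩
  have Ld : ∀ Y ∈ L, Disjoint Y Z2 := by
    rintro Y ⟨hY, a1, a2, a3⟩
    have self : ∀ k (Z : Set G), xi k Z Z := fun k Z => ⟨0, by simp⟩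
    rcases h.nestH hY H2 with n | n | n | n
    · exact absurd (d12.symm.mono_left n) (h.xi_disj H1 z1 a1 (self _ _))
    · exact absurd (disjoint_compl_left.mono_right n) (h.xi_disj H2 z2 a2 (self _ _))
    · exact n
    · exact absurd ((d23).mono_left n) (h.xi_disj H3 z3 a3 (self _ _))
  have Lc : ∀ Y ∈ L, ∀ Y' ∈ L, Y ⊆ Y' ∨ Y' ⊆ Y := by
    rintro Y hY Y' hY'
    rcases h.nestH hY.1 hY'.1 with n | n | n | n
    · exact Or.inl n
    · exact Or.inr n
    · exact absurd n (h.xi_disj H1 z1 hY.2.1 hY'.2.1)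
    · refine absurd ?_ (h.xi_disj H2 z2 hY.2.2.1 hY'.2.2.1)
      exact (disjoint_compl_right (a := Y')).mono_left n
  obtain ⟨a, ha⟩ := (h.infH H1).nonempty
  obtain ⟨b, hb⟩ := (h.infH H2).nonempty
  obtain ⟨M, ⟨hM, hM1⟩, hmax⟩ := ((h.t1H a b).subset (t := {Y | Y ∈ L ∧ Z1 ⊆ Y}) (by
    rintro Y ⟨hY, h1⟩
    exact ⟨hY.1, h1 ha, fun hh => Set.disjoint_left.1 (Ld Y hY) hh hb⟩)).exists_maximal ⟨Z1, LZ, subset_rfl⟩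
  have top : ∀ Y ∈ L, Y ⊆ M := by
    intro Y hY
    rcases Lc Y hY M hM with n | n
    · exact n
    · exact hmax ⟨hY, hM1.trans n⟩ n
  have pres : ∀ z, Commute z k1 ∧ Commute z k2 ∧ Commute z k3 → z • M ∈ L := by
    rintro z ⟨c1, c2, c3⟩
    refine ⟨HHs z hM.1, h.xi_smul H1 z1 c1 hM.1 hM.2.1, ?_, ?_⟩
    · rw [← smul_set_compl]; exact h.xi_smul H2 z2 c2 (HHc hM.1) hM.2.2.1
    · rw [← smul_set_compl]; exact h.xi_smul H3 z3 c3 (HHc hM.1) hM.2.2.2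
  refine (h.stabH hM.1 (Y := M)).subset ?_
  intro z hz
  refine (top _ (pres z hz)).antisymm ?_
  have := top _ (pres z⁻¹ ⟨hz.1.inv_left, hz.2.1.inv_left, hz.2.2.inv_left⟩)
  have := smul_set_mono (a := z) this
  simpa using this
end Cut
open Classical in
lemma CutSys.cent {D : Set G} (h : CutSys D) {k : G} {Z : Set G} (hZ : Z ∈ HH D) (hz : k • Z ⊂ Z) :
    ∃ F : Finset G, {z : G | ∀ f ∈ F, Commute z (f * k * f⁻¹)}.Finite := by
  obtain ⟨f1, f2, f3, d12, d13, d23⟩ : ∃ f1 f2 f3 : G, Disjoint (f1 • Z) (f2 • Z) ∧ Disjoint (f1 • Z) (f3 • Z) ∧ Disjoint (f2 • Z) (f3 • Z) := by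
    have key : ∀ (E : Set G) (x : G), CutSys E → Z = x • E → ∃ f1 f2 f3 : G, Disjoint (f1 • Z) (f2 • Z) ∧ Disjoint (f1 • Z) (f3 • Z) ∧ Disjoint (f2 • Z) (f3 • Z) := by
      rintro E x hE rfl
      obtain ⟨y1, y2, a, b, c⟩ := hE.y
      refine ⟨y1 * x⁻¹, y2 * y1 * x⁻¹, y2 * y2 * x⁻¹, ?_⟩
      simp only [mul_smul, inv_smul_smul]
      exact ⟨c.mono_right (smul_set_mono a), c.mono_right (smul_set_mono b), (disjoint_smul_set (a := y2)).2 c⟩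
    obtain ⟨x, e | e⟩ := hZ
    · exact key D x h e
    · exact key Dᶜ x h.compl e
  refine ⟨{f1, f2, f3}, ?_⟩
  have st : ∀ f : G, (f * k * f⁻¹) • (f • Z) ⊂ f • Z := by
    intro f
    rw [smul_smul]; simp only [inv_mul_cancel_right]; rw [mul_smul]; exact sm_ssub.2 hz
  refine (h.toCut.cent_aux (Cut.HHs f1 hZ) (Cut.HHs f2 hZ) (Cut.HHs f3 hZ) (st f1) (st f2) (st f3) d12 d13 d23).subset ?_
  intro z hz
  exact ⟨hz f1 (by simp), hz f2 (by simp), hz f3 (by simp)⟩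
def Good (D : Set G) (τ : G) : Prop := ∃ (ω : G ≃* G) (Z : Set G), Z ∈ HH D ∧ ω τ • Z ⊂ Z
open Classical in
lemma CutSys.det {D : Set G} (h : CutSys D) {S : Finset G} (hS : Gen S) {τ : G} (hτ : Good D τ) :
    ∃ F : Finset G, ∀ c : G → G, {ω : G ≃* G | ∀ e ∈ F, ω (e * τ * e⁻¹) = c e}.Finite := by
  obtain ⟨ω1, Z, hZ, hz⟩ := hτ
  obtain ⟨F1, hF1⟩ := h.cent hZ hz
  set F0 := F1.image ω1.symm with hF0
  have cf : {z : G | ∀ e ∈ F0, Commute z (e * τ * e⁻¹)}.Finite := by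
    refine (hF1.preimage (ω1.injective.injOn)).subset ?_
    intro z hz f hf
    have := hz (ω1.symm f) (Finset.mem_image_of_mem _ hf)
    have := this.map ω1
    simpa using this
  refine ⟨F0 ∪ S * F0, fun c => ?_⟩
  rcases eq_empty_or_nonempty {ω : G ≃* G | ∀ e ∈ F0 ∪ S * F0, ω (e * τ * e⁻¹) = c e} with he | ⟨ω0, h0⟩
  · rw [he]; exact finite_empty
  let R : (G ≃* G) → (S → G) := fun ω s => ω0.symm (ω s.1)
  have Rinj : Function.Injective R := by
    intro ω ω' e
    have key : ∀ x, ω x = ω' x := by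
      refine hS.ind _ 1 (by simp) ?_
      intro x hx s hs
      have := congrFun e ⟨s, hs⟩
      simp only [R, EmbeddingLike.apply_eq_iff_eq] at this
      rw [map_mul, map_mul, hx, this]
    exact MulEquiv.ext key
  have fin : (Set.pi univ fun s : S => (fun z => s.1 * z) '' {z : G | ∀ e ∈ F0, Commute z (e * τ * e⁻¹)}).Finite :=
    Set.Finite.pi fun s => cf.image _
  refine (fin.preimage Rinj.injOn).subset ?_
  intro ω hω s _
  refine ⟨s.1⁻¹ * ω0.symm (ω s.1), ?_, by simp [R]⟩
  intro e he
  have a1 : ω0.symm (ω (e * τ * e⁻¹)) = e * τ * e⁻¹ := by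
    rw [hω e (Finset.mem_union_left _ he), ← h0 e (Finset.mem_union_left _ he)]; simp
  have m2 : s.1 * e ∈ F0 ∪ S * F0 := Finset.mem_union_right _ (Finset.mul_mem_mul s.2 he)
  have a2 : ω0.symm (ω (s.1 * (e * τ * e⁻¹) * s.1⁻¹)) = s.1 * (e * τ * e⁻¹) * s.1⁻¹ := by
    have e3 : s.1 * (e * τ * e⁻¹) * s.1⁻¹ = (s.1 * e) * τ * (s.1 * e)⁻¹ := by group
    rw [e3, hω _ m2, ← h0 _ m2]; simp
  set x := ω0.symm (ω s.1) with hx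
  have a3 : x * (e * τ * e⁻¹) * x⁻¹ = s.1 * (e * τ * e⁻¹) * s.1⁻¹ := by
    rw [← a2, map_mul ω, map_mul ω, map_mul ω0.symm, map_mul ω0.symm, a1, map_inv, map_inv]
  generalize e * τ * e⁻¹ = b at a3
  show s.1⁻¹ * x * b = b * (s.1⁻¹ * x)
  have : x * b = s.1 * b * s.1⁻¹ * x := by rw [← a3]; group
  rw [mul_assoc, this]; group
lemma CutSys.phi {D : Set G} (h : CutSys D) {y1 y2 : G} (dj : Disjoint (y1 • D) (y2 • D)) :
    ∃ Φ : Set G, Φ.Finite ∧ ∀ v : G, ∃ c1 ∈ Φ, ∃ c2 ∈ Φ, (c1 * v * c2) • D ⊆ y1 • D := by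
  obtain ⟨q1, q2, -, -, dq⟩ := h.compl.y
  refine ⟨{y1, y2, y1 * q1⁻¹, y1 * q2⁻¹}, toFinite _, fun v => ?_⟩
  have fin : ∀ p q : G, Disjoint (v • p • D) (q • Dᶜ) → (y1 * q⁻¹ * v * p) • D ⊆ y1 • D := by
    intro p q hd
    have : v • p • D ⊆ q • D := by
      have := hd.subset_compl_right
      rwa [smul_set_compl, compl_compl] at this
    have := smul_set_mono (a := y1 * q⁻¹) this
    simpa [mul_smul] using this
  by_contra! hn
  have c11 := fun hd => hn (y1 * q1⁻¹) (by simp) y1 (by simp) (fin _ _ hd)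
  have c12 := fun hd => hn (y1 * q2⁻¹) (by simp) y1 (by simp) (fin _ _ hd)
  have c21 := fun hd => hn (y1 * q1⁻¹) (by simp) y2 (by simp) (fin _ _ hd)
  have c22 := fun hd => hn (y1 * q2⁻¹) (by simp) y2 (by simp) (fin _ _ hd)
  have dv : Disjoint (v • y1 • D) (v • y2 • D) := (disjoint_smul_set (a := v)).2 dj
  rcases h.toCut.nestH (Cut.HHs v (Cut.HHD y1)) (Cut.HHDc q1) with n | n | n | n
  · exact c12 (dq.mono_left n)
  · exact c21 (dv.symm.mono_right n)
  · exact c11 n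
  · exact c22 (dq.mono_left (dv.symm.subset_compl_right.trans n))
end cent
section geo
variable {G : Type u} [Group G]
def SS (D : Set G) (m1 m2 : G) : Set (Set G) := sep D m1 m2 ∪ sep D m2 m1
def XX (U : ℕ → G) (δ : ℕ → Bool) : ℕ → G
  | 0 => 1
  | i + 1 => XX U δ i * (bif δ i then U i else (U i)⁻¹)
lemma XX_fin (U : ℕ → G) (i : ℕ) : {x | ∃ δ, x = XX U δ i}.Finite := by
  induction i with
  | zero => exact (finite_singleton 1).subset (by rintro _ ⟨δ, rfl⟩; rfl)
  | succ i ih =>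
    refine (ih.mul (toFinite {U i, (U i)⁻¹})).subset ?_
    rintro _ ⟨δ, rfl⟩
    exact mul_mem_mul ⟨δ, rfl⟩ (by cases δ i <;> simp)
namespace Cut
variable {D : Set G}
lemma dd_inv (H t : G) : dd D t (H⁻¹ * t) = dd D t (H * t) := by rw [← dd_smul H]; simp [dd_symm]
lemma dd_two (a b t : G) : dd D (a * t) (b * t) = dd D t (a⁻¹ * b * t) := by rw [← dd_smul a⁻¹]; simp [mul_assoc]
lemma dd_mul (h : Cut D) (a b t : G) : dd D t (a * b * t) ≤ dd D t (a * t) + dd D t (b * t) := by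
  have := h.dd_tri t (a * t) (a * b * t)
  rw [mul_assoc a, dd_smul] at this
  rwa [mul_assoc a]
lemma pow_len (h : Cut D) {H t : G} {m : ℕ} (hm : 1 ≤ m) (hg : dd D t (H * t) + m ≤ dd D t (H * H * t)) :
    ∀ k, dd D t (H ^ k * t) + m ≤ dd D t (H ^ (k + 1) * t) := by
  have e1 := h.gp_formula t (H⁻¹ * t) (H * t)
  rw [dd_inv, dd_two, inv_inv] at e1
  intro k
  rcases k with _ | n
  · have := h.dd_mul H H t
    simp [dd_self]; omega
  have hd : ∀ i j, dd D (H ^ i * t) (H ^ (i + j) * t) = dd D t (H ^ j * t) := by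
    intro i j; rw [pow_add, mul_assoc, dd_smul]
  have h1 : ∀ i, dd D (H ^ i * t) (H ^ (i + 1) * t) = dd D t (H * t) := by intro i; rw [hd]; simp
  have := h.loc_fwd (fun i => H ^ i * t) (dd D t (H * t)) (gp D t (H⁻¹ * t) (H * t)) (n + 2) (by omega)
    (fun i _ => (h1 i).ge) (fun i _ => by
      have := h.gp_formula (H ^ (i + 1) * t) (H ^ i * t) (H ^ (i + 2) * t)
      rw [hd i 2, dd_symm _ (H ^ i * t), h1, show i + 2 = i + 1 + 1 by ring, h1, pow_two] at this
      show gp D (H ^ (i + 1) * t) (H ^ i * t) (H ^ (i + 1 + 1) * t) ≤ _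
      omega) n 0 (by omega)
  have f := h.gp_formula (H ^ 1 * t) (H ^ 0 * t) (H ^ (1 + (n + 1)) * t)
  simp only [zero_add] at this
  rw [hd, dd_symm, h1 0, show 1 + (n + 1) = 2 + n by ring] at f
  rw [show 2 + n = n + 1 + 1 by ring] at f this
  simp only [pow_zero, one_mul] at f this
  omega
lemma pow_gp (h : Cut D) {H t : G} {m : ℕ} (hm : 1 ≤ m) (hg : dd D t (H * t) + m ≤ dd D t (H * H * t)) (k : ℕ) :
    gp D t ((H ^ k)⁻¹ * t) (H ^ k * t) ≤ dd D t (H * t) := by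
  have pl := h.pow_len hm hg
  rcases k with _ | n
  · have : gps D t t t = ∅ := by ext Z; simp [gps]
    simp [gp, this]
  have e1 := h.gp_formula t (H⁻¹ * t) (H ^ (n + 1) * t)
  have e2 := h.gp_formula t (H⁻¹ * t) ((H ^ (n + 1))⁻¹ * t)
  rw [dd_inv, dd_two, inv_inv] at e1 e2
  rw [← pow_succ'] at e1
  rw [dd_inv, show H * (H ^ (n + 1))⁻¹ = (H ^ n)⁻¹ by rw [pow_succ]; group, dd_inv] at e2
  have p1 := pl n
  have p2 := pl (n + 1)
  rcases h.gp_min t (H⁻¹ * t) ((H ^ (n + 1))⁻¹ * t) (H ^ (n + 1) * t) with c | c <;> omega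
lemma geom (h : Cut D) {H t : G} {m : ℕ} (hm : 1 ≤ m) (hg : dd D t (H * t) + m ≤ dd D t (H * H * t)) (k x : ℕ) (f : G)
    (hf : dd D t (f * t) ≤ x) : k * m ≤ dd D t ((f * H * f⁻¹) ^ k * t) + 2 * x ∧
      gp D t (((f * H * f⁻¹) ^ k)⁻¹ * t) ((f * H * f⁻¹) ^ k * t) ≤ dd D t (H * t) + 3 * x := by
  have cj : ∀ A, dd D t (f * A * f⁻¹ * t) ≤ dd D t (A * t) + 2 * x ∧ dd D t (A * t) ≤ dd D t (f * A * f⁻¹ * t) + 2 * x := by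
    intro A
    have a1 := h.dd_mul (f * A) f⁻¹ t
    have a2 := h.dd_mul f A t
    have a3 := h.dd_mul (f⁻¹ * (f * A * f⁻¹)) f t
    have a4 := h.dd_mul f⁻¹ (f * A * f⁻¹) t
    rw [dd_inv] at a1 a4
    rw [show f⁻¹ * (f * A * f⁻¹) * f = A by group] at a3
    omega
  rw [conj_pow]
  have pk : ∀ k, k * m ≤ dd D t (H ^ k * t) := by
    intro k
    induction k with
    | zero => simp
    | succ k ih => have := h.pow_len hm hg k; rw [add_mul]; omega
  refine ⟨(pk k).trans (cj _).2, ?_⟩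
  have e1 := h.gp_formula t ((H ^ k)⁻¹ * t) (H ^ k * t)
  have e2 := h.gp_formula t ((f * H ^ k * f⁻¹)⁻¹ * t) (f * H ^ k * f⁻¹ * t)
  rw [dd_inv, dd_two, inv_inv] at e1 e2
  rw [show f * H ^ k * f⁻¹ * (f * H ^ k * f⁻¹) = f * (H ^ k * H ^ k) * f⁻¹ by group] at e2
  have := cj (H ^ k)
  have := cj (H ^ k * H ^ k)
  have := h.pow_gp hm hg k
  omega
lemma signs (h : Cut D) (U : ℕ → G) (t : G) (b : ℕ) (hb : ∀ i, gp D t ((U i)⁻¹ * t) (U i * t) ≤ b) : ∃ δ : ℕ → Bool,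
    ∀ i, gp D t ((bif δ i then U i else (U i)⁻¹)⁻¹ * t) ((bif δ (i + 1) then U (i + 1) else (U (i + 1))⁻¹) * t) ≤ b := by
  have st : ∀ (i : ℕ) (s : Bool), ∃ s' : Bool,
      gp D t ((bif s then U i else (U i)⁻¹)⁻¹ * t) ((bif s' then U (i + 1) else (U (i + 1))⁻¹) * t) ≤ b := by
    intro i s
    rcases h.gp_min t ((U (i + 1))⁻¹ * t) ((bif s then U i else (U i)⁻¹)⁻¹ * t) (U (i + 1) * t) with c | c
    · exact ⟨false, by rw [gp_symm]; exact c.trans (hb _)⟩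
    · exact ⟨true, c.trans (hb _)⟩
  choose f hf using st
  obtain ⟨δ, hδ⟩ : ∃ δ : ℕ → Bool, ∀ i, δ (i + 1) = f i (δ i) := ⟨fun i => Nat.rec true (fun i s => f i s) i, fun i => rfl⟩
  exact ⟨δ, fun i => by rw [hδ i]; exact hf i (δ i)⟩
lemma pre_ncard {B : Set (Set G)} (hB : B.Finite) (g : G) : {Z : Set G | g • Z ∈ B}.Finite ∧ {Z : Set G | g • Z ∈ B}.ncard = B.ncard := by
  have : {Z : Set G | g • Z ∈ B} = (fun Z => g⁻¹ • Z) '' B := by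
    ext Z; exact ⟨fun hz => ⟨_, hz, by simp⟩, by rintro ⟨Y, hY, rfl⟩; simpa using hY⟩
  rw [this]
  exact ⟨hB.image _, ncard_image_of_injective _ (MulAction.injective _)⟩
lemma cpre {B : Set (Set G)} (hB : B.Finite) : {Z : Set G | Zᶜ ∈ B}.Finite ∧ {Z : Set G | Zᶜ ∈ B}.ncard = B.ncard :=
  ⟨(hB.image (fun Z => Zᶜ)).subset fun Z hZ => ⟨Zᶜ, hZ, compl_compl _⟩, compl_image_ncard _ _ fun _ => Iff.rfl⟩
lemma count (h : Cut D) (P : ℕ → G) (r i A b Hg c : ℕ) (hi : i < r) (hA : 4 * b + 4 * Hg + 2 * c < A)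
    (h1 : ∀ i, i + 1 ≤ r → A ≤ dd D (P i) (P (i + 1)))
    (h2 : ∀ i, i + 2 ≤ r → gp D (P (i + 1)) (P i) (P (i + 2)) ≤ b) (m1 m2 : G) (g0 : gp D (P 0) m1 m2 ≤ Hg)
    (gr : gp D (P r) m1 m2 ≤ Hg) (H : G) (c1 : dd D (P i) (H * P i) ≤ c) (c2 : dd D (P (i + 1)) (H * P (i + 1)) ≤ c) :
    ∃ Z ∈ SS D m1 m2, H • Z ∈ SS D m1 m2 := by
  have A1 : (gps D (P i) (P 0) (P (i + 1))).ncard ≤ b := by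
    rcases i with _ | j
    · have : gps D (P 0) (P 0) (P (0 + 1)) = ∅ := by ext Z; simp [gps]; tauto
      simp [this]
    · exact h.loc_bwd P A b r (by omega) h1 h2 j (by omega)
  have A2 : (gps D (P (i + 1)) (P i) (P r)).ncard ≤ b := by
    rcases eq_or_ne (i + 1) r with rfl | hne
    · have : gps D (P (i + 1)) (P i) (P (i + 1)) = ∅ := by ext Z; simp [gps]; tauto
      simp [this]
    · have := h.loc_fwd P A b r (by omega) h1 h2 (r - (i + 2)) i (by omega)
      rwa [show i + 2 + (r - (i + 2)) = r by omega] at this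
  set N := sep D (P i) (P (i + 1)) with hN
  set B := N \ SS D m1 m2 with hB
  have Bf : B.Finite := (h.sep_fin _ _).subset diff_subset
  have Bs : B ⊆ gps D (P i) (P 0) (P (i + 1)) ∪ ({Z | Zᶜ ∈ gps D (P (i + 1)) (P i) (P r)} ∪
      (gps D (P 0) m1 m2 ∪ {Z | Zᶜ ∈ gps D (P r) m1 m2})) := by
    rintro Z ⟨⟨z1, z2, z3⟩, hn⟩
    simp only [SS, sep, gps, mem_union, mem_setOf_eq, HHc_iff, mem_compl_iff, z1, z2, z3, true_and, not_or, not_and, not_not, not_true, not_false_iff, and_true] at hn ⊢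
    tauto
  have q2 := cpre (h.gps_fin (P (i + 1)) (P i) (P r))
  have q4 := cpre (h.gps_fin (P r) m1 m2)
  have Bc := (ncard_le_ncard Bs ((h.gps_fin _ _ _).union (q2.1.union ((h.gps_fin _ _ _).union q4.1)))).trans
    ((ncard_union_le _ _).trans (Nat.add_le_add_left ((ncard_union_le _ _).trans (Nat.add_le_add_left (ncard_union_le _ _) _)) _))
  rw [q2.2, q4.2] at Bc
  change gp D (P 0) m1 m2 ≤ Hg at g0
  unfold gp at g0 gr
  by_contra! hno
  have s1 := pre_ncard Bf H
  have s2 := pre_ncard (h.sep_fin (H * P i) (P i)) H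
  have s3 := pre_ncard (h.sep_fin (P (i + 1)) (H * P (i + 1))) H
  have Ns : N ⊆ B ∪ ({Z | H • Z ∈ B} ∪ ({Z | H • Z ∈ sep D (H * P i) (P i)} ∪ {Z | H • Z ∈ sep D (P (i + 1)) (H * P (i + 1))})) := by
    rintro Z hZ
    have hZ' := hZ
    obtain ⟨z1, z2, z3⟩ := hZ'
    by_cases a : Z ∈ SS D m1 m2
    · right
      by_cases a2 : H • Z ∈ N
      · exact Or.inl ⟨a2, hno Z a⟩
      · right
        have a3 : P i ∈ H • Z → P (i + 1) ∈ H • Z := by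
          intro q; by_contra q'; exact a2 ⟨HHs H z1, q, q'⟩
        by_cases a4 : P i ∈ H • Z
        · exact Or.inr ⟨HHs H z1, a3 a4, fun q => z3 (mul_mem_sm.1 q)⟩
        · exact Or.inl ⟨HHs H z1, mul_mem_sm.2 z2, a4⟩
    · exact Or.inl ⟨hZ, a⟩
  have Nc := (ncard_le_ncard Ns (Bf.union (s1.1.union (s2.1.union s3.1)))).trans
    ((ncard_union_le _ _).trans (Nat.add_le_add_left ((ncard_union_le _ _).trans (Nat.add_le_add_left (ncard_union_le _ _) _)) _))
  rw [s1.2, s2.2, s3.2] at Nc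
  have e1 : (sep D (H * P i) (P i)).ncard ≤ c := by rw [dd_symm] at c1; exact c1
  have e2 : (sep D (P (i + 1)) (H * P (i + 1))).ncard ≤ c := c2
  have e3 : A ≤ N.ncard := h1 i hi
  omega
lemma CC_fin (h : Cut D) (m1 m2 : G) : {H : G | ∃ Z ∈ SS D m1 m2, H • Z ∈ SS D m1 m2}.Finite := by
  have f : (SS D m1 m2).Finite := (h.sep_fin _ _).union (h.sep_fin _ _)
  refine (f.biUnion (t := fun Z => ⋃ Y ∈ SS D m1 m2, {H : G | H • Z = Y}) fun Z hZ => f.biUnion fun Y _ => h.stabH ?_).subset ?_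
  · rcases hZ with hZ | hZ <;> exact hZ.1
  · rintro H ⟨Z, hZ, hH⟩
    exact mem_biUnion hZ (mem_biUnion hH rfl)
def Thin (ω : G ≃* G) (x : G) (D Z : Set G) : Prop := {g | g ∈ x • D ∧ ω g ∈ Z}.Finite ∨ {g | g ∉ x • D ∧ ω g ∈ Z}.Finite
def Tube (D : Set G) (ω : G ≃* G) (x m1 m2 : G) (κ : ℕ) : Prop :=
  {Z | Z ∈ HH D ∧ m1 ∈ Z ∧ m2 ∈ Z ∧ Thin ω x D Z}.Finite ∧ {Z | Z ∈ HH D ∧ m1 ∈ Z ∧ m2 ∈ Z ∧ Thin ω x D Z}.ncard ≤ κ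
lemma inf_t (h : Cut D) (ω : G ≃* G) (t : G) {Z : Set G} (hZ : Z ∈ HH D) (P : G → Prop) (hi : {g | P g ∧ ω g ∈ Z}.Infinite) :
    {g | P g ∧ ω g * t ∈ Z}.Infinite := by
  intro hf
  refine hi ((hf.union ((h.aiH hZ t).preimage ω.injective.injOn)).subset ?_)
  rintro g ⟨h1, h2⟩
  by_cases c : ω g * t ∈ Z
  · exact Or.inl ⟨h1, c⟩
  · exact Or.inr ⟨h2, c⟩
lemma tube_bd (h : Cut D) {K l κ : ℕ} {ω : G ≃* G} {t x m1 m2 : G}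
    (hK : ∀ Z ∈ HH D, {g | g ∈ x • D ∧ ω g * t ∈ Z}.Infinite → {g | g ∉ x • D ∧ ω g * t ∈ Z}.Infinite → (hts D Z (ω x * t)).ncard ≤ K * l)
    (hT : Tube D ω x m1 m2 κ) : gp D (ω x * t) m1 m2 ≤ K * l + κ := by
  have q := cpre (h.gps_fin (ω x * t) m1 m2)
  rw [gp, ← q.2]
  set T := {Z : Set G | Zᶜ ∈ gps D (ω x * t) m1 m2} with hTd
  have Tm : ∀ Z ∈ T, Z ∈ HH D ∧ ω x * t ∉ Z ∧ m1 ∈ Z ∧ m2 ∈ Z := by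
    rintro Z ⟨a, b, c, d⟩; exact ⟨HHc_iff.1 a, b, not_not.1 c, not_not.1 d⟩
  rcases eq_empty_or_nonempty {Z | Z ∈ T ∧ ¬ Thin ω x D Z} with he | hne
  · refine (ncard_le_ncard (fun Z hZ => ?_) hT.1).trans (hT.2.trans (by omega))
    have := Tm Z hZ
    refine ⟨this.1, this.2.2.1, this.2.2.2, ?_⟩
    by_contra hc
    exact (eq_empty_iff_forall_notMem.1 he Z) ⟨hZ, hc⟩
  obtain ⟨Z1, ⟨z1, z2⟩, hmin⟩ := (q.1.subset (fun Z hZ => hZ.1 : {Z | Z ∈ T ∧ ¬ Thin ω x D Z} ⊆ T)).exists_minimal hne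
  obtain ⟨b1, b2, b3, b4⟩ := Tm Z1 z1
  have sub : T ⊆ hts D Z1 (ω x * t) ∪ {Z | Z ∈ HH D ∧ m1 ∈ Z ∧ m2 ∈ Z ∧ Thin ω x D Z} := by
    intro Z hZ
    obtain ⟨a1, a2, a3, a4⟩ := Tm Z hZ
    by_cases c : Thin ω x D Z
    · exact Or.inr ⟨a1, a3, a4, c⟩
    · refine Or.inl ⟨a1, ?_, a2⟩
      rcases h.gps_chain b1 a1 b3 a3 b2 a2 with n | n
      · exact n
      · exact hmin ⟨hZ, c⟩ n
  simp only [Thin, not_or] at z2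
  refine (ncard_le_ncard sub ((h.hts_fin b1 _).union hT.1)).trans ((ncard_union_le _ _).trans (add_le_add ?_ hT.2))
  exact hK Z1 b1 (h.inf_t ω t b1 _ z2.1) (h.inf_t ω t b1 _ z2.2)
end Cut
end geo
section fl
variable {G : Type u} [Group G] {D : Set G}
open Classical in
lemma CutSys.det2 (h : CutSys D) {S : Finset G} (hS : Gen S) {τ : G} (hτ : Good D τ) :
    ∃ (r : ℕ) (e : ℕ → G), 1 ≤ r ∧ (range e).Finite ∧
      ∀ B : Set G, B.Finite → {ω : G ≃* G | ∀ i < r, ω (e i * τ * (e i)⁻¹) ∈ B}.Finite := by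
  obtain ⟨F, hF⟩ := h.det hS hτ
  refine ⟨(insert 1 F).toList.length, fun i => (insert 1 F).toList.getD i 1, ?_, ?_, fun B hB => ?_⟩
  · rw [Finset.length_toList]; exact Finset.card_pos.2 ⟨1, by simp⟩
  · refine ((insert 1 F).finite_toSet).subset ?_
    rintro _ ⟨i, rfl⟩
    by_cases hi : i < (insert 1 F).toList.length
    · have := List.getElem_mem hi
      rw [Finset.mem_toList] at this
      simp only [List.getD_eq_getElem _ _ hi]; exact this
    · simp only [List.getD_eq_default _ _ (not_lt.1 hi)]; simp
  · refine Set.Finite.subset (s := (fun (ω : G ≃* G) (f : F) => ω (f.1 * τ * f.1⁻¹)) ⁻¹' (Set.pi univ fun _ : F => B)) ?_ ?_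
    · refine Set.Finite.preimage' (Set.Finite.pi fun _ => hB) fun c _ => ?_
      refine (hF (fun x => if hx : x ∈ F then c ⟨x, hx⟩ else 1)).subset ?_
      intro ω hω e he
      have := congrFun (mem_singleton_iff.1 hω) ⟨e, he⟩
      simpa [he] using this
    · intro ω hω f _
      have hm : f.1 ∈ (insert 1 F).toList := by rw [Finset.mem_toList]; simp
      obtain ⟨i, hi, e⟩ := List.getElem_of_mem hm
      have := hω i hi
      simp only [List.getD_eq_getElem _ _ hi, e] at this
      exact this
lemma XX_det (u : ℕ → G) (k r : ℕ) (w : G) {CC : Set G} (hC : CC.Finite) : ∃ B : Set G, B.Finite ∧ ∀ (ω : G ≃* G) (δ : ℕ → Bool),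
    (∀ i < r, ω (w * XX (fun i => u i ^ k) δ i * u i * (XX (fun i => u i ^ k) δ i)⁻¹ * w⁻¹) ∈ CC) → ∀ i < r, ω (w * u i * w⁻¹) ∈ B := by
  have bs : ∀ (i : ℕ) (A : Set G) (ω : G ≃* G) (δ : ℕ → Bool), ω (w * XX (fun i => u i ^ k) δ i * w⁻¹) ∈ A →
      ω (w * XX (fun i => u i ^ k) δ i * u i * (XX (fun i => u i ^ k) δ i)⁻¹ * w⁻¹) ∈ CC → ω (w * u i * w⁻¹) ∈ A⁻¹ * CC * A := by
    intro i A ω δ ha hc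
    have : w * u i * w⁻¹ = (w * XX (fun i => u i ^ k) δ i * w⁻¹)⁻¹ *
      (w * XX (fun i => u i ^ k) δ i * u i * (XX (fun i => u i ^ k) δ i)⁻¹ * w⁻¹) * (w * XX (fun i => u i ^ k) δ i * w⁻¹) := by group
    rw [this, map_mul, map_mul, map_inv]
    exact mul_mem_mul (mul_mem_mul (Set.inv_mem_inv.2 ha) hc) ha
  have key : ∀ j, ∃ A : Set G, A.Finite ∧ ∀ (ω : G ≃* G) (δ : ℕ → Bool),
    (∀ i < r, ω (w * XX (fun i => u i ^ k) δ i * u i * (XX (fun i => u i ^ k) δ i)⁻¹ * w⁻¹) ∈ CC) → j ≤ r → ω (w * XX (fun i => u i ^ k) δ j * w⁻¹) ∈ A := by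
    intro j
    induction j with
    | zero => exact ⟨{1}, finite_singleton _, fun ω δ _ _ => by simp [XX]⟩
    | succ j ih =>
      obtain ⟨A, hA, ha⟩ := ih
      have fB := (hA.inv.mul hC).mul hA
      refine ⟨A * ((fun b => b ^ k) '' (A⁻¹ * CC * A) ∪ (fun b => (b ^ k)⁻¹) '' (A⁻¹ * CC * A)), hA.mul ((fB.image _).union (fB.image _)), ?_⟩
      intro ω δ hh hj
      have a1 := ha ω δ hh (by omega)
      have b1 := bs j A ω δ a1 (hh j (by omega))
      have : w * XX (fun i => u i ^ k) δ (j + 1) * w⁻¹ = (w * XX (fun i => u i ^ k) δ j * w⁻¹) *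
          (bif δ j then (w * u j * w⁻¹) ^ k else ((w * u j * w⁻¹) ^ k)⁻¹) := by
        simp only [XX, conj_pow]; cases δ j <;> simp [mul_assoc]
      rw [this, map_mul]
      refine mul_mem_mul a1 ?_
      cases δ j
      · exact Or.inr ⟨_, b1, by simp⟩
      · exact Or.inl ⟨_, b1, by simp⟩
  choose A hA ha using key
  refine ⟨⋃ i ∈ Iio r, (A i)⁻¹ * CC * A i, (finite_Iio r).biUnion fun i _ => ((hA i).inv.mul hC).mul (hA i), ?_⟩
  intro ω δ hh i hi
  exact mem_biUnion (show i ∈ Iio r from hi) (bs i _ ω δ (ha i ω δ hh hi.le) (hh i hi))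
lemma chain_ex {y1 : G} {Φ : Set G} (hΦ : ∀ v : G, ∃ c1 ∈ Φ, ∃ c2 ∈ Φ, (c1 * v * c2) • D ⊆ y1 • D) {V : Set G} (hV : V.Finite) :
    ∃ (n : ℕ) (g : ℕ → G), g 0 = 1 ∧ 1 ≤ n ∧ (∀ s < n, g (s + 1) • D ⊆ g s • y1 • D) ∧
      ∀ v ∈ V, ∃ s < n, ∃ c1 ∈ Φ, ∃ c2 ∈ Φ, g (s + 1) = g s * c1 * v * c2 := by
  induction V, hV using Set.Finite.induction_on with
  | empty => exact ⟨1, fun s => if s = 0 then 1 else y1, by simp, le_rfl, fun s hs => by simp [show s = 0 by omega], by simp⟩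
  | @insert v V _ _ ih =>
    obtain ⟨n, g, g0, hn, hg, hv⟩ := ih
    obtain ⟨c1, k1, c2, k2, hc⟩ := hΦ v
    refine ⟨n + 1, fun s => if s ≤ n then g s else g n * c1 * v * c2, by simpa using g0, by omega, ?_, ?_⟩
    · intro s hs
      rcases eq_or_ne s n with rfl | hne
      · have := smul_set_mono (a := g s) hc
        rw [smul_smul] at this
        simpa [mul_assoc] using this
      · simp only [show s + 1 ≤ n by omega, show s ≤ n by omega, if_true]; exact hg s (by omega)
    · rintro v' (rfl | hv')
      · exact ⟨n, by omega, c1, k1, c2, k2, by simp⟩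
      · obtain ⟨s, hs, q⟩ := hv v' hv'
        refine ⟨s, by omega, ?_⟩
        simpa only [show s + 1 ≤ n by omega, show s ≤ n by omega, if_true] using q
open Classical in
lemma CutSys.FL (h : CutSys D) {S : Finset G} (hS : Gen S) (h1S : 1 ∈ S) (κ : ℕ) {y1 y2 : G} (dj : Disjoint (y1 • D) (y2 • D)) :
    ∃ (n : ℕ) (g : ℕ → G), g 0 = 1 ∧ 1 ≤ n ∧ (∀ s < n, g (s + 1) • D ⊆ g s • y1 • D) ∧
      ∀ m1 m2, {ω : G ≃* G | ∀ s ≤ n, Cut.Tube D ω (g s) m1 m2 κ}.Finite ∧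
        ∀ ω : G ≃* G, (∀ s ≤ n, Cut.Tube D ω (g s) m1 m2 κ) → m1 ≠ m2 := by
  have hc := h.toCut
  obtain ⟨C, hC⟩ := h.serre hS h1S
  obtain ⟨K, hK⟩ := Cut.bbt hc hS
  obtain ⟨Φ, fΦ, hΦ⟩ := h.phi dj
  choose L hL using hc.word_bound hS
  have dt := fun τ (hτ : Good D τ) => h.det2 hS hτ
  choose! r e hr he hfin using dt
  set TT : Set G := {τ | τ ∈ S * S * S ∧ Good D τ} with hTT
  have fT : TT.Finite := (S * S * S).finite_toSet.subset fun τ hτ => hτ.1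
  obtain ⟨E, hE⟩ := (((fΦ.union fT).union (fT.biUnion (t := fun τ => range (e τ)) fun τ hτ => he τ hτ.2)).image L).bddAbove
  have hE' : ∀ x, (x ∈ Φ ∨ x ∈ TT ∨ ∃ τ ∈ TT, ∃ i, e τ i = x) → ∀ (ω : G ≃* G) (t : G) (l : ℕ),
      (∀ σ ∈ S, dd D t (ω σ * t) ≤ l) → dd D t (ω x * t) ≤ E * l := by
    intro x hx ω t l hl
    refine (hL x ω t l hl).trans (Nat.mul_le_mul_right _ (hE ⟨x, ?_, rfl⟩))
    rcases hx with a | a | ⟨τ, a, i, b⟩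
    · exact Or.inl (Or.inl a)
    · exact Or.inl (Or.inr a)
    · exact Or.inr (mem_biUnion a ⟨i, b⟩)
  set k := C * (28 * E + 4 * K) + 4 * κ + 1 with hk
  set u : G → ℕ → G := fun τ i => e τ i * τ * (e τ i)⁻¹ with hu
  obtain ⟨n, g, g0, hn, hg, hv⟩ := chain_ex hΦ (V := ⋃ τ ∈ TT, {x | ∃ δ, x = XX (fun i => u τ i ^ k) δ (r τ)})
    (fT.biUnion fun τ _ => XX_fin _ _)
  have main : ∀ m1 m2, ∀ ω : G ≃* G, (∀ s ≤ n, Cut.Tube D ω (g s) m1 m2 κ) → ∃ τ ∈ TT, ∃ s ∈ Iio n, ∃ c1 ∈ Φ, ∃ δ, ∀ i < r τ,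
      ω (g s * c1 * XX (fun i => u τ i ^ k) δ i * u τ i * (XX (fun i => u τ i ^ k) δ i)⁻¹ * (g s * c1)⁻¹) ∈
        {H : G | ∃ Z ∈ SS D m1 m2, H • Z ∈ SS D m1 m2} := by
    intro m1 m2 ω hω
    obtain ⟨t, l, hl, hl1, τ, hτ, m, hm, hlm, gr⟩ := hC ω
    have τT : τ ∈ TT := ⟨hτ, by
      obtain ⟨Z, hZ, hz⟩ := hc.growth (ω τ) t (by omega)
      exact ⟨ω, Z, hZ, hz⟩⟩
    have hτE := hE' τ (Or.inr (Or.inl τT)) ω t l hl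
    have heE := fun i => hE' (e τ i) (Or.inr (Or.inr ⟨τ, τT, i, rfl⟩)) ω t l hl
    have gm := fun i => hc.geom hm gr k (E * l) (ω (e τ i)) (heE i)
    have ueq : ∀ i, ω (u τ i) = ω (e τ i) * ω τ * (ω (e τ i))⁻¹ := by intro i; simp [hu]
    have ul : ∀ i, dd D t (ω (u τ i) * t) ≤ 3 * (E * l) := by
      intro i
      rw [ueq]
      have a1 := hc.dd_mul (ω (e τ i) * ω τ) (ω (e τ i))⁻¹ t
      have a2 := hc.dd_mul (ω (e τ i)) (ω τ) t
      rw [Cut.dd_inv] at a1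
      have := heE i
      omega
    obtain ⟨δ, hδ⟩ := hc.signs (fun i => ω (u τ i ^ k)) t (4 * (E * l)) (fun i => by
      have := (gm i).2
      simp only [map_pow, ueq]; omega)
    obtain ⟨s, hs, c1, k1, c2, k2, hgs⟩ := hv (XX (fun i => u τ i ^ k) δ (r τ)) (mem_biUnion τT ⟨δ, rfl⟩)
    refine ⟨τ, τT, s, hs, c1, k1, δ, fun i hi => ?_⟩
    set X := XX (fun i => u τ i ^ k) δ with hX
    set w := g s * c1 with hw
    have big : 4 * (4 * (E * l)) + 4 * (K * l + κ + E * l) + 2 * (3 * (E * l)) + 2 * (E * l) < k * m := by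
      have : l * (28 * E + 4 * K) ≤ C * m * (28 * E + 4 * K) := Nat.mul_le_mul_right _ hlm
      rw [hk]; nlinarith
    have Xs : ∀ i, ω (w * X (i + 1)) = ω (w * X i) * (bif δ i then ω (u τ i ^ k) else (ω (u τ i ^ k))⁻¹) := by
      intro i; simp only [hX, XX, map_mul]; cases δ i <;> simp [mul_assoc]
    have tb := fun s hs => hc.tube_bd (fun Z hZ => hK ω t l hl Z hZ (g s)) (hω s hs)
    have mv : ∀ a c, dd D t (ω c * t) ≤ E * l → gp D (ω a * t) m1 m2 ≤ K * l + κ → gp D (ω a * ω c * t) m1 m2 ≤ K * l + κ + E * l := by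
      intro a c hcc hh
      have sub : gps D (ω a * ω c * t) m1 m2 ⊆ gps D (ω a * t) m1 m2 ∪ sep D (ω a * (ω c * t)) (ω a * t) := by
        rintro Z ⟨z1, z2, z3, z4⟩
        by_cases q : ω a * t ∈ Z
        · exact Or.inl ⟨z1, q, z3, z4⟩
        · exact Or.inr ⟨z1, by rwa [← mul_assoc], q⟩
      refine (ncard_le_ncard sub ((hc.gps_fin _ _ _).union (hc.sep_fin _ _))).trans ((ncard_union_le _ _).trans (add_le_add hh ?_))
      change dd D _ _ ≤ _
      rw [Cut.dd_smul, Cut.dd_symm]; exact hcc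
    refine hc.count (fun i => ω (w * X i) * t) (r τ) i (k * m - 2 * (E * l)) (4 * (E * l)) (K * l + κ + E * l) (3 * (E * l)) hi
      (by omega) ?_ ?_ m1 m2 ?_ ?_ _ ?_ ?_
    · intro i _
      simp only [Xs]
      rw [Cut.dd_two, inv_mul_cancel_left]
      have := (gm i).1
      rw [← ueq, ← map_pow] at this
      cases δ i <;> simp only [cond_true, cond_false, Cut.dd_inv] <;> omega
    · intro i _
      have e3 := hδ i
      generalize hA : (bif δ i then ω (u τ i ^ k) else (ω (u τ i ^ k))⁻¹) = A at e3
      have x1 := Xs (i + 1)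
      rw [Xs i, hA] at x1
      have x0 := Xs i
      rw [hA] at x0
      generalize (bif δ (i + 1) then ω (u τ (i + 1) ^ k) else (ω (u τ (i + 1) ^ k))⁻¹) = B at e3 x1
      have f1 := hc.gp_formula t (A⁻¹ * t) (B * t)
      have f2 := hc.gp_formula (ω (w * X (i + 1)) * t) (ω (w * X i) * t) (ω (w * X (i + 2)) * t)
      rw [x1, x0, Cut.dd_two, Cut.dd_two, Cut.dd_two] at f2
      rw [Cut.dd_inv, Cut.dd_two] at f1
      show gp D (ω (w * X (i + 1)) * t) (ω (w * X i) * t) (ω (w * X (i + 2)) * t) ≤ _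
      rw [show i + 2 = i + 1 + 1 from rfl, x1, x0]
      rw [show (ω (w * X i) * A)⁻¹ * ω (w * X i) = A⁻¹ by group, show (ω (w * X i) * A)⁻¹ * (ω (w * X i) * A * B) = B by group,
        show (ω (w * X i))⁻¹ * (ω (w * X i) * A * B) = A * B by group, Cut.dd_inv] at f2
      rw [inv_inv] at f1
      omega
    · have := mv (g s) c1 (hE' c1 (Or.inl k1) ω t l hl) (tb s (show s < n from hs).le)
      simpa [hX, XX, hw] using this
    · have := mv (g (s + 1)) c2⁻¹ (by rw [map_inv, Cut.dd_inv]; exact hE' c2 (Or.inl k2) ω t l hl) (tb (s + 1) hs)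
      rw [hgs, ← map_mul] at this
      simpa [hw] using this
    · have : ω (w * X i * u τ i * (X i)⁻¹ * w⁻¹) * (ω (w * X i) * t) = ω (w * X i) * (ω (u τ i) * t) := by
        simp only [map_mul, map_inv]; group
      show dd D (ω (w * X i) * t) _ ≤ _
      rw [this, Cut.dd_smul]; exact ul i
    · have : ω (w * X i * u τ i * (X i)⁻¹ * w⁻¹) * (ω (w * X (i + 1)) * t) = ω (w * X (i + 1)) * (ω (u τ i) * t) := by
        rw [Xs i]
        cases δ i <;> simp only [map_mul, map_inv, map_pow, cond_true, cond_false] <;> group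
      show dd D (ω (w * X (i + 1)) * t) _ ≤ _
      rw [this, Cut.dd_smul]; exact ul i
  refine ⟨n, g, g0, hn, hg, fun m1 m2 => ⟨?_, ?_⟩⟩
  · have ff := hc.CC_fin m1 m2
    refine (fT.biUnion fun τ hτ => (finite_Iio n).biUnion fun s _ => fΦ.biUnion (t := fun c1 => {ω : G ≃* G | ∃ δ, ∀ i < r τ,
      ω (g s * c1 * XX (fun i => u τ i ^ k) δ i * u τ i * (XX (fun i => u τ i ^ k) δ i)⁻¹ * (g s * c1)⁻¹) ∈
        {H : G | ∃ Z ∈ SS D m1 m2, H • Z ∈ SS D m1 m2}}) fun c1 _ => ?_).subset (fun ω hω => ?_)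
    · obtain ⟨B, hB, hb⟩ := XX_det (u τ) k (r τ) (g s * c1) ff
      refine ((hfin τ hτ.2 B hB).preimage (f := fun ω => (MulAut.conj (g s * c1)).trans ω) ?_).subset ?_
      · intro a _ b _ hab
        ext x
        have := DFunLike.congr_fun hab ((MulAut.conj (g s * c1)).symm x)
        simpa using this
      · rintro ω ⟨δ, hω⟩ i hi
        exact hb ω δ hω i hi
    · obtain ⟨τ, hτ, s, hs, c1, h1, h2⟩ := main m1 m2 ω hω
      exact mem_biUnion hτ (mem_biUnion hs (mem_biUnion h1 h2))
  · rintro ω hω rfl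
    obtain ⟨τ, hτ, s, hs, c1, h1, δ, h2⟩ := main m1 m1 ω hω
    obtain ⟨Z, hZ, _⟩ := h2 0 (hr τ hτ.2)
    rcases hZ with hZ | hZ <;> exact hZ.2.2 hZ.2.1
end fl
section pack
variable {G : Type u} [Group G] {D : Set G}
def AS (A B : Set G) : Prop := (A \ B).Finite
lemma AS.of_sub {A B : Set G} (h : A ⊆ B) : AS A B := by rw [AS, diff_eq_empty.2 h]; exact finite_empty
lemma AS.trans {A B C : Set G} (h1 : AS A B) (h2 : AS B C) : AS A C :=
  (Set.Finite.union h1 h2).subset fun x hx => by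
    by_cases hb : x ∈ B
    · exact Or.inr ⟨hb, hx.2⟩
    · exact Or.inl ⟨hx.1, hb⟩
lemma AS.compl {A B : Set G} (h : AS A B) : AS Bᶜ Aᶜ := Set.Finite.subset h fun x hx => ⟨not_not.1 hx.2, hx.1⟩
lemma AS.image {A B : Set G} (h : AS A B) (ω : G ≃* G) : AS (ω '' A) (ω '' B) := by
  rw [AS, ← image_diff ω.injective]; exact Set.Finite.image _ h
lemma AS.mem {A B : Set G} {η : Ultrafilter G} (hη : (η : Filter G) ≤ Filter.cofinite) (h : AS A B) (ha : A ∈ η) : B ∈ η := by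
  have : (A \ B)ᶜ ∈ η := hη (by rw [Filter.mem_cofinite, compl_compl]; exact h)
  filter_upwards [this, ha] with x h1 h2
  by_contra hb; exact h1 ⟨h2, hb⟩
lemma uf_inf {A : Set G} {η : Ultrafilter G} (hη : (η : Filter G) ≤ Filter.cofinite) (ha : A ∈ η) : A.Infinite := by
  intro hf
  have := AS.mem hη (B := ∅) (by rw [AS, diff_empty]; exact hf) ha
  exact η.empty_notMem this
structure Pack (D : Set G) (γ : G) : Prop where
  sub : γ • D ⊆ D
  inf1 : (D \ γ • D).Infinite
  R : ∀ ω : G ≃* G, ∀ Z ∈ HH D, AS (ω '' (γ • D)) Zᶜ ∨ AS (ω '' (γ • D)) Z ∨ AS Z (ω '' D) ∨ AS Zᶜ (ω '' D)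
  b : ∀ p : G, ∀ H1 ∈ HH D, ∀ H2 ∈ HH D, {ω : G ≃* G | AS (ω '' (p • D)) H1 ∧ AS H2 (ω '' ((p * γ) • D))}.Finite
  S : ∀ ζ1 ζ1' ζ2 ζ2' : Ultrafilter G, (ζ1 : Filter G) ≤ Filter.cofinite → (ζ1' : Filter G) ≤ Filter.cofinite →
    (ζ2 : Filter G) ≤ Filter.cofinite → (ζ2' : Filter G) ≤ Filter.cofinite → (∃ Z ∈ HH D, Z ∈ ζ1 ∧ Z ∉ ζ1') → (∃ Z ∈ HH D, Z ∈ ζ2 ∧ Z ∉ ζ2') →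
    {ω : G ≃* G | (ω '' D)ᶜ ∈ ζ1 ∧ (ω '' D)ᶜ ∈ ζ1' ∧ ω '' (γ • D) ∈ ζ2 ∧ ω '' (γ • D) ∈ ζ2'}.Finite
  Sep : ∀ η η' : Ultrafilter G, (η : Filter G) ≤ Filter.cofinite → (η' : Filter G) ≤ Filter.cofinite → γ • D ∈ η → D ∉ η' →
    ∀ ω : G ≃* G, ∃ Z ∈ HH D, ω ⁻¹' Z ∈ η ∧ ω ⁻¹' Z ∉ η'
lemma thin_iff {ω : G ≃* G} {x : G} {Z : Set G} : Cut.Thin ω x D Z ↔ AS Z (ω '' (x • D))ᶜ ∨ AS Z (ω '' (x • D)) := by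
  have e1 : Z \ (ω '' (x • D))ᶜ = ω '' {g | g ∈ x • D ∧ ω g ∈ Z} := by
    ext z; simp only [mem_diff, mem_compl_iff, not_not, mem_image, mem_setOf_eq]
    constructor
    · rintro ⟨h, g, hg, rfl⟩; exact ⟨g, ⟨hg, h⟩, rfl⟩
    · rintro ⟨g, ⟨h1, h2⟩, rfl⟩; exact ⟨h2, g, h1, rfl⟩
  have e2 : Z \ (ω '' (x • D)) = ω '' {g | g ∉ x • D ∧ ω g ∈ Z} := by
    ext z; simp only [mem_diff, mem_image, mem_setOf_eq]
    constructor
    · rintro ⟨h, hg⟩; exact ⟨ω.symm z, ⟨fun hh => hg ⟨_, hh, by simp⟩, by simpa using h⟩, by simp⟩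
    · rintro ⟨g, ⟨h1, h2⟩, rfl⟩; exact ⟨h2, fun ⟨g', h3, e⟩ => h1 (ω.injective e ▸ h3)⟩
  unfold Cut.Thin AS
  rw [e1, e2, finite_image_iff ω.injective.injOn, finite_image_iff ω.injective.injOn]
lemma rep_cases {Y : Set G} (hY : Y ∈ HH D) : ∃ m : G, ∀ Z : Set G, (Z ⊂ m • D ∨ Z ⊂ (m • D)ᶜ) → Z ⊂ Y ∨ Z ⊂ Yᶜ := by
  obtain ⟨m, rfl | rfl⟩ := hY
  · exact ⟨m, fun Z h => h⟩
  · refine ⟨m, fun Z h => ?_⟩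
    rw [smul_set_compl, compl_compl]; exact h.symm
lemma ai_as (h : Cut D) (x p : G) : AS ((fun z => z * p) '' (x • D)) (x • D) := by
  refine ((h.aiH (Cut.HHD x) p).image (fun z => z * p)).subset ?_
  rintro _ ⟨⟨z, hz, rfl⟩, h2⟩
  exact ⟨z, ⟨hz, h2⟩, rfl⟩
lemma conj_as (h : Cut D) (p x : G) : AS (MulAut.conj p '' (x • D)) ((p * x) • D) ∧ AS ((p * x) • D) (MulAut.conj p '' (x • D)) := by
  have e : MulAut.conj p '' (x • D) = (fun z => z * p⁻¹) '' ((p * x) • D) := by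
    rw [mul_smul, ← image_smul (a := p), image_image]; rfl
  rw [e]
  refine ⟨ai_as h _ _, ?_⟩
  refine (((h.aiH (Cut.HHD (p * x)) p))).subset ?_
  rintro z ⟨h1, h2⟩
  exact ⟨h1, fun hh => h2 ⟨_, hh, by simp⟩⟩
lemma CutSys.k1 (h : CutSys D) : ∃ κ1 : ℕ, ∀ x : G, {Z | Z ∈ HH D ∧ x ∈ Z ∧ (AS Z (x • D)ᶜ ∨ AS Z (x • D))}.Finite ∧
    {Z | Z ∈ HH D ∧ x ∈ Z ∧ (AS Z (x • D)ᶜ ∨ AS Z (x • D))}.ncard ≤ κ1 := by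
  have fin : {Z | Z ∈ HH D ∧ 1 ∈ Z ∧ (AS Z Dᶜ ∨ AS Z D)}.Finite := by
    obtain ⟨K0, h0⟩ := h.toCut.adj
    obtain ⟨B, fB, -, hB⟩ := h0 1
    have f2 : {Z | Z ∈ HH D ∧ AS Z D ∧ AS D Z}.Finite := by
      refine (((h.t4 Cut.HHD1).image (fun x => x • D)).union ((h.compl.t4 (H := D) (by rw [Cut.HH_compl_eq]; exact Cut.HHD1)).image (fun x => x • Dᶜ))).subset ?_
      rintro Z ⟨⟨x, rfl | rfl⟩, h1, h2⟩
      · exact Or.inl ⟨x, ⟨h1, h2⟩, rfl⟩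
      · exact Or.inr ⟨x, ⟨h1, h2⟩, rfl⟩
    refine ((Cut.cpre fB).1.union ((Cut.cpre f2).1.union f2)).subset ?_
    rintro Z ⟨hZ, h1, h2⟩
    rcases hB Zᶜ (Cut.HHc hZ) (not_not.2 h1) with c | c | c
    · exact Or.inl c
    · rw [one_smul] at c
      have c' : Dᶜ ⊆ Z := compl_subset_comm.1 c.1
      rcases h2 with h2 | h2
      · exact Or.inr (Or.inl ⟨Cut.HHc hZ, AS.of_sub c.1, by simpa using h2.compl⟩)
      · exact absurd (h2.subset (fun z hz => ⟨c' hz, hz⟩)) h.cinf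
    · rw [one_smul] at c
      have c' : D ⊆ Z := compl_subset_compl.1 c.1
      rcases h2 with h2 | h2
      · exact absurd (h2.subset (fun z hz => ⟨c' hz, not_not.2 hz⟩)) h.inf
      · exact Or.inr (Or.inr ⟨hZ, h2, AS.of_sub c'⟩)
  refine ⟨{Z | Z ∈ HH D ∧ 1 ∈ Z ∧ (AS Z Dᶜ ∨ AS Z D)}.ncard, fun x => ?_⟩
  have := Cut.pre_ncard fin x⁻¹
  have e : {Z : Set G | x⁻¹ • Z ∈ {Z | Z ∈ HH D ∧ 1 ∈ Z ∧ (AS Z Dᶜ ∨ AS Z D)}} = {Z | Z ∈ HH D ∧ x ∈ Z ∧ (AS Z (x • D)ᶜ ∨ AS Z (x • D))} := by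
    have ee : ∀ Z W : Set G, AS (x⁻¹ • Z) W ↔ AS Z (x • W) := by
      intro Z W
      have : x⁻¹ • Z \ W = x⁻¹ • (Z \ x • W) := by rw [smul_set_sdiff]; simp
      unfold AS; rw [this, Set.finite_smul_set]
    ext Z
    simp only [mem_setOf_eq, Cut.HHs_iff, mem_sm, ee, smul_set_compl, inv_inv, mul_one]
  rw [e] at this
  exact ⟨this.1, this.2.le⟩
lemma CutSys.pack (h : CutSys D) {S : Finset G} (hS : Gen S) (h1S : 1 ∈ S) : ∃ γ, Pack D γ := by
  have hc := h.toCut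
  obtain ⟨y1, y2, s1, s2, dj⟩ := h.y
  obtain ⟨K0, hadj⟩ := hc.adj
  obtain ⟨κ1, hκ1⟩ := h.k1
  obtain ⟨n, g, g0, hn, hg, hFL⟩ := h.FL hS h1S (2 * K0 + 2 * κ1) dj
  have mono : ∀ a b, a ≤ b → b ≤ n → g b • D ⊆ g a • D := by
    intro a b hab
    induction b, hab using Nat.le_induction with
    | base => intro _; exact subset_rfl
    | succ b hab ih => intro hb; exact ((hg b (by omega)).trans (smul_set_mono s1)).trans (ih (by omega))
  have top : ∀ s ≤ n, g s • D ⊆ D := fun s hs => by simpa [g0] using mono 0 s (Nat.zero_le _) hs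
  have bot : ∀ s ≤ n, g n • D ⊆ g s • D := fun s hs => mono s n hs le_rfl
  have adj2 : ∀ m : G, ∃ B : Set (Set G), B.Finite ∧ B.ncard ≤ K0 ∧ ∀ Z ∈ HH D, m ∈ Z → Z ∈ B ∨ Zᶜ ⊂ m • D ∨ Zᶜ ⊂ (m • D)ᶜ := by
    intro m
    obtain ⟨B, fB, cB, hB⟩ := hadj m
    have := Cut.cpre fB
    exact ⟨_, this.1, this.2.le.trans cB, fun Z hZ hm => hB Zᶜ (Cut.HHc hZ) (not_not.2 hm)⟩
  have tube1 : ∀ (ω : G ≃* G) (m : G) (P : Set G → Prop), (∀ Z ∈ HH D, ∀ s ≤ n, Cut.Thin ω (g s) D Z → P Z) →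
      (∀ Z ∈ HH D, P Z → m ∈ Z → (Zᶜ ⊂ m • D ∨ Zᶜ ⊂ (m • D)ᶜ) → False) → False := by
    intro ω m P hP hno
    refine (hFL m m).2 ω (fun s hs => ?_) rfl
    obtain ⟨B, fB, cB, hB⟩ := adj2 m
    have sub : {Z | Z ∈ HH D ∧ m ∈ Z ∧ m ∈ Z ∧ Cut.Thin ω (g s) D Z} ⊆ B := by
      rintro Z ⟨a, b, _, c⟩
      exact (hB Z a b).resolve_right (hno Z a (hP Z a s hs c) b)
    exact ⟨fB.subset sub, (ncard_le_ncard sub fB).trans (by omega)⟩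
  refine ⟨g n, top n le_rfl, ?_, ?_, ?_, ?_, ?_⟩
  · refine (hc.infH (Cut.HHD y2)).mono ?_
    intro z hz
    refine ⟨s2 hz, fun hh => ?_⟩
    have : g n • D ⊆ y1 • D := by
      refine (bot 1 hn).trans ?_
      have := hg 0 hn
      simpa [g0] using this
    exact Set.disjoint_left.1 dj (this hh) hz
  · intro ω Z hZ
    by_contra! hno
    obtain ⟨n1, n2, n3, n4⟩ := hno
    obtain ⟨m, hm⟩ := rep_cases hZ
    have nt : ∀ Y, (Z ⊆ Y ∨ Zᶜ ⊆ Y) → ∀ s ≤ n, ¬ Cut.Thin ω (g s) D Y := by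
      intro Y hY s hs ht
      have i1 : AS (ω '' (g n • D)) (ω '' (g s • D)) := AS.of_sub (image_mono (bot s hs))
      have i2 : AS (ω '' (g s • D)) (ω '' D) := AS.of_sub (image_mono (top s hs))
      rw [thin_iff] at ht
      rcases hY with hY | hY <;> rcases ht with ht | ht
      · have := ((AS.of_sub hY).trans ht).compl
        rw [compl_compl] at this
        exact n1 (i1.trans this)
      · exact n3 (((AS.of_sub hY).trans ht).trans i2)
      · have := ((AS.of_sub hY).trans ht).compl
        rw [compl_compl, compl_compl] at this
        exact n2 (i1.trans this)
      · exact n4 (((AS.of_sub hY).trans ht).trans i2)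
    refine tube1 ω m (fun Y => ∃ s ≤ n, Cut.Thin ω (g s) D Y) (fun Y _ s hs ht => ⟨s, hs, ht⟩) ?_
    rintro Y hY ⟨s, hs, ht⟩ _ hh
    refine nt Y ?_ s hs ht
    rcases hm _ hh with c | c
    · exact Or.inr (compl_subset_comm.1 c.1)
    · exact Or.inl (compl_subset_compl.1 c.1)
  · intro p H1 hH1 H2 hH2
    obtain ⟨m1, e1⟩ := hH1
    obtain ⟨m2, e2⟩ := hH2
    refine ((hFL m1 m2).1.preimage (f := fun ω => (MulAut.conj p).trans ω) ?_).subset ?_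
    · intro a _ b _ hab
      ext x
      have := DFunLike.congr_fun hab ((MulAut.conj p).symm x)
      simpa [mul_assoc] using this
    · rintro ω ⟨a1, a2⟩ s hs
      show Cut.Tube D ((MulAut.conj p).trans ω) (g s) m1 m2 _
      have sub : {Z | Z ∈ HH D ∧ m1 ∈ Z ∧ m2 ∈ Z ∧ Cut.Thin ((MulAut.conj p).trans ω) (g s) D Z} ⊆
          {Z | Z ∈ HH D ∧ m1 ∈ Z ∧ (AS Z (m1 • D)ᶜ ∨ AS Z (m1 • D))} ∪ {Z | Z ∈ HH D ∧ m2 ∈ Z ∧ (AS Z (m2 • D)ᶜ ∨ AS Z (m2 • D))} := by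
        rintro Z ⟨z1, z2, z3, z4⟩
        have im : ((MulAut.conj p).trans ω : G ≃* G) '' (g s • D) = ω '' (MulAut.conj p '' (g s • D)) := by rw [image_image]; rfl
        have k1 : AS (ω '' (MulAut.conj p '' (g s • D))) H1 := by
          refine ((conj_as hc p (g s)).1.image ω).trans (AS.trans (AS.of_sub (image_mono ?_)) a1)
          rw [mul_smul]; exact smul_set_mono (top s hs)
        have k2 : AS H2 (ω '' (MulAut.conj p '' (g s • D))) := by
          refine a2.trans (AS.trans (AS.of_sub (image_mono ?_)) ((conj_as hc p (g s)).2.image ω))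
          rw [mul_smul, mul_smul]; exact smul_set_mono (bot s hs)
        rw [thin_iff, im] at z4
        rcases z4 with z4 | z4
        · right
          have := z4.trans k2.compl
          rcases e2 with rfl | rfl
          · exact ⟨z1, z3, Or.inl this⟩
          · rw [smul_set_compl, compl_compl] at this; exact ⟨z1, z3, Or.inr this⟩
        · left
          have := z4.trans k1
          rcases e1 with rfl | rfl
          · exact ⟨z1, z2, Or.inr this⟩
          · rw [smul_set_compl] at this; exact ⟨z1, z2, Or.inl this⟩
      have ff := (hκ1 m1).1.union (hκ1 m2).1
      have := (ncard_le_ncard sub ff).trans (ncard_union_le _ _)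
      have q1 := (hκ1 m1).2
      have q2 := (hκ1 m2).2
      exact ⟨ff.subset sub, by omega⟩
  · intro ζ1 ζ1' ζ2 ζ2' c1 c1' c2 c2' hs1 hs2
    have gen : ∀ ζ ζ' : Ultrafilter G, (∃ Z ∈ HH D, Z ∈ ζ ∧ Z ∉ ζ') → ∃ m : G, ∃ B : Set (Set G), B.Finite ∧ B.ncard ≤ K0 ∧
        ∀ Z ∈ HH D, m ∈ Z → Z ∉ ζ → Z ∉ ζ' → Z ∈ B := by
      rintro ζ ζ' ⟨Y, hY, y1, y2⟩
      obtain ⟨m, hm⟩ := rep_cases hY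
      obtain ⟨B, fB, cB, hB⟩ := adj2 m
      refine ⟨m, B, fB, cB, fun Z hZ hmZ z1 z2 => (hB Z hZ hmZ).resolve_right fun hh => ?_⟩
      rw [← Ultrafilter.compl_mem_iff_notMem] at z1 z2
      rcases hm _ hh with c | c
      · exact y2 (Filter.mem_of_superset z2 c.1)
      · exact (Ultrafilter.compl_mem_iff_notMem.1 (Filter.mem_of_superset z1 c.1)) y1
    obtain ⟨m1, B1, fB1, cB1, hB1⟩ := gen _ _ hs1
    obtain ⟨m2, B2, fB2, cB2, hB2⟩ := gen _ _ hs2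
    refine (hFL m1 m2).1.subset ?_
    rintro ω ⟨a1, a2, a3, a4⟩ s hs
    have sub : {Z | Z ∈ HH D ∧ m1 ∈ Z ∧ m2 ∈ Z ∧ Cut.Thin ω (g s) D Z} ⊆ B1 ∪ B2 := by
      rintro Z ⟨z1, z2, z3, z4⟩
      have i1 : AS (ω '' (g n • D)) (ω '' (g s • D)) := AS.of_sub (image_mono (bot s hs))
      have i2 : AS (ω '' (g s • D)) (ω '' D) := AS.of_sub (image_mono (top s hs))
      rw [thin_iff] at z4
      rcases z4 with z4 | z4
      · right
        have := z4.trans i1.compl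
        refine hB2 Z z1 z3 (fun hz => ?_) (fun hz => ?_)
        · exact Ultrafilter.compl_mem_iff_notMem.1 (this.mem c2 hz) a3
        · exact Ultrafilter.compl_mem_iff_notMem.1 (this.mem c2' hz) a4
      · left
        have := z4.trans i2
        refine hB1 Z z1 z2 (fun hz => ?_) (fun hz => ?_)
        · exact Ultrafilter.compl_mem_iff_notMem.1 a1 (this.mem c1 hz)
        · exact Ultrafilter.compl_mem_iff_notMem.1 a2 (this.mem c1' hz)
    exact ⟨(fB1.union fB2).subset sub, ((ncard_le_ncard sub (fB1.union fB2)).trans (ncard_union_le _ _)).trans (by omega)⟩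
  · intro η η' cη cη' h1 h2 ω
    by_contra! hno
    have hno' : ∀ Z ∈ HH D, ω ⁻¹' Z ∈ η → ω ⁻¹' Z ∈ η' := hno
    have hno2 : ∀ Z ∈ HH D, ω ⁻¹' Z ∉ η → ω ⁻¹' Zᶜ ∈ η := fun Z _ hz => by
      rw [preimage_compl]; exact Ultrafilter.compl_mem_iff_notMem.2 hz
    have inf : ∀ Z ∈ HH D, ω ⁻¹' Z ∈ η → ∀ s ≤ n, {x | x ∈ g s • D ∧ ω x ∈ Z}.Infinite ∧ {x | x ∉ g s • D ∧ ω x ∈ Z}.Infinite := by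
      intro Z hZ hz s hs
      refine ⟨uf_inf cη ?_, uf_inf cη' ?_⟩
      · filter_upwards [hz, h1] with x a b using ⟨bot s hs b, a⟩
      · filter_upwards [hno' Z hZ hz, Ultrafilter.compl_mem_iff_notMem.2 h2] with x a b using ⟨fun hh => b (top s hs hh), a⟩
    have nthin : ∀ Z ∈ HH D, ∀ s ≤ n, Cut.Thin ω (g s) D Z → ω ⁻¹' Z ∉ η := by
      intro Z hZ s hs ht hz
      obtain ⟨i1, i2⟩ := inf Z hZ hz s hs
      rcases ht with ht | ht
      · exact i1 ht
      · exact i2 ht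
    have two : ∀ Z Y : Set G, ω ⁻¹' Z ∈ η → ω ⁻¹' Y ∈ η → ¬ Disjoint Z Y := by
      intro Z Y a b hd
      refine η.empty_notMem ?_
      filter_upwards [a, b] with x a b using Set.disjoint_left.1 hd a b
    set T : Set (Set G) := {Z | Z ∈ HH D ∧ ω ⁻¹' Z ∈ η ∧ 1 ∉ Z} with hT
    have fT : T.Finite := by
      obtain ⟨K, hK⟩ := Cut.bbt hc hS
      have hb := hK ω 1 (S.sup fun σ => dd D 1 (ω σ * 1)) (fun σ hσ => Finset.le_sup (f := fun σ => dd D 1 (ω σ * 1)) hσ)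
      set M := K * S.sup fun σ => dd D 1 (ω σ * 1)
      by_contra hinf
      obtain ⟨F, hF, cF⟩ := Set.Infinite.exists_subset_card_eq hinf (M + 1)
      obtain ⟨Z, hZ, hmin⟩ := F.exists_minimal (Finset.card_pos.1 (by omega))
      obtain ⟨z1, z2, z3⟩ := hF hZ
      have := hb Z z1 (g 0) (by simpa using (inf Z z1 z2 0 (Nat.zero_le _)).1) (by simpa using (inf Z z1 z2 0 (Nat.zero_le _)).2)
      have sub : (F : Set (Set G)) ⊆ hts D Z (ω (g 0) * 1) := by
        intro Y hY
        obtain ⟨w1, w2, w3⟩ := hF hY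
        refine ⟨w1, ?_, by simpa [g0] using w3⟩
        rcases hc.nestH z1 w1 with c | c | c | c
        · exact c
        · exact hmin hY c
        · exact absurd c (two _ _ z2 w2)
        · exact absurd (c z3) w3
      have := ncard_le_ncard sub (hc.hts_fin z1 _)
      rw [ncard_coe_finset] at this
      omega
    rcases T.eq_empty_or_nonempty with he | hne
    · refine tube1 ω 1 (fun Z => ω ⁻¹' Z ∉ η) nthin ?_
      intro Z hZ z1 z2 _
      exact eq_empty_iff_forall_notMem.1 he Zᶜ ⟨Cut.HHc hZ, hno2 Z hZ z1, not_not.2 z2⟩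
    · obtain ⟨Y, ⟨y1, y2, y3⟩, hmin⟩ := fT.exists_minimal hne
      obtain ⟨m, hm⟩ := rep_cases y1
      refine tube1 ω m (fun Z => ω ⁻¹' Z ∉ η) nthin ?_
      intro Z hZ z1 z2 hh
      rcases hm _ hh with c | c
      · exact c.2 (hmin ⟨Cut.HHc hZ, hno2 Z hZ z1, fun q => y3 (c.1 q)⟩ c.1)
      · exact two _ _ (hno2 Z hZ z1) y2 (disjoint_compl_left.mono_left c.1)
end pack
section walls
variable {G : Type u} [Group G] {D : Set G} {γ : G}
structure WW (G : Type u) [Group G] where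
  o : MulAut G
  s : Bool
instance : MulAction (MulAut G) (WW G) where
  smul a w := ⟨a * w.o, w.s⟩
  one_smul w := by show (⟨1 * w.o, w.s⟩ : WW G) = w; rw [one_mul]
  mul_smul a b w := by show (⟨a * b * w.o, w.s⟩ : WW G) = ⟨a * (b * w.o), w.s⟩; rw [mul_assoc]
lemma WW.smul_def (a : MulAut G) (w : WW G) : a • w = ⟨a * w.o, w.s⟩ := rfl
def EE (D : Set G) (γ : G) (i : ℤ) : Set G := γ ^ i • D
def UU (D : Set G) (γ : G) (w : WW G) (i : ℤ) : Set G :=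
  if w.s then w.o '' EE D γ i else (w.o '' EE D γ (-i))ᶜ
def WW.flip (w : WW G) : WW G := ⟨w.o, !w.s⟩
lemma UU_flip (w : WW G) (i : ℤ) : UU D γ w.flip i = (UU D γ w (-i))ᶜ := by
  rcases w with ⟨o, s⟩
  cases s <;> simp [UU, WW.flip]
lemma UU_smul (a : MulAut G) (w : WW G) (i : ℤ) : UU D γ (a • w) i = a '' UU D γ w i := by
  rcases w with ⟨o, s⟩
  cases s <;> simp [UU, WW.smul_def, image_image, image_compl_eq a.bijective]
lemma Pack.Eanti (h : Pack D γ) {i j : ℤ} (hij : i ≤ j) : EE D γ j ⊆ EE D γ i := by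
  induction j, hij using Int.le_induction with
  | base => exact subset_rfl
  | succ j _ ih =>
    refine Subset.trans ?_ ih
    rw [EE, zpow_add_one, mul_smul]
    exact smul_set_mono h.sub
lemma Pack.Uanti (h : Pack D γ) (w : WW G) {i j : ℤ} (hij : i ≤ j) : UU D γ w j ⊆ UU D γ w i := by
  unfold UU
  split
  · exact image_mono (h.Eanti hij)
  · exact compl_subset_compl.2 (image_mono (h.Eanti (by omega)))
lemma AS.imgE {A B : Set G} (h : AS A B) (f : G ≃ G) : AS (f '' A) (f '' B) := by
  rw [AS, ← image_diff f.injective]; exact Set.Finite.image _ h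
lemma UU_HH (w : WW G) (j : ℤ) : ∃ Z ∈ HH D, UU D γ w j = w.o '' Z := by
  unfold UU
  split
  · exact ⟨_, Cut.HHD _, rfl⟩
  · exact ⟨(γ ^ (-j) • D)ᶜ, Cut.HHc (Cut.HHD _), by rw [image_compl_eq w.o.bijective]; rfl⟩
lemma Pack.Rp (h : Pack D γ) (ω β : MulAut G) (i : ℤ) {Z : Set G} (hZ : Z ∈ HH D) :
    AS (ω '' EE D γ (i + 1)) (β '' Z)ᶜ ∨ AS (ω '' EE D γ (i + 1)) (β '' Z) ∨ AS (β '' Z) (ω '' EE D γ i) ∨ AS (β '' Z)ᶜ (ω '' EE D γ i) := by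
  set f : G ≃ G := (Equiv.mulLeft (β⁻¹ (ω (γ ^ i)))).trans β.toEquiv with hf
  have fx : ∀ x, f x = β (β⁻¹ (ω (γ ^ i)) * x) := fun x => rfl
  have e : ∀ Y : Set G, f '' ((β⁻¹ * ω) '' Y) = ω '' (γ ^ i • Y) := by
    intro Y
    rw [← image_smul, image_image, image_image]
    refine image_congr fun y _ => ?_
    simp [fx, map_mul]
  have e2 : f '' ((β⁻¹ (ω (γ ^ i)))⁻¹ • Z) = β '' Z := by
    rw [← image_smul, image_image]
    refine image_congr fun y _ => ?_
    simp [fx]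
  have e3 : f '' ((β⁻¹ (ω (γ ^ i)))⁻¹ • Z)ᶜ = (β '' Z)ᶜ := by rw [image_compl_eq f.bijective, e2]
  have E1 : EE D γ (i + 1) = γ ^ i • γ • D := by rw [EE, zpow_add_one, mul_smul]
  rw [E1, EE, ← e D, ← e (γ • D), ← e3, ← e2]
  rcases h.R (β⁻¹ * ω) _ (Cut.HHs ((β⁻¹ (ω (γ ^ i)))⁻¹) hZ) with c | c | c | c
  · exact Or.inl (c.imgE f)
  · exact Or.inr (Or.inl (c.imgE f))
  · exact Or.inr (Or.inr (Or.inl (c.imgE f)))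
  · exact Or.inr (Or.inr (Or.inr (c.imgE f)))
lemma Pack.Rg (h : Pack D γ) (a b : WW G) (i j : ℤ) :
    AS (UU D γ a (i + 1)) (UU D γ b j)ᶜ ∨ AS (UU D γ a (i + 1)) (UU D γ b j) ∨ AS (UU D γ b j) (UU D γ a i) ∨ AS (UU D γ b j)ᶜ (UU D γ a i) := by
  obtain ⟨Z, hZ, e⟩ := UU_HH (D := D) (γ := γ) b j
  rw [e]
  rcases a with ⟨o, s⟩
  cases s
  · simp only [UU, Bool.false_eq_true, if_false]
    have := h.Rp o b.o (-(i + 1)) hZ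
    rw [show -(i + 1) + 1 = -i by ring] at this
    rcases this with c | c | c | c
    · right; right; left; simpa using c.compl
    · right; right; right; exact c.compl
    · left; exact c.compl
    · right; left; simpa using c.compl
  · simp only [UU, if_true]
    exact h.Rp o b.o i hZ
structure Uf (D : Set G) (γ : G) (η : Fin 3 → Ultrafilter G) : Prop where
  cof : ∀ k, (η k : Filter G) ≤ Filter.cofinite
  h0 : EE D γ (-4) ∉ η 0
  h1 : EE D γ 4 ∈ η 1
  h2 : EE D γ 0 ∈ η 2
  h3 : EE D γ 1 ∉ η 2
lemma exUf {s : Set G} (hs : s.Infinite) : ∃ η : Ultrafilter G, (η : Filter G) ≤ Filter.cofinite ∧ s ∈ η := by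
  have : (Filter.cofinite ⊓ Filter.principal s).NeBot := Filter.cofinite_inf_principal_neBot_iff.2 hs
  refine ⟨Ultrafilter.of (Filter.cofinite ⊓ Filter.principal s), (Ultrafilter.of_le _).trans inf_le_left, ?_⟩
  exact (Ultrafilter.of_le _).trans inf_le_right (Filter.mem_principal_self s)
lemma exists_Uf (hc : Cut D) (h : Pack D γ) : ∃ η, Uf D γ η := by
  obtain ⟨e0, c0, m0⟩ := exUf (hc.infH (Cut.HHc (Cut.HHD (γ ^ (-4 : ℤ)))))
  obtain ⟨e1, c1, m1⟩ := exUf (hc.infH (Cut.HHD (γ ^ (4 : ℤ))))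
  obtain ⟨e2, c2, m2⟩ := exUf h.inf1
  refine ⟨![e0, e1, e2], ?_, Ultrafilter.compl_mem_iff_notMem.1 m0, m1, ?_, ?_⟩
  · intro k; fin_cases k
    · exact c0
    · exact c1
    · exact c2
  · show EE D γ 0 ∈ e2
    rw [EE, zpow_zero, one_smul]
    exact Filter.mem_of_superset m2 diff_subset
  · show EE D γ 1 ∉ e2
    rw [EE, zpow_one, ← Ultrafilter.compl_mem_iff_notMem]
    exact Filter.mem_of_superset m2 (fun x hx => hx.2)
def two (P : Fin 3 → Prop) : Prop := ∃ k l, k ≠ l ∧ P k ∧ P l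
lemma two.mono {P Q : Fin 3 → Prop} (h : ∀ k, P k → Q k) : two P → two Q := fun ⟨k, l, n, a, b⟩ => ⟨k, l, n, h _ a, h _ b⟩
lemma two.inter {P Q : Fin 3 → Prop} : two P → two Q → ∃ k, P k ∧ Q k := by
  rintro ⟨k, l, n, a, b⟩ ⟨k', l', n', a', b'⟩
  have : ∀ k l k' l' : Fin 3, k ≠ l → k' ≠ l' → k = k' ∨ k = l' ∨ l = k' ∨ l = l' := by decide
  rcases this k l k' l' n n' with rfl | rfl | rfl | rfl
  exacts [⟨_, a, a'⟩, ⟨_, a, b'⟩, ⟨_, b, a'⟩, ⟨_, b, b'⟩]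
lemma two.or {P Q : Fin 3 → Prop} (h : ∀ k, P k ∨ Q k) : two P ∨ two Q := by
  rcases h 0 with a | a <;> rcases h 1 with b | b <;> rcases h 2 with c | c
  · exact Or.inl ⟨0, 1, by decide, a, b⟩
  · exact Or.inl ⟨0, 1, by decide, a, b⟩
  · exact Or.inl ⟨0, 2, by decide, a, c⟩
  · exact Or.inr ⟨1, 2, by decide, b, c⟩
  · exact Or.inl ⟨1, 2, by decide, b, c⟩
  · exact Or.inr ⟨0, 2, by decide, a, c⟩
  · exact Or.inr ⟨0, 1, by decide, a, b⟩
  · exact Or.inr ⟨0, 1, by decide, a, b⟩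
variable {η : Fin 3 → Ultrafilter G}
lemma map_cof {e : Ultrafilter G} (h : (e : Filter G) ≤ Filter.cofinite) (x : MulAut G) : (e.map x : Filter G) ≤ Filter.cofinite :=
  (Filter.map_mono h).trans x.injective.tendsto_cofinite
lemma img_mem {e : Ultrafilter G} (x : MulAut G) {A : Set G} : x '' A ∈ e.map x ↔ A ∈ e := by
  rw [Ultrafilter.mem_map, preimage_image_eq _ x.injective]
lemma smul_mem {e : Ultrafilter G} (a x : MulAut G) (w : WW G) (i : ℤ) : UU D γ (a • w) i ∈ e.map (a • x : MulAut G) ↔ UU D γ w i ∈ e.map x := by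
  rw [UU_smul, Ultrafilter.mem_map, Ultrafilter.mem_map]
  have : (⇑(a • x : MulAut G)) ⁻¹' (a '' UU D γ w i) = x ⁻¹' UU D γ w i := by
    ext z; simp [smul_eq_mul]
  rw [this]
def wneg (D : Set G) (γ : G) (η : Fin 3 → Ultrafilter G) (w : WW G) : Set (MulAut G) := {a | two fun k => UU D γ w (-4) ∉ (η k).map a}
def wpos (D : Set G) (γ : G) (η : Fin 3 → Ultrafilter G) (w : WW G) : Set (MulAut G) := {a | two fun k => UU D γ w 4 ∈ (η k).map a}
def wlt (D : Set G) (γ : G) (a b : WW G) : Prop := AS (UU D γ b (-1)) (UU D γ a 4) ∧ AS (UU D γ b (-4)) (UU D γ a 1)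
lemma wflip (w : WW G) : wneg D γ η w.flip = wpos D γ η w := by
  ext a
  simp only [wneg, wpos, UU_flip, mem_setOf_eq, Ultrafilter.compl_notMem_iff, neg_neg]
lemma AS.smul_iff (a : MulAut G) {w w' : WW G} {i j : ℤ} : AS (UU D γ (a • w) i) (UU D γ (a • w') j) ↔ AS (UU D γ w i) (UU D γ w' j) := by
  have key : ∀ (a : MulAut G) (w w' : WW G), AS (UU D γ w i) (UU D γ w' j) → AS (UU D γ (a • w) i) (UU D γ (a • w') j) := by
    intro a w w' h; rw [UU_smul, UU_smul]; exact h.image a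
  refine ⟨fun h => ?_, key a w w'⟩
  have := key a⁻¹ _ _ h
  rwa [inv_smul_smul, inv_smul_smul] at this
lemma pw1 (h : Pack D γ) (hη : Uf D γ η) (w : WW G) : two fun k => UU D γ w (-1) ∈ (η k).map w.o := by
  rcases w with ⟨o, s⟩
  cases s
  · refine ⟨0, 2, by decide, ?_, ?_⟩ <;>
      simp only [UU, Bool.false_eq_true, if_false, neg_neg, Ultrafilter.compl_mem_iff_notMem, img_mem]
    · exact fun hh => hη.h0 (Filter.mem_of_superset hh (h.Eanti (by norm_num)))
    · exact hη.h3
  · refine ⟨1, 2, by decide, ?_, ?_⟩ <;> simp only [UU, if_true, img_mem]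
    · exact Filter.mem_of_superset hη.h1 (h.Eanti (by norm_num))
    · exact Filter.mem_of_superset hη.h2 (h.Eanti (by norm_num))
lemma pw2 (h : Pack D γ) (hη : Uf D γ η) (w : WW G) : two fun k => UU D γ w 1 ∉ (η k).map w.o := by
  have := pw1 h hη w.flip
  simp only [UU_flip, neg_neg, Ultrafilter.compl_mem_iff_notMem] at this
  exact this
lemma sepE (h : Pack D γ) (hη : Uf D γ η) {k l : Fin 3} (hkl : k ≠ l) : ∃ i : ℤ, -1 ≤ i ∧ i ≤ 1 ∧
    ((EE D γ (i + 1) ∈ η k ∧ EE D γ i ∉ η l) ∨ (EE D γ (i + 1) ∈ η l ∧ EE D γ i ∉ η k)) := by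
  have a10 : EE D γ (0 + 1) ∈ η 1 ∧ EE D γ 0 ∉ η 0 :=
    ⟨Filter.mem_of_superset hη.h1 (h.Eanti (by norm_num)), fun hh => hη.h0 (Filter.mem_of_superset hh (h.Eanti (by norm_num)))⟩
  have a20 : EE D γ (-1 + 1) ∈ η 2 ∧ EE D γ (-1) ∉ η 0 :=
    ⟨hη.h2, fun hh => hη.h0 (Filter.mem_of_superset hh (h.Eanti (by norm_num)))⟩
  have a12 : EE D γ (1 + 1) ∈ η 1 ∧ EE D γ 1 ∉ η 2 := ⟨Filter.mem_of_superset hη.h1 (h.Eanti (by norm_num)), hη.h3⟩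
  fin_cases k <;> fin_cases l <;> simp at hkl
  · exact ⟨0, by norm_num, by norm_num, Or.inr a10⟩
  · exact ⟨-1, by norm_num, by norm_num, Or.inr a20⟩
  · exact ⟨0, by norm_num, by norm_num, Or.inl a10⟩
  · exact ⟨1, by norm_num, by norm_num, Or.inl a12⟩
  · exact ⟨-1, by norm_num, by norm_num, Or.inl a20⟩
  · exact ⟨1, by norm_num, by norm_num, Or.inr a12⟩
lemma sepU (h : Pack D γ) (hη : Uf D γ η) {k l : Fin 3} (hkl : k ≠ l) (w : WW G) : ∃ i : ℤ, -4 ≤ i ∧ i ≤ 4 ∧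
    ((UU D γ w i ∈ (η k).map w.o ∧ UU D γ w i ∉ (η l).map w.o) ∨ (UU D γ w i ∈ (η l).map w.o ∧ UU D γ w i ∉ (η k).map w.o)) := by
  obtain ⟨i, i1, i2, hh⟩ := sepE h hη hkl
  have hh' : (EE D γ i ∈ η k ∧ EE D γ i ∉ η l) ∨ (EE D γ i ∈ η l ∧ EE D γ i ∉ η k) :=
    hh.imp (fun c => ⟨Filter.mem_of_superset c.1 (h.Eanti (by omega)), c.2⟩) (fun c => ⟨Filter.mem_of_superset c.1 (h.Eanti (by omega)), c.2⟩)
  rcases w with ⟨o, s⟩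
  cases s
  · refine ⟨-i, by omega, by omega, ?_⟩
    simp only [UU, Bool.false_eq_true, if_false, neg_neg, Ultrafilter.compl_mem_iff_notMem, img_mem, not_not]
    tauto
  · refine ⟨i, by omega, by omega, ?_⟩
    simpa only [UU, if_true, img_mem] using hh'
lemma sepH (h : Pack D γ) (hη : Uf D γ η) {k l : Fin 3} (hkl : k ≠ l) (x : MulAut G) : ∃ Z ∈ HH D, Z ∈ (η k).map x ∧ Z ∉ (η l).map x := by
  have key : ∀ (e e' : Ultrafilter G), (e : Filter G) ≤ Filter.cofinite → (e' : Filter G) ≤ Filter.cofinite → ∀ i : ℤ, EE D γ (i + 1) ∈ e → EE D γ i ∉ e' →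
      ∃ Z ∈ HH D, Z ∈ e.map x ∧ Z ∉ e'.map x := by
    intro e e' ce ce' i h1 h2
    have inj : Function.Injective (fun g : G => (γ ^ i)⁻¹ * g) := mul_right_injective _
    have pre : ∀ Y : Set G, (fun g : G => (γ ^ i)⁻¹ * g) ⁻¹' Y = γ ^ i • Y := fun Y => by
      ext z; rw [mem_sm]; rfl
    obtain ⟨Z, hZ, z1, z2⟩ := h.Sep (e.map fun g => (γ ^ i)⁻¹ * g) (e'.map fun g => (γ ^ i)⁻¹ * g)
      ((Filter.map_mono ce).trans inj.tendsto_cofinite) ((Filter.map_mono ce').trans inj.tendsto_cofinite)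
      (by rw [Ultrafilter.mem_map, pre, ← mul_smul, ← zpow_add_one]; exact h1) (by rw [Ultrafilter.mem_map, pre]; exact h2) x
    have pp : (fun g : G => (γ ^ i)⁻¹ * g) ⁻¹' (x ⁻¹' Z) = x ⁻¹' (x (γ ^ i) • Z) := by
      ext z; simp [mem_sm]
    rw [Ultrafilter.mem_map, pp] at z1 z2
    exact ⟨x (γ ^ i) • Z, Cut.HHs _ hZ, z1, z2⟩
  obtain ⟨i, -, -, c | c⟩ := sepE h hη hkl
  · exact key _ _ (hη.cof _) (hη.cof _) i c.1 c.2
  · obtain ⟨Z, hZ, z1, z2⟩ := key _ _ (hη.cof _) (hη.cof _) i c.1 c.2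
    exact ⟨Zᶜ, Cut.HHc hZ, Ultrafilter.compl_mem_iff_notMem.2 z2, fun hh => Ultrafilter.compl_mem_iff_notMem.1 hh z1⟩
lemma finW {S : Set (WW G)} (h : ∀ t, {ω : MulAut G | (⟨ω, t⟩ : WW G) ∈ S}.Finite) : S.Finite := by
  refine (((h true).image fun ω => (⟨ω, true⟩ : WW G)).union ((h false).image fun ω => (⟨ω, false⟩ : WW G))).subset ?_
  rintro ⟨ω, t⟩ hw
  cases t
  · exact Or.inr ⟨ω, hw, rfl⟩
  · exact Or.inl ⟨ω, hw, rfl⟩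
lemma fin5 (h : Pack D γ) (hη : Uf D γ η) (x y : MulAut G) : {w | x ∈ wneg D γ η w ∧ y ∈ wpos D γ η w}.Finite := by
  have fS : ∀ (x y : MulAut G), {ω : MulAut G | (two fun k => ω '' EE D γ (-4) ∉ (η k).map x) ∧ (two fun k => ω '' EE D γ 4 ∈ (η k).map y)}.Finite := by
    intro x y
    have : (⋃ q : {q : (Fin 3 × Fin 3) × (Fin 3 × Fin 3) // q.1.1 ≠ q.1.2 ∧ q.2.1 ≠ q.2.2},
        {ω : G ≃* G | (ω '' D)ᶜ ∈ (η q.1.1.1).map x ∧ (ω '' D)ᶜ ∈ (η q.1.1.2).map x ∧ ω '' (γ • D) ∈ (η q.1.2.1).map y ∧ ω '' (γ • D) ∈ (η q.1.2.2).map y}).Finite := by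
      refine Set.finite_iUnion fun q => ?_
      exact h.S _ _ _ _ (map_cof (hη.cof _) x) (map_cof (hη.cof _) x) (map_cof (hη.cof _) y) (map_cof (hη.cof _) y)
        (sepH h hη q.2.1 x) (sepH h hη q.2.2 y)
    refine this.subset ?_
    rintro ω ⟨⟨k, l, n, a, b⟩, ⟨k', l', n', a', b'⟩⟩
    have s1 : D ⊆ EE D γ (-4) := by
      have := h.Eanti (i := -4) (j := 0) (by norm_num)
      rwa [EE, zpow_zero, one_smul] at this
    have s2 : EE D γ 4 ⊆ γ • D := by
      have := h.Eanti (i := 1) (j := 4) (by norm_num)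
      rwa [EE, EE, zpow_one] at this
    rw [mem_iUnion]
    refine ⟨⟨((k, l), (k', l')), n, n'⟩, ?_, ?_, Filter.mem_of_superset a' (image_mono s2), Filter.mem_of_superset b' (image_mono s2)⟩
    · exact Ultrafilter.compl_mem_iff_notMem.2 fun hh => a (Filter.mem_of_superset hh (image_mono s1))
    · exact Ultrafilter.compl_mem_iff_notMem.2 fun hh => b (Filter.mem_of_superset hh (image_mono s1))
  refine finW fun t => ?_
  cases t
  · refine (fS y x).subset ?_
    rintro ω ⟨h1, h2⟩
    refine ⟨h2.mono fun k hk => ?_, h1.mono fun k hk => ?_⟩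
    · simpa only [UU, Bool.false_eq_true, if_false, Ultrafilter.compl_mem_iff_notMem] using hk
    · simpa only [UU, Bool.false_eq_true, if_false, Ultrafilter.compl_notMem_iff, neg_neg] using hk
  · exact fS x y
lemma E0 (h : Pack D γ) (a : WW G) (ha : a.o = 1) (i i' j : ℤ) :
    {b | AS (UU D γ b j) (UU D γ a i) ∧ AS (UU D γ a i') (UU D γ b (j + 1))}.Finite := by
  have hU : ∀ i, UU D γ a i ∈ HH D := fun i => by
    obtain ⟨Z, hZ, e⟩ := UU_HH (D := D) (γ := γ) a i
    rw [e, ha]; simpa using hZ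
  refine finW fun t => ?_
  cases t
  · refine (h.b (γ ^ (-(j + 1))) _ (Cut.HHc (hU i')) _ (Cut.HHc (hU i))).subset ?_
    rintro ω ⟨h1, h2⟩
    simp only [UU, Bool.false_eq_true, if_false] at h1 h2
    have h1 := h1.compl
    have h2 := h2.compl
    rw [compl_compl] at h1 h2
    refine ⟨h2, ?_⟩
    rw [← zpow_add_one, show -(j + 1) + 1 = -j by ring]; exact h1
  · refine (h.b (γ ^ j) _ (hU i) _ (hU i')).subset ?_
    rintro ω ⟨h1, h2⟩
    refine ⟨h1, ?_⟩
    rw [← zpow_add_one]; exact h2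
lemma E2 (h : Pack D γ) (a : WW G) (ha : a.o = 1) (i j j' : ℤ) :
    {b | AS (UU D γ a i) (UU D γ b j) ∧ AS (UU D γ b j') (UU D γ a (i + 1))}.Finite := by
  refine finW fun t => ?_
  refine ((E0 h ⟨1, t⟩ rfl j j' i).preimage (f := fun ω : MulAut G => ω⁻¹ • a) ?_).subset ?_
  · intro x _ y _ hxy
    have := congrArg WW.o hxy
    simpa [WW.smul_def, ha] using this
  · rintro ω ⟨h1, h2⟩
    have e : (⟨1, t⟩ : WW G) = ω⁻¹ • (⟨ω, t⟩ : WW G) := by simp [WW.smul_def]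
    show AS (UU D γ (ω⁻¹ • a) i) (UU D γ ⟨1, t⟩ j) ∧ AS (UU D γ ⟨1, t⟩ j') (UU D γ (ω⁻¹ • a) (i + 1))
    rw [e, AS.smul_iff, AS.smul_iff]
    exact ⟨h1, h2⟩
def inc (D : Set G) (γ : G) (η : Fin 3 → Ultrafilter G) (a : WW G) : Set (WW G) :=
  {b | (∃ x y, (x ∈ wneg D γ η a ∧ y ∈ wpos D γ η a) ∧ (x ∈ wneg D γ η b ∧ y ∈ wpos D γ η b)) ∧ ¬ wlt D γ a b ∧ ¬ wlt D γ b a}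
lemma F1 (h : Pack D γ) (hη : Uf D γ η) {a b : WW G} {x y : MulAut G} (xa : x ∈ wneg D γ η a) (ya : y ∈ wpos D γ η a)
    (xb : x ∈ wneg D γ η b) (yb : y ∈ wpos D γ η b) (i j : ℤ) (i1 : -4 ≤ i) (i2 : i + 1 ≤ 4) (j1 : -4 ≤ j) (j2 : j ≤ 4) :
    AS (UU D γ b j) (UU D γ a i) ∨ AS (UU D γ a (i + 1)) (UU D γ b j) := by
  obtain ⟨k, k1, k2⟩ := two.inter xa xb
  obtain ⟨l, l1, l2⟩ := two.inter ya yb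
  rcases h.Rg a b i j with c | c | c | c
  · exfalso
    have := c.mem (map_cof (hη.cof l) y) (Filter.mem_of_superset l1 (h.Uanti a i2))
    exact Ultrafilter.compl_mem_iff_notMem.1 this (Filter.mem_of_superset l2 (h.Uanti b j2))
  · exact Or.inr c
  · exact Or.inl c
  · exfalso
    have := c.mem (map_cof (hη.cof k) x) (Ultrafilter.compl_mem_iff_notMem.2 fun hh => k2 (Filter.mem_of_superset hh (h.Uanti b j1)))
    exact k1 (Filter.mem_of_superset this (h.Uanti a i1))
lemma inc_fin1 (h : Pack D γ) (hη : Uf D γ η) (a : WW G) (ha : a.o = 1) : (inc D γ η a).Finite := by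
  refine ((E0 h a ha (-4) 4 (-4)).union ((E0 h a ha 3 4 (-3)).union ((E0 h a ha (-4) (-1) 2).union
    ((E2 h a ha 2 (-4) (-3)).union ((E2 h a ha (-3) (-4) 3).union (E2 h a ha (-3) (-4) 4)))))).subset ?_
  rintro b ⟨⟨x, y, ⟨xa, ya⟩, ⟨xb, yb⟩⟩, n1, n2⟩
  have f1 := F1 h hη xa ya xb yb
  have f2 := F1 h hη xb yb xa ya
  by_contra hno
  simp only [mem_union, mem_setOf_eq, not_or, not_and] at hno
  norm_num at hno
  obtain ⟨g1, g2, g3, g4, g5, g6⟩ := hno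
  have q1 := f1 (-4) (-4) (by norm_num) (by norm_num) (by norm_num) (by norm_num)
  have q2 := f1 3 (-3) (by norm_num) (by norm_num) (by norm_num) (by norm_num)
  have q3 := f2 (-2) 4 (by norm_num) (by norm_num) (by norm_num) (by norm_num)
  have q4 := f1 1 (-4) (by norm_num) (by norm_num) (by norm_num) (by norm_num)
  have q5 := f1 (-2) 3 (by norm_num) (by norm_num) (by norm_num) (by norm_num)
  have q6 := f1 (-2) 4 (by norm_num) (by norm_num) (by norm_num) (by norm_num)
  have q7 := f2 1 (-4) (by norm_num) (by norm_num) (by norm_num) (by norm_num)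
  norm_num at q1 q2 q3 q4 q5 q6 q7
  rcases q1 with c | c
  · have p := q2.resolve_right (g1 c)
    exact n1 ⟨q3.resolve_left (g2 p), q4.resolve_right fun hh => g4 hh p⟩
  · exact n2 ⟨q6.resolve_left (g6 c), q7.resolve_right fun hh => g3 hh (q5.resolve_left (g5 c))⟩
lemma wneg_smul (a : MulAut G) (w : WW G) (x : MulAut G) : a • x ∈ wneg D γ η (a • w) ↔ x ∈ wneg D γ η w := by
  simp only [wneg, mem_setOf_eq, smul_mem]
lemma wpos_smul (a : MulAut G) (w : WW G) (x : MulAut G) : a • x ∈ wpos D γ η (a • w) ↔ x ∈ wpos D γ η w := by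
  simp only [wpos, mem_setOf_eq, smul_mem]
lemma wlt_smul (a : MulAut G) (w w' : WW G) : wlt D γ (a • w) (a • w') ↔ wlt D γ w w' := by
  simp only [wlt, AS.smul_iff]
lemma inc_sub (a : WW G) : inc D γ η a ⊆ (fun w => a.o • w) '' inc D γ η ⟨1, a.s⟩ := by
  rintro b ⟨⟨x, y, ⟨xa, ya⟩, ⟨xb, yb⟩⟩, n1, n2⟩
  have e : (⟨1, a.s⟩ : WW G) = a.o⁻¹ • a := by rcases a with ⟨o, s⟩; simp [WW.smul_def]
  refine ⟨a.o⁻¹ • b, ⟨⟨a.o⁻¹ • x, a.o⁻¹ • y, ?_, ?_⟩, ?_, ?_⟩, by simp⟩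
  · rw [e, wneg_smul, wpos_smul]; exact ⟨xa, ya⟩
  · rw [wneg_smul, wpos_smul]; exact ⟨xb, yb⟩
  · rw [e, wlt_smul]; exact n1
  · rw [e, wlt_smul]; exact n2
lemma ax7 (h : Pack D γ) (hη : Uf D γ η) (w : WW G) (x y : MulAut G) (c : WW G) (xw : x ∈ wneg D γ η w) (yw : y ∈ wpos D γ η w)
    (xc : x ∈ wneg D γ η c) (yc : y ∈ wneg D γ η c) : w.o ∉ wpos D γ η c := by
  rintro ⟨k, l, n, hk, hl⟩
  obtain ⟨p, p1, p2⟩ := two.inter xw xc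
  obtain ⟨q, q1, q2⟩ := two.inter yw yc
  have key : ∀ k l i, -4 ≤ i → i ≤ 4 → UU D γ c 4 ∈ (η k).map w.o → UU D γ c 4 ∈ (η l).map w.o → UU D γ w i ∈ (η k).map w.o → UU D γ w i ∉ (η l).map w.o → False := by
    intro k l i i1 i2 hk hl h1 h2
    rcases h.Rg c w 3 i with r | r | r | r
    · exact Ultrafilter.compl_mem_iff_notMem.1 (r.mem (map_cof (hη.cof _) _) hk) h1
    · exact h2 (r.mem (map_cof (hη.cof _) _) hl)
    · have := r.mem (map_cof (hη.cof _) _) (Filter.mem_of_superset q1 (h.Uanti w i2))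
      exact q2 (Filter.mem_of_superset this (h.Uanti c (by norm_num)))
    · have := r.mem (map_cof (hη.cof _) _) (Ultrafilter.compl_mem_iff_notMem.2 fun hh => p1 (Filter.mem_of_superset hh (h.Uanti w i1)))
      exact p2 (Filter.mem_of_superset this (h.Uanti c (by norm_num)))
  obtain ⟨i, i1, i2, r | r⟩ := sepU h hη n w
  · exact key k l i i1 i2 hk hl r.1 r.2
  · exact key l k i i1 i2 hl hk r.1 r.2
lemma Einf (h : Pack D γ) {i j : ℤ} (hij : i < j) : ¬ AS (EE D γ i) (EE D γ j) := by
  intro hf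
  have : (γ ^ i • (D \ γ • D)).Finite := by
    refine Set.Finite.subset hf ?_
    rw [smul_set_sdiff, ← mul_smul, ← zpow_add_one]
    exact diff_subset_diff_right (h.Eanti (by omega))
  exact h.inf1 (Set.finite_smul_set.1 this)
lemma Uinf (h : Pack D γ) (w : WW G) {i j : ℤ} (hij : i < j) : ¬ AS (UU D γ w i) (UU D γ w j) := by
  have key : ∀ (o : MulAut G) {i j : ℤ}, i < j → ¬ AS (o '' EE D γ i) (o '' EE D γ j) := by
    intro o i j hij hf
    have := hf.image o⁻¹
    rw [image_image, image_image] at this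
    simp only [MulAut.inv_apply_self, image_id'] at this
    exact Einf h hij this
  intro hf
  unfold UU at hf
  split at hf
  · exact key _ hij hf
  · have := hf.compl
    rw [compl_compl, compl_compl] at this
    exact key _ (by omega) this
def wallSys (h : Pack D γ) (hη : Uf D γ η) : WallSys (MulAut G) (MulAut G) (WW G) where
  neg := wneg D γ η
  pos := wpos D γ η
  flip := WW.flip
  lt := wlt D γ
  B := (inc D γ η ⟨1, true⟩).ncard + (inc D γ η ⟨1, false⟩).ncard
  p := WW.o
  disj w x h1 h2 := by
    obtain ⟨k, a, b⟩ := two.inter h1 h2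
    exact a (Filter.mem_of_superset b (h.Uanti w (by norm_num)))
  neg_smul := wneg_smul
  pos_smul := wpos_smul
  lt_smul := wlt_smul
  flip_flip w := by simp [WW.flip]
  neg_flip := wflip
  irrefl w hw := Uinf h w (by norm_num) hw.1
  trans a b c h1 h2 := ⟨h2.1.trans ((AS.of_sub (h.Uanti b (by norm_num))).trans h1.1),
    h2.2.trans ((AS.of_sub (h.Uanti b (by norm_num))).trans h1.2)⟩
  ax3 a b c h1 h2 y := by
    refine two.or fun k => ?_
    by_cases hh : UU D γ c (-4) ∈ (η k).map y
    · exact Or.inl ((h2.2.trans ((AS.of_sub (h.Uanti b (by norm_num))).trans h1.1)).mem (map_cof (hη.cof k) y) hh)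
    · exact Or.inr hh
  fin4 a := ((inc_fin1 h hη ⟨1, a.s⟩ rfl).image _).subset (inc_sub a)
  ax4 a := by
    refine (ncard_le_ncard (inc_sub a) ((inc_fin1 h hη ⟨1, a.s⟩ rfl).image _)).trans ((ncard_image_le (inc_fin1 h hη ⟨1, a.s⟩ rfl)).trans ?_)
    cases a.s
    · exact Nat.le_add_left _ _
    · exact Nat.le_add_right _ _
  fin5 := fin5 h hη
  ax6p a b hab x hx := two.mono (fun k hk => hab.1.mem (map_cof (hη.cof k) x) (Filter.mem_of_superset hk (h.Uanti b (by norm_num)))) hx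
  ax6n a b hab x hx := two.mono (fun k hk hh => hk (Filter.mem_of_superset (hab.2.mem (map_cof (hη.cof k) x) hh) (h.Uanti a (by norm_num)))) hx
  ax7 := ax7 h hη
  ax7p w c hc := two.mono (fun k hk => hc.1.mem (map_cof (hη.cof k) _) hk) (pw1 h hη w)
  ax7n w c hc := two.mono (fun k hk hh => hk (hc.2.mem (map_cof (hη.cof k) _) hh)) (pw2 h hη w)
  free a w hw := by
    have := congrArg WW.o hw
    simpa [WW.smul_def] using this
lemma conjE (hc : Cut D) (i j : ℤ) : AS (MulAut.conj (γ ^ i) '' EE D γ j) (EE D γ (i + j)) ∧ AS (EE D γ (i + j)) (MulAut.conj (γ ^ i) '' EE D γ j) := by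
  have := conj_as hc (γ ^ i) (γ ^ j)
  rwa [← zpow_add] at this
lemma unb (hc : Cut D) (h : Pack D γ) (hη : Uf D γ η) (n : ℕ) : ∃ a : MulAut G, n ≤ (wallSys h hη).d 1 (a • 1) := by
  set w : ℤ → WW G := fun i => ⟨MulAut.conj (γ ^ i), true⟩ with hw
  have inj : Function.Injective w := by
    have key : ∀ i j, i < j → w i ≠ w j := by
      intro i j hij hh
      have e : MulAut.conj (γ ^ i) = MulAut.conj (γ ^ j) := congrArg WW.o hh
      have a1 := (conjE (γ := γ) hc i 0).2
      rw [e] at a1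
      have := a1.trans (conjE (γ := γ) hc j 0).1
      exact Einf h (by omega) this
    intro i j hij
    rcases lt_trichotomy i j with c | c | c
    · exact absurd hij (key _ _ c)
    · exact c
    · exact absurd hij.symm (key _ _ c)
  refine ⟨MulAut.conj (γ ^ ((n : ℤ) + 10)), ?_⟩
  have sub : w '' (Icc 5 (n + 5 : ℤ)) ⊆ (wallSys h hη).Sep 1 (MulAut.conj (γ ^ ((n : ℤ) + 10)) • 1) := by
    rintro _ ⟨i, ⟨i1, i2⟩, rfl⟩
    have m1 : ∀ e : Ultrafilter G, e.map (1 : MulAut G) = e := fun e => e.map_id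
    constructor
    · refine ⟨0, 2, by decide, fun hh => ?_, fun hh => ?_⟩ <;> rw [m1] at hh <;>
        have := (conjE (γ := γ) hc i (-4)).1.mem (hη.cof _) hh
      · exact hη.h0 (Filter.mem_of_superset this (h.Eanti (by omega)))
      · exact hη.h3 (Filter.mem_of_superset this (h.Eanti (by omega)))
    · have e : w i = MulAut.conj (γ ^ ((n : ℤ) + 10)) • w (i - (n + 10)) := by
        simp only [hw, WW.smul_def, ← map_mul, ← zpow_add]
        congr 3; ring
      rw [e]
      refine (wpos_smul _ _ _).2 ⟨1, 2, by decide, ?_, ?_⟩ <;> beta_reduce <;> rw [m1] <;>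
        refine (conjE (γ := γ) hc (i - (n + 10)) 4).2.mem (hη.cof _) ?_
      · exact Filter.mem_of_superset hη.h1 (h.Eanti (by omega))
      · exact Filter.mem_of_superset hη.h2 (h.Eanti (by omega))
  have := ncard_le_ncard sub ((wallSys h hη).sep_fin _ _)
  rw [ncard_image_of_injective _ inj, ← Finset.coe_Icc, ncard_coe_finset, Int.card_Icc] at this
  have e : ((n : ℤ) + 5 + 1 - 5).toNat = n + 1 := by omega
  rw [e] at this
  exact (Nat.le_succ n).trans this
lemma nvc (h : CutSys D) : ¬ VirtuallyCyclic (MulAut G) := by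
  rintro ⟨H, hf, hcy⟩
  obtain ⟨y1, y2, s1, s2, dj⟩ := h.y
  obtain ⟨m, m0, -, hm⟩ := H.exists_pow_mem_of_index_ne_zero hf.index_ne_zero (MulAut.conj y1)
  obtain ⟨k, k0, -, hk⟩ := H.exists_pow_mem_of_index_ne_zero hf.index_ne_zero (MulAut.conj y2)
  obtain ⟨g, hg⟩ := hcy.exists_generator
  obtain ⟨p, hp⟩ := hg ⟨_, hm⟩
  obtain ⟨q, hq⟩ := hg ⟨_, hk⟩
  have hp' : (g : MulAut G) ^ p = MulAut.conj (y1 ^ m) := by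
    rw [map_pow]; simpa using congrArg Subtype.val hp
  have hq' : (g : MulAut G) ^ q = MulAut.conj (y2 ^ k) := by
    rw [map_pow]; simpa using congrArg Subtype.val hq
  have cm : MulAut.conj (y1 ^ m * y2 ^ k) = MulAut.conj (y2 ^ k * y1 ^ m) := by
    rw [map_mul, map_mul, ← hp', ← hq', ← zpow_add, ← zpow_add, add_comm]
  have pw : ∀ (y : G), y • D ⊆ D → ∀ m : ℕ, y ^ m • D ⊆ D := by
    intro y hy m
    induction m with
    | zero => simp
    | succ m ih => rw [pow_succ, mul_smul]; exact (smul_set_mono hy).trans ih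
  have pw2 : ∀ (y : G), y • D ⊆ D → ∀ m : ℕ, 0 < m → ∀ Y ⊆ D, y ^ m • Y ⊆ y • D := by
    intro y hy m hm Y hY
    obtain ⟨m, rfl⟩ := Nat.exists_eq_succ_of_ne_zero hm.ne'
    rw [pow_succ', mul_smul]
    exact smul_set_mono ((smul_set_mono hY).trans (pw y hy m))
  have a1 := (conj_as h.toCut (y1 ^ m * y2 ^ k) 1).2
  rw [cm] at a1
  have := a1.trans (conj_as h.toCut (y2 ^ k * y1 ^ m) 1).1
  rw [mul_one, mul_one] at this
  refine h.toCut.infH (Cut.HHD (y1 ^ m * y2 ^ k)) (Set.Finite.subset this fun z hz => ⟨hz, fun hz' => ?_⟩)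
  rw [mul_smul] at hz hz'
  exact Set.disjoint_left.1 dj (pw2 y1 s1 m m0 _ (pw y2 s2 k) hz) (pw2 y2 s2 k k0 _ (pw y1 s1 m) hz')
end walls
theorem final (G : Type u) [Group G] (hfg : Group.FG G) (hends : InfinitelyManyEnds G) : AcylindricallyHyperbolic (MulAut G) := by
  obtain ⟨S, hS, h1S, D, hD⟩ := exists_cutsys hends
  obtain ⟨γ, hγ⟩ := hD.pack hS h1S
  obtain ⟨η, hη⟩ := exists_Uf hD.toCut hγ
  exact ⟨nvc hD, (wallSys hγ hη).criterion 1 (unb hD.toCut hγ hη)⟩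
end AH

/-- The automorphism group of every finitely generated group with infinitely many ends
is acylindrically hyperbolic. -/
theorem aut_acylindricallyHyperbolic_of_infinitelyManyEnds
    (G : Type u) [Group G] (hfg : Group.FG G) (hends : InfinitelyManyEnds G) :
    AcylindricallyHyperbolic (MulAut G) := by
  exact AH.final G hfg hends
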